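/- arXiv:1604.00101 — 2 statements merged into one kernel-verified Lean document; each statement's English description precedes it below -/
import Mathlib

section
/- Let σ = 1, let A be an index set, and for each a ∈ A let K_a = K_a(y) ∈ L₀ be a kernel independent of (t,x), and f_a : Q₁ → ℝ with sup_{a∈A} ‖f_a‖_{L∞(Q₁)} < ∞. Suppose u : (−∞,0) × ℝ^d → ℝ is smooth and bounded, δu(t,x,·) is integrable against |y|^{−d−1}, and u satisfies ∂_t u = inf_{a∈A}(L_a u + f_a) pointwise in Q₁. Then [u]_{Λ¹(Q_{1/2})} ≤ C (sup_{a∈A} ‖f_a‖_{L∞(Q₁)} + ‖u‖_{L∞((−∞,0)×ℝ^d)}), where C depends only on d, λ, and Λ. -/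
open MeasureTheory Set Metric ENNReal
open scoped Classical
noncomputable section

namespace Nonlocal

variable {d : ℕ}

/-- `d`-dimensional Euclidean space. -/
abbrev E (d : ℕ) : Type := EuclideanSpace ℝ (Fin d)

/-- The parabolic cylinder `Q_r(t,x) = (t - r^σ, t) × B_r(x)`. -/
def Q (σ r t : ℝ) (x : E d) : Set (ℝ × E d) := Ioo (t - r ^ σ) t ×ˢ ball x r

/-- `Q_r = Q_r(0,0)`. -/
def Q0 (d : ℕ) (σ r : ℝ) : Set (ℝ × E d) := Q σ r 0 (0 : E d)

/-- The lower half space `ℝ₀^{d+1} = (-∞,0) × ℝ^d`. -/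
def lowerHalf (d : ℕ) : Set (ℝ × E d) := Iio (0 : ℝ) ×ˢ (univ : Set (E d))

/-- The spatial differential `Du`. -/
def Du (u : ℝ × E d → ℝ) (z : ℝ × E d) : E d →L[ℝ] ℝ :=
  fderiv ℝ (fun x => u (z.1, x)) z.2

/-- The time derivative `∂_t u`. -/
def ut (u : ℝ × E d → ℝ) (z : ℝ × E d) : ℝ :=
  deriv (fun s => u (s, z.2)) z.1

/-- The increment `δu(t,x,y)`, whose form depends on the order `σ`. -/
def deltaU (σ : ℝ) (u : ℝ × E d → ℝ) (t : ℝ) (x y : E d) : ℝ :=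
  u (t, x + y) - u (t, x) -
    (if 1 < σ then Du u (t, x) y
      else if σ = 1 then (if ‖y‖ < 1 then Du u (t, x) y else 0) else 0)

/-- Ellipticity bounds `λ(2-σ)|y|^{-d-σ} ≤ K(y) ≤ Λ(2-σ)|y|^{-d-σ}`. -/
def kernelBounds (σ lam Lam : ℝ) (K : E d → ℝ) : Prop :=
  ∀ y : E d, y ≠ 0 →
    lam * (2 - σ) * ‖y‖ ^ (-((d : ℝ) + σ)) ≤ K y ∧
      K y ≤ Lam * (2 - σ) * ‖y‖ ^ (-((d : ℝ) + σ))

/-- Cancellation condition `∫_{∂B_r} y K(y) dS(y) = 0` for all `r > 0`,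
formulated equivalently via vanishing of the integrals over all annuli. -/
def cancels (K : E d → ℝ) : Prop :=
  ∀ r₁ r₂ : ℝ, 0 < r₁ → r₁ < r₂ →
    (∫ y in {y : E d | r₁ ≤ ‖y‖ ∧ ‖y‖ ≤ r₂}, K y • y) = 0

/-- Membership in the class `L₀`. -/
def memL0 (σ lam Lam : ℝ) (K : E d → ℝ) : Prop :=
  kernelBounds σ lam Lam K ∧ (σ = 1 → cancels K)

/-- The nonlocal operator `L u(t,x) = ∫ δu(t,x,y) K(y) dy` (translation invariant kernel). -/
def Lop (σ : ℝ) (K : E d → ℝ) (u : ℝ × E d → ℝ) (z : ℝ × E d) : ℝ :=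
  ∫ y, deltaU σ u z.1 z.2 y * K y

/-- The nonlocal operator with `(t,x)`-dependent kernel. -/
def LopTX (σ : ℝ) (K : ℝ × E d → E d → ℝ) (u : ℝ × E d → ℝ) (z : ℝ × E d) : ℝ :=
  ∫ y, deltaU σ u z.1 z.2 y * K z y

/-- The maximal Pucci extremal operator `M⁺`. -/
def Mplus (σ lam Lam : ℝ) (u : ℝ × E d → ℝ) (z : ℝ × E d) : ℝ :=
  if σ = 1 then sSup {v | ∃ K : E d → ℝ, memL0 1 lam Lam K ∧ v = Lop 1 K u z}
  else ∫ y, (Lam * max (deltaU σ u z.1 z.2 y) 0 - lam * max (-deltaU σ u z.1 z.2 y) 0) *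
      ((2 - σ) * ‖y‖ ^ (-((d : ℝ) + σ)))

/-- The minimal Pucci extremal operator `M⁻`. -/
def Mminus (σ lam Lam : ℝ) (u : ℝ × E d → ℝ) (z : ℝ × E d) : ℝ :=
  if σ = 1 then sInf {v | ∃ K : E d → ℝ, memL0 1 lam Lam K ∧ v = Lop 1 K u z}
  else ∫ y, (lam * max (deltaU σ u z.1 z.2 y) 0 - Lam * max (-deltaU σ u z.1 z.2 y) 0) *
      ((2 - σ) * ‖y‖ ^ (-((d : ℝ) + σ)))

variable {F : Type*} [NormedAddCommGroup F]

/-- The parabolic Hölder seminorm `[f]_{β,α;Ω}` (exponent `β` in time and `α` in space). -/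
def holderE (β α : ℝ) (Ω : Set (ℝ × E d)) (f : ℝ × E d → F) : ℝ≥0∞ :=
  ⨆ (p : Ω) (q : Ω), ENNReal.ofReal
    (‖f p.1 - f q.1‖ / max (‖p.1.2 - q.1.2‖ ^ α) (|p.1.1 - q.1.1| ^ β))

/-- The sup norm `‖f‖_{L∞(Ω)}`. -/
def supENorm (Ω : Set (ℝ × E d)) (f : ℝ × E d → F) : ℝ≥0∞ :=
  ⨆ p : Ω, ENNReal.ofReal ‖f p.1‖

/-- The full Hölder norm `‖f‖_{β,α;Ω}`. -/
def pnormE (β α : ℝ) (Ω : Set (ℝ × E d)) (f : ℝ × E d → ℝ) : ℝ≥0∞ :=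
  supENorm Ω f + holderE β α Ω f

/-- The seminorm `[u]_{1+α/σ, σ+α; Ω} = [D^ν u]_{α/σ, σ+α-ν; Ω} + [∂_t u]_{α/σ, σ+α-ν; Ω}`
with `ν = ⌊σ+α⌋`. -/
def parab2Semi (σ α : ℝ) (Ω : Set (ℝ × E d)) (u : ℝ × E d → ℝ) : ℝ≥0∞ :=
  holderE (α / σ) (σ + α - (⌊σ + α⌋₊ : ℝ)) Ω
      (fun z => iteratedFDeriv ℝ ⌊σ + α⌋₊ (fun x => u (z.1, x)) z.2)
    + holderE (α / σ) (σ + α - (⌊σ + α⌋₊ : ℝ)) Ω (fun z => ut u z)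

/-- General parabolic seminorm `[u]_{β/σ, β; Ω}` of order `β ≥ 0` (sup norm for `β = 0`);
a time-derivative term appears when `β > σ`. -/
def pSemiGen (σ β : ℝ) (Ω : Set (ℝ × E d)) (u : ℝ × E d → ℝ) : ℝ≥0∞ :=
  if β = 0 then supENorm Ω u
  else
    holderE (if σ < β then (β - σ) / σ else β / σ) (β - ((⌈β⌉₊ : ℝ) - 1)) Ω
        (fun z => iteratedFDeriv ℝ (⌈β⌉₊ - 1) (fun x => u (z.1, x)) z.2)
      + (if σ < β then
          holderE ((β - σ) / σ) (β - ((⌈β⌉₊ : ℝ) - 1)) Ω (fun z => ut u z) else 0)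

/-- Hölder seminorm in `x` only: `[f]^*_{β;Ω}`. -/
def holderX (β : ℝ) (Ω : Set (ℝ × E d)) (f : ℝ × E d → F) : ℝ≥0∞ :=
  ⨆ (t : ℝ) (x : E d) (y : E d) (_ : (t, x) ∈ Ω) (_ : (t, y) ∈ Ω),
    ENNReal.ofReal (‖f (t, x) - f (t, y)‖ / ‖x - y‖ ^ β)

/-- Hölder seminorm in `t` only: `[f]^t_{β;Ω}`. -/
def holderT (β : ℝ) (Ω : Set (ℝ × E d)) (f : ℝ × E d → F) : ℝ≥0∞ :=
  ⨆ (t : ℝ) (s : ℝ) (x : E d) (_ : (t, x) ∈ Ω) (_ : (s, x) ∈ Ω),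
    ENNReal.ofReal (‖f (t, x) - f (s, x)‖ / |t - s| ^ β)

/-- Zygmund seminorm in `t` only: `[u]^t_{Λ¹(Ω)}`. -/
def zygT (Ω : Set (ℝ × E d)) (u : ℝ × E d → ℝ) : ℝ≥0∞ :=
  ⨆ (t : ℝ) (x : E d) (h : ℝ) (_ : 0 < h) (_ : (t, x) ∈ Ω) (_ : (t + h, x) ∈ Ω)
    (_ : (t - h, x) ∈ Ω),
    ENNReal.ofReal (|u (t + h, x) + u (t - h, x) - 2 * u (t, x)| / h)

/-- Zygmund seminorm in `(t,x)`: `[u]_{Λ¹(Ω)}`. -/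
def zygFull (Ω : Set (ℝ × E d)) (u : ℝ × E d → ℝ) : ℝ≥0∞ :=
  ⨆ (z : ℝ × E d) (h : ℝ × E d) (_ : h ≠ 0) (_ : z ∈ Ω) (_ : z + h ∈ Ω) (_ : z - h ∈ Ω),
    ENNReal.ofReal (|u (z + h) + u (z - h) - 2 * u z| / ‖h‖)

/-- The function `P(t,x)` of Lemma 3.3. -/
def Pfun (σ : ℝ) (u : ℝ × E d → ℝ) (z : ℝ × E d) : ℝ :=
  ∫ y, max (deltaU σ u z.1 z.2 y - deltaU σ u 0 (0 : E d) y) 0 *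
    ((2 - σ) * ‖y‖ ^ (-((d : ℝ) + σ)))

/-- The function `N(t,x)` of Lemma 3.3. -/
def Nfun (σ : ℝ) (u : ℝ × E d → ℝ) (z : ℝ × E d) : ℝ :=
  ∫ y, max (-(deltaU σ u z.1 z.2 y - deltaU σ u 0 (0 : E d) y)) 0 *
    ((2 - σ) * ‖y‖ ^ (-((d : ℝ) + σ)))

/-- Mollification of `u` in the time variable: `u^{(R)}`. -/
def tmoll (σ R : ℝ) (η : ℝ → ℝ) (u : ℝ × E d → ℝ) : ℝ × E d → ℝ :=
  fun z => ∫ s : ℝ, (2 * u (z.1 - R ^ σ * s, z.2) - u (z.1 - 2 * R ^ σ * s, z.2)) * η (s - 1)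

/-- First-order Taylor expansion of `u^{(R)}` at the origin. -/
def tmollTaylor (σ R : ℝ) (η : ℝ → ℝ) (u : ℝ × E d → ℝ) : ℝ × E d → ℝ :=
  fun z => tmoll σ R η u (0, 0)
    + z.1 * derivWithin (fun s => tmoll σ R η u (s, (0 : E d))) (Iio (0 : ℝ)) 0
    + fderiv ℝ (fun x => tmoll σ R η u ((0 : ℝ), x)) 0 z.2

/-- Mollification of `u` in space-time (case `σ = 1`). -/
def stmoll (R : ℝ) (η : ℝ → ℝ) (ζ : E d → ℝ) (u : ℝ × E d → ℝ) : ℝ × E d → ℝ :=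
  fun z => ∫ w : ℝ × E d,
    (2 * u (z.1 - R * w.1, z.2 - R • w.2) - u (z.1 - 2 * R * w.1, z.2 - R • w.2)) *
      (η (w.1 - 1) * ζ w.2)

/-- First-order Taylor expansion of the space-time mollification at the origin. -/
def stmollTaylor (R : ℝ) (η : ℝ → ℝ) (ζ : E d → ℝ) (u : ℝ × E d → ℝ) : ℝ × E d → ℝ :=
  fun z => stmoll R η ζ u (0, 0)
    + z.1 * derivWithin (fun s => stmoll R η ζ u (s, (0 : E d))) (Iio (0 : ℝ)) 0
    + fderiv ℝ (fun x => stmoll R η ζ u ((0 : ℝ), x)) 0 z.2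

end Nonlocal
open MeasureTheory Set Metric ENNReal Nonlocal

theorem integrableOn_norm_rpow_ge {d : ℕ} {p s : ℝ} (hp : (d : ℝ) < p) (hs : 0 < s) :
    IntegrableOn (fun y : E d => ‖y‖ ^ (-p)) {y | s ≤ ‖y‖} := by
  have h0 : Integrable (fun y : E d => (1 + ‖y‖) ^ (-p)) :=
    integrable_one_add_norm (by simpa using hp)
  have hms : MeasurableSet {y : E d | s ≤ ‖y‖} := measurableSet_le measurable_const measurable_norm
  refine Integrable.mono' ((h0.const_mul ((s / (1 + s)) ^ (-p))).integrableOn (s := {y | s ≤ ‖y‖}))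
    ((measurable_norm.pow_const _).aestronglyMeasurable) ?_
  filter_upwards [ae_restrict_mem hms] with y hy
  have hy : s ≤ ‖y‖ := hy
  have hy0 : 0 < ‖y‖ := hs.trans_le hy
  rw [Real.norm_of_nonneg (by positivity), ← Real.mul_rpow (by positivity) (by positivity)]
  apply Real.rpow_le_rpow_of_nonpos (by positivity)
  · rw [div_mul_eq_mul_div, div_le_iff₀ (by positivity)]
    nlinarith
  · have : (0 : ℝ) ≤ d := by positivity
    linarith

open scoped Pointwise in
theorem setIntegral_norm_rpow_ge {d : ℕ} {p s : ℝ} (hs : 0 < s) :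
    ∫ y in {y : E d | s ≤ ‖y‖}, ‖y‖ ^ (-p)
      = s ^ ((d : ℝ) - p) * ∫ y in {y : E d | 1 ≤ ‖y‖}, ‖y‖ ^ (-p) := by
  have h := Measure.setIntegral_comp_smul_of_pos (volume : Measure (E d))
    (fun y : E d => ‖y‖ ^ (-p)) {y | 1 ≤ ‖y‖} hs
  have hset : s • {y : E d | 1 ≤ ‖y‖} = {y | s ≤ ‖y‖} := by
    ext y
    rw [mem_smul_set_iff_inv_smul_mem₀ hs.ne']
    simp only [mem_ofPred_eq, norm_smul, norm_inv, Real.norm_of_nonneg hs.le]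
    rw [inv_mul_eq_div, le_div_iff₀ hs, one_mul]
  rw [hset] at h
  have h2 : ∫ y in {y : E d | 1 ≤ ‖y‖}, ‖s • y‖ ^ (-p)
      = s ^ (-p) * ∫ y in {y : E d | 1 ≤ ‖y‖}, ‖y‖ ^ (-p) := by
    rw [← integral_const_mul]
    congr 1 with y
    rw [norm_smul, Real.norm_of_nonneg hs.le, Real.mul_rpow hs.le (norm_nonneg _)]
  rw [h2] at h
  simp only [finrank_euclideanSpace, Fintype.card_fin, smul_eq_mul] at h
  rw [sub_eq_add_neg, Real.rpow_add hs, Real.rpow_natCast, mul_assoc, h]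
  field_simp

/-- Measurable kernels of the class `L₀` of order one. -/
def IsKer {d : ℕ} (lam Lam : ℝ) (K : E d → ℝ) : Prop := memL0 1 lam Lam K ∧ Measurable K

namespace IsKer

variable {d : ℕ} {lam Lam : ℝ} {K : E d → ℝ}

theorem lower (h : IsKer lam Lam K) {y : E d} (hy : y ≠ 0) :
    lam * ‖y‖ ^ (-((d : ℝ) + 1)) ≤ K y := by
  have := (h.1.1 y hy).1
  norm_num at this ⊢
  linarith

theorem upper (h : IsKer lam Lam K) {y : E d} (hy : y ≠ 0) :
    K y ≤ Lam * ‖y‖ ^ (-((d : ℝ) + 1)) := by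
  have := (h.1.1 y hy).2
  norm_num at this ⊢
  linarith

theorem pos (h : IsKer lam Lam K) (hlam : 0 < lam) {y : E d} (hy : y ≠ 0) : 0 < K y := by
  have := norm_pos_iff.2 hy
  exact lt_of_lt_of_le (by positivity) (h.lower hy)

theorem integrableOn_linear (h : IsKer lam Lam K) (hlam : 0 < lam)
    (P : E d →L[ℝ] ℝ) {r₁ r₂ : ℝ} (hr : 0 < r₁) :
    IntegrableOn (fun y => P y * K y) {y : E d | r₁ ≤ ‖y‖ ∧ ‖y‖ ≤ r₂} := by
  have h0 := integrableOn_norm_rpow_ge (d := d) (p := d + 1) (by linarith) hr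
  have hms : MeasurableSet {y : E d | r₁ ≤ ‖y‖ ∧ ‖y‖ ≤ r₂} :=
    (measurableSet_le measurable_const measurable_norm).inter
      (measurableSet_le measurable_norm measurable_const)
  refine Integrable.mono' ((h0.mono_set (fun y hy => hy.1)).const_mul (‖P‖ * r₂ * Lam))
    (P.continuous.measurable.mul h.2).aestronglyMeasurable ?_
  filter_upwards [ae_restrict_mem hms] with y hy
  have hy1 : r₁ ≤ ‖y‖ := hy.1
  have hy2 : ‖y‖ ≤ r₂ := hy.2
  have hyp : 0 < ‖y‖ := hr.trans_le hy1
  have hy0 := norm_pos_iff.1 hyp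
  have hK := h.pos hlam hy0
  rw [norm_mul, Real.norm_of_nonneg hK.le, mul_assoc]
  refine mul_le_mul ?_ (h.upper hy0) hK.le (mul_nonneg (norm_nonneg _) (hyp.le.trans hy2))
  exact (P.le_opNorm y).trans (by gcongr)

theorem integral_linear_annulus (h : IsKer lam Lam K) (hlam : 0 < lam)
    (P : E d →L[ℝ] ℝ) {r₁ r₂ : ℝ} (hr : 0 < r₁) (hr2 : r₁ < r₂) :
    ∫ y in {y : E d | r₁ ≤ ‖y‖ ∧ ‖y‖ ≤ r₂}, P y * K y = 0 := by
  have hms : MeasurableSet {y : E d | r₁ ≤ ‖y‖ ∧ ‖y‖ ≤ r₂} :=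
    (measurableSet_le measurable_const measurable_norm).inter
      (measurableSet_le measurable_norm measurable_const)
  have hc := h.1.2 rfl r₁ r₂ hr hr2
  have hint : IntegrableOn (fun y => K y • y) {y : E d | r₁ ≤ ‖y‖ ∧ ‖y‖ ≤ r₂} := by
    have h0 := integrableOn_norm_rpow_ge (d := d) (p := d + 1) (by linarith) hr
    refine Integrable.mono' ((h0.mono_set (fun y hy => hy.1)).const_mul (r₂ * Lam))
      (h.2.smul measurable_id).aestronglyMeasurable ?_
    filter_upwards [ae_restrict_mem hms] with y hy
    have hy1 : r₁ ≤ ‖y‖ := hy.1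
    have hy2 : ‖y‖ ≤ r₂ := hy.2
    have hyp : 0 < ‖y‖ := hr.trans_le hy1
    have hy0 := norm_pos_iff.1 hyp
    have hK := h.pos hlam hy0
    rw [norm_smul, Real.norm_of_nonneg hK.le, mul_assoc, mul_comm]
    exact mul_le_mul hy2 (h.upper hy0) hK.le (by linarith)
  have := P.integral_comp_comm hint
  rw [hc, map_zero] at this
  rw [← this]
  congr 1 with y
  simp [mul_comm]

theorem integral_linear_halfopen (h : IsKer lam Lam K) (hlam : 0 < lam)
    (P : E d →L[ℝ] ℝ) {r₁ r₂ : ℝ} (hr : 0 < r₁) (hr2 : r₁ < r₂) :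
    IntegrableOn (fun y => P y * K y) {y : E d | r₁ ≤ ‖y‖ ∧ ‖y‖ < r₂} ∧
    ∫ y in {y : E d | r₁ ≤ ‖y‖ ∧ ‖y‖ < r₂}, P y * K y = 0 := by
  refine ⟨(h.integrableOn_linear hlam P hr (r₂ := r₂)).mono_set
    (fun y hy => ⟨hy.1, le_of_lt hy.2⟩), ?_⟩
  rw [← h.integral_linear_annulus hlam P hr hr2]
  apply setIntegral_congr_set
  have hsph : volume (sphere (0 : E d) r₂) = 0 :=
    Measure.addHaar_sphere_of_ne_zero _ _ (hr.trans hr2).ne'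
  have hsub : ∀ᵐ y : E d, y ∉ sphere (0 : E d) r₂ := measure_eq_zero_iff_ae_notMem.1 hsph
  filter_upwards [hsub] with y hy
  rw [mem_sphere_zero_iff_norm] at hy
  simp only [eq_iff_iff]
  exact ⟨fun hy' => ⟨hy'.1, hy'.2.le⟩, fun hy' => ⟨hy'.1, lt_of_le_of_ne hy'.2 hy⟩⟩

theorem cutoff_change (h : IsKer lam Lam K) (hlam : 0 < lam)
    (P : E d →L[ℝ] ℝ) {r₁ r₂ : ℝ} (hr : 0 < r₁) (hr2 : 0 < r₂) (D : E d → ℝ)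
    (hD : Integrable (fun y => (D y - if ‖y‖ < r₁ then P y else 0) * K y)) :
    Integrable (fun y => (D y - if ‖y‖ < r₂ then P y else 0) * K y) ∧
    ∫ y, (D y - if ‖y‖ < r₂ then P y else 0) * K y
      = ∫ y, (D y - if ‖y‖ < r₁ then P y else 0) * K y := by
  rcases lt_trichotomy r₁ r₂ with hlt | rfl | hlt
  · obtain ⟨h1, h2⟩ := h.integral_linear_halfopen hlam P hr hlt
    have hms : MeasurableSet {y : E d | r₁ ≤ ‖y‖ ∧ ‖y‖ < r₂} :=
      (measurableSet_le measurable_const measurable_norm).inter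
        (measurableSet_lt measurable_norm measurable_const)
    have heq : (fun y => (D y - if ‖y‖ < r₂ then P y else 0) * K y)
        = fun y => (D y - if ‖y‖ < r₁ then P y else 0) * K y
          - indicator {y : E d | r₁ ≤ ‖y‖ ∧ ‖y‖ < r₂} (fun y => P y * K y) y := by
      ext y
      simp only [indicator, mem_ofPred_eq]
      by_cases h1 : ‖y‖ < r₁
      · have h2 : ‖y‖ < r₂ := h1.trans hlt
        simp [h1, h2, h1.not_ge]
      · by_cases h2 : ‖y‖ < r₂
        · simp [h1, h2, not_lt.1 h1]; ring
        · simp [h1, h2]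
    rw [heq]
    have h1' := h1.integrable_indicator hms
    refine ⟨hD.sub h1', ?_⟩
    rw [integral_sub hD h1', integral_indicator hms, h2, sub_zero]
  · exact ⟨hD, rfl⟩
  · obtain ⟨h1, h2⟩ := h.integral_linear_halfopen hlam P hr2 hlt
    have hms : MeasurableSet {y : E d | r₂ ≤ ‖y‖ ∧ ‖y‖ < r₁} :=
      (measurableSet_le measurable_const measurable_norm).inter
        (measurableSet_lt measurable_norm measurable_const)
    have heq : (fun y => (D y - if ‖y‖ < r₂ then P y else 0) * K y)
        = fun y => (D y - if ‖y‖ < r₁ then P y else 0) * K y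
          + indicator {y : E d | r₂ ≤ ‖y‖ ∧ ‖y‖ < r₁} (fun y => P y * K y) y := by
      ext y
      simp only [indicator, mem_ofPred_eq]
      by_cases h1 : ‖y‖ < r₂
      · have h2 : ‖y‖ < r₁ := h1.trans hlt
        simp [h1, h2, h1.not_ge]
      · by_cases h2 : ‖y‖ < r₁
        · simp [h1, h2, not_lt.1 h1]; ring
        · simp [h1, h2]
    rw [heq]
    have h1' := h1.integrable_indicator hms
    refine ⟨hD.add h1', ?_⟩
    rw [integral_add hD h1', integral_indicator hms, h2, add_zero]

open scoped Pointwise in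
theorem scale (h : IsKer lam Lam K) {ρ : ℝ} (hρ : 0 < ρ) :
    IsKer lam Lam (fun y => ρ ^ (d + 1) * K (ρ • y)) := by
  have key : ∀ y : E d, ρ ^ (d + 1) * ‖ρ • y‖ ^ (-((d : ℝ) + 1)) = ‖y‖ ^ (-((d : ℝ) + 1)) := by
    intro y
    rw [norm_smul, Real.norm_of_nonneg hρ.le, Real.mul_rpow hρ.le (norm_nonneg _), ← mul_assoc,
      Real.rpow_neg hρ.le, show ((d : ℝ) + 1) = ((d + 1 : ℕ) : ℝ) by push_cast; ring,
      Real.rpow_natCast, mul_inv_cancel₀ (by positivity), one_mul]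
  refine ⟨⟨fun y hy => ?_, fun _ r₁ r₂ hr hr2 => ?_⟩, ?_⟩
  · have hy' : ρ • y ≠ 0 := smul_ne_zero hρ.ne' hy
    have h1 := mul_le_mul_of_nonneg_left (h.lower hy') (by positivity : 0 ≤ ρ ^ (d + 1))
    have h2 := mul_le_mul_of_nonneg_left (h.upper hy') (by positivity : 0 ≤ ρ ^ (d + 1))
    rw [mul_left_comm, key] at h1 h2
    norm_num at h1 h2 ⊢
    exact ⟨by linarith, by linarith⟩
  · have hc := h.1.2 rfl (ρ * r₁) (ρ * r₂) (by positivity) (by gcongr)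
    have hs := Measure.setIntegral_comp_smul_of_pos (volume : Measure (E d))
      (fun y : E d => K y • y) {y | r₁ ≤ ‖y‖ ∧ ‖y‖ ≤ r₂} hρ
    have hset : ρ • {y : E d | r₁ ≤ ‖y‖ ∧ ‖y‖ ≤ r₂} = {y | ρ * r₁ ≤ ‖y‖ ∧ ‖y‖ ≤ ρ * r₂} := by
      ext y
      rw [mem_smul_set_iff_inv_smul_mem₀ hρ.ne']
      simp only [mem_ofPred_eq, norm_smul, norm_inv, Real.norm_of_nonneg hρ.le]
      rw [inv_mul_eq_div, le_div_iff₀ hρ, div_le_iff₀ hρ, mul_comm r₁, mul_comm r₂]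
    rw [hset, hc, smul_zero] at hs
    have : ∀ y : E d, (ρ ^ (d + 1) * K (ρ • y)) • y = ρ ^ d • (K (ρ • y) • ρ • y) := by
      intro y
      simp only [smul_smul]
      congr 1
      ring
    simp only [this]
    rw [integral_smul, hs, smul_zero]
  · exact (h.2.comp (measurable_const_smul ρ)).const_mul _

end IsKer

/-- A nonnegative bump supported in the unit ball with a one-sided quadratic Taylor bound. -/
def bump {d : ℕ} (x : E d) : ℝ := max 0 (1 - ‖x‖ ^ 2) ^ 2

theorem bump_nonneg {d : ℕ} (x : E d) : 0 ≤ bump x := by unfold bump; positivity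

theorem bump_le_one {d : ℕ} (x : E d) : bump x ≤ 1 := by
  unfold bump
  have : max 0 (1 - ‖x‖ ^ 2) ≤ 1 := max_le zero_le_one (by nlinarith [norm_nonneg x])
  exact pow_le_one₀ (le_max_left _ _) this

theorem bump_eq_zero {d : ℕ} {x : E d} (hx : 1 ≤ ‖x‖) : bump x = 0 := by
  unfold bump
  rw [max_eq_left (by nlinarith)]
  norm_num

theorem continuous_bump {d : ℕ} : Continuous (bump : E d → ℝ) := by
  unfold bump
  fun_prop

theorem bump_ge_half {d : ℕ} {x : E d} (hx : ‖x‖ ≤ 1 / 2) : 9 / 16 ≤ bump x := by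
  unfold bump
  have h1 : (3 : ℝ) / 4 ≤ max 0 (1 - ‖x‖ ^ 2) :=
    le_max_of_le_right (by nlinarith [norm_nonneg x])
  nlinarith

theorem integrable_bump {d : ℕ} : Integrable (bump : E d → ℝ) := by
  apply continuous_bump.integrable_of_hasCompactSupport
  apply HasCompactSupport.intro (isCompact_closedBall (0 : E d) 1)
  intro x hx
  apply bump_eq_zero
  rw [mem_closedBall_zero_iff, not_le] at hx
  exact hx.le

theorem integral_bump_pos {d : ℕ} : 0 < ∫ x : E d, bump x := by
  rw [integral_pos_iff_support_of_nonneg bump_nonneg integrable_bump]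
  refine lt_of_lt_of_le (measure_ball_pos volume (0 : E d) (show (0 : ℝ) < 1 / 2 by norm_num))
    (measure_mono fun x hx => ?_)
  have := bump_ge_half (mem_ball_zero_iff.1 hx).le
  exact ne_of_gt (by linarith)

theorem bump_taylor {d : ℕ} (x y : E d) :
    bump x - 4 * max 0 (1 - ‖x‖ ^ 2) * inner ℝ x y - 2 * ‖y‖ ^ 2 ≤ bump (x + y) := by
  have hn : ‖x + y‖ ^ 2 = ‖x‖ ^ 2 + 2 * inner ℝ x y + ‖y‖ ^ 2 := norm_add_sq_real x y
  unfold bump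
  rw [hn]
  set a := max 0 (1 - ‖x‖ ^ 2) with ha
  set b := max 0 (1 - (‖x‖ ^ 2 + 2 * inner ℝ x y + ‖y‖ ^ 2)) with hb
  have ha0 : 0 ≤ a := le_max_left _ _
  have ha1 : a ≤ 1 := max_le zero_le_one (by nlinarith [norm_nonneg x])
  have hb0 : 1 - (‖x‖ ^ 2 + 2 * inner ℝ x y + ‖y‖ ^ 2) ≤ b := le_max_right _ _
  have h1 : a * a = a * (1 - ‖x‖ ^ 2) := by
    rcases max_cases 0 (1 - ‖x‖ ^ 2) with h | h
    · rw [ha, h.1]; ring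
    · rw [ha, h.1]
  nlinarith [sq_nonneg (b - a), mul_le_mul_of_nonneg_left hb0 ha0,
    mul_le_mul_of_nonneg_right ha1 (sq_nonneg ‖y‖)]

theorem nontrivial_E {d : ℕ} (hd : 1 ≤ d) : Nontrivial (E d) := by
  apply Module.nontrivial_of_finrank_pos (R := ℝ)
  rw [finrank_euclideanSpace, Fintype.card_fin]
  exact hd

theorem integrableOn_ball_sq_kernel {d : ℕ} (hd : 1 ≤ d) :
    IntegrableOn (fun y : E d => ‖y‖ ^ 2 * ‖y‖ ^ (-((d : ℝ) + 1))) (ball 0 1) := by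
  refine integrableOn_ball_of_norm_le_rpow (C := 1) (α := (d : ℝ) - 1) (by simpa using hd)
    (by simp) ?_ (by fun_prop)
  have := nontrivial_E hd
  have h0 : ∀ᵐ y : E d ∂(volume.restrict (ball 0 1)), y ≠ 0 :=
    ae_restrict_of_ae (Measure.ae_ne volume 0)
  filter_upwards [h0] with y hy
  have hy := norm_pos_iff.2 hy
  rw [Real.norm_of_nonneg (by positivity), ← Real.rpow_natCast, ← Real.rpow_add hy, one_mul]
  apply le_of_eq
  congr 1
  push_cast
  ring

theorem exists_small_radius {d : ℕ} (hd : 1 ≤ d) (A c b : ℝ) (hb : 0 < b) :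
    ∃ ρ : ℝ, 0 < ρ ∧ ρ ≤ 1 ∧
      ∫ y in ball (0 : E d) ρ, (A * (‖y‖ ^ 2 * ‖y‖ ^ (-((d : ℝ) + 1))) + c) ≤ b := by
  have hF : IntegrableOn (fun y : E d => A * (‖y‖ ^ 2 * ‖y‖ ^ (-((d : ℝ) + 1))) + c) (ball 0 1) :=
    ((integrableOn_ball_sq_kernel hd).const_mul A).add
      (integrableOn_const (measure_ball_lt_top.ne))
  have hlim := tendsto_setIntegral_of_antitone (μ := (volume : Measure (E d)))
    (s := fun n : ℕ => ball (0 : E d) (1 / ((n : ℝ) + 1)))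
    (f := fun y : E d => A * (‖y‖ ^ 2 * ‖y‖ ^ (-((d : ℝ) + 1))) + c)
    (fun n => measurableSet_ball)
    (fun n m hnm => ball_subset_ball (by
      have : (n : ℝ) ≤ m := by exact_mod_cast hnm
      gcongr)) ⟨0, by simpa using hF⟩
  have := nontrivial_E hd
  have hinter : (⋂ n : ℕ, ball (0 : E d) (1 / ((n : ℝ) + 1))) = {0} := by
    ext y
    simp only [mem_iInter, mem_ball_zero_iff, mem_singleton_iff]
    constructor
    · intro h
      by_contra hy
      obtain ⟨n, hn⟩ := exists_nat_one_div_lt (norm_pos_iff.2 hy)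
      exact lt_asymm hn (h n)
    · rintro rfl n
      rw [norm_zero]
      positivity
  rw [hinter, Measure.restrict_singleton] at hlim
  simp only [measure_singleton, zero_smul, integral_zero_measure] at hlim
  obtain ⟨n, hn⟩ := (hlim.eventually (ge_mem_nhds hb)).exists
  refine ⟨1 / ((n : ℝ) + 1), by positivity, ?_, hn⟩
  rw [div_le_one (by positivity)]
  have : (0 : ℝ) ≤ n := by positivity
  linarith

theorem IsKer.lower_of_norm_le_two {d : ℕ} {lam Lam : ℝ} {K : E d → ℝ} (h : IsKer lam Lam K)
    (hlam : 0 < lam) {y : E d} (hy : y ≠ 0) (hy2 : ‖y‖ ≤ 2) :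
    lam * (2 : ℝ) ^ (-((d : ℝ) + 1)) ≤ K y := by
  refine le_trans ?_ (h.lower hy)
  have := norm_pos_iff.2 hy
  exact mul_le_mul_of_nonneg_left (Real.rpow_le_rpow_of_nonpos this hy2
    (by have : (0 : ℝ) ≤ d := by positivity
        linarith)) hlam.le

/-- At a point where `φ + m • bump` is maximal up to a gain `ψ` and an excess `T`, its derivative is
determined by `bump`. -/
theorem fderiv_at_contact {d : ℕ} {m : ℝ} {x₀ : E d} (hm : 0 ≤ m) (hx₀ : ‖x₀‖ < 1)
    {φ T ψ : E d → ℝ} {P : E d →L[ℝ] ℝ} (hP : HasFDerivAt φ P x₀) (hψ : ∀ x, 0 ≤ ψ x)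
    (hT : ∀ x, ‖x‖ < 2 → T x = 0)
    (hmax : ∀ x, φ x + m * bump x ≤ φ x₀ + m * bump x₀ - ψ x + T x) (y : E d) :
    P y = 4 * m * max 0 (1 - ‖x₀‖ ^ 2) * inner ℝ x₀ y := by
  set a := max 0 (1 - ‖x₀‖ ^ 2)
  have hder : HasFDerivAt (fun x => φ x - 4 * m * a * inner ℝ x₀ x - 2 * m * ‖x - x₀‖ ^ 2)
      (P - (4 * m * a) • innerSL ℝ x₀ - (2 * m) • 0) x₀ := by
    refine (hP.sub ?_).sub ?_
    · simpa using ((innerSL ℝ x₀).hasFDerivAt (x := x₀)).const_mul (4 * m * a)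
    · have h1 : HasFDerivAt (fun x : E d => ‖x - x₀‖ ^ 2) (0 : E d →L[ℝ] ℝ) x₀ := by
        have := ((hasFDerivAt_id (𝕜 := ℝ) x₀).sub_const x₀).norm_sq
        simpa using this
      exact h1.const_mul (2 * m)
  have hloc : IsLocalMax (fun x => φ x - 4 * m * a * inner ℝ x₀ x - 2 * m * ‖x - x₀‖ ^ 2) x₀ := by
    filter_upwards [ball_mem_nhds x₀ one_pos] with x hx
    have h1 := hmax x
    have h2 := bump_taylor x₀ (x - x₀)
    have h3 : ‖x‖ < 2 := by
      have : ‖x‖ ≤ ‖x - x₀‖ + ‖x₀‖ := by simpa using norm_add_le (x - x₀) x₀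
      rw [mem_ball_iff_norm] at hx
      linarith
    rw [hT x h3] at h1
    rw [add_sub_cancel, inner_sub_right] at h2
    have h4 := mul_le_mul_of_nonneg_left h2 hm
    have h5 := hψ x
    simp only [sub_self, norm_zero]
    nlinarith
  have := DFunLike.congr_fun (hloc.hasFDerivAt_eq_zero hder) y
  simp at this
  linarith

/-- Evaluation of the nonlocal operators at a contact point with the bump barrier. -/
theorem contact_estimate {d : ℕ} (hd : 1 ≤ d) {lam Lam : ℝ} (hlam : 0 < lam) (hlL : lam ≤ Lam) :
    ∃ c C : ℝ, 0 < c ∧ 0 < C ∧ ∀ (K : E d → ℝ), IsKer lam Lam K →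
      ∀ (x₀ : E d) (m s : ℝ) (φ ψ T : E d → ℝ) (P : E d →L[ℝ] ℝ), ‖x₀‖ < 1 → 0 ≤ m → 0 < s →
      HasFDerivAt φ P x₀ →
      Integrable (fun y => (φ (x₀ + y) - φ x₀ - if ‖y‖ < s then P y else 0) * K y) →
      Integrable ψ → (∀ x, 0 ≤ ψ x) → (∀ x, 1 < ‖x‖ → ψ x = 0) →
      (∀ x, 0 ≤ T x) → (∀ x, ‖x‖ < 2 → T x = 0) →
      Integrable (fun y => T (x₀ + y) * ‖y‖ ^ (-((d : ℝ) + 1))) →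
      (∀ x, φ x + m * bump x ≤ φ x₀ + m * bump x₀ - ψ x + T x) →
      ∫ y, (φ (x₀ + y) - φ x₀ - if ‖y‖ < s then P y else 0) * K y
        ≤ C * m * bump x₀ - c * (∫ x, ψ x)
          + Lam * ∫ y, T (x₀ + y) * ‖y‖ ^ (-((d : ℝ) + 1)) := by
  set c : ℝ := lam * (2 : ℝ) ^ (-((d : ℝ) + 1)) with hc
  have hcpos : 0 < c := by positivity
  have hLam : 0 < Lam := hlam.trans_le hlL
  obtain ⟨ρ, hρ, hρ1, hρint⟩ := exists_small_radius hd (2 * Lam) c (c * ∫ x : E d, bump x)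
    (mul_pos hcpos integral_bump_pos)
  set J := ∫ y in {y : E d | ρ ≤ ‖y‖}, ‖y‖ ^ (-((d : ℝ) + 1)) with hJ
  have hJ0 : 0 ≤ J := integral_nonneg fun y => by positivity
  refine ⟨c, Lam * J + 1, hcpos, by positivity, ?_⟩
  intro K hK x₀ m s φ ψ T P hx₀ hm hs hP hint hψi hψ0 hψ1 hT0 hT2 hTi hmax
  obtain ⟨hint', heq⟩ := hK.cutoff_change hlam P hs hρ _ hint
  rw [← heq]
  have hPy := fderiv_at_contact hm hx₀ hP hψ0 hT2 hmax
  have := nontrivial_E hd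
  set F : E d → ℝ := fun y => 2 * Lam * (‖y‖ ^ 2 * ‖y‖ ^ (-((d : ℝ) + 1))) + c with hF
  have hFi : Integrable (indicator (ball 0 ρ) F) := by
    rw [integrable_indicator_iff measurableSet_ball]
    exact (((integrableOn_ball_sq_kernel hd).mono_set (ball_subset_ball hρ1)).const_mul _).add
      (integrableOn_const (measure_ball_lt_top.ne))
  have hms : MeasurableSet {y : E d | ρ ≤ ‖y‖} := measurableSet_le measurable_const measurable_norm
  have hκi : Integrable (indicator {y : E d | ρ ≤ ‖y‖} fun y => ‖y‖ ^ (-((d : ℝ) + 1))) := by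
    rw [integrable_indicator_iff hms]
    exact integrableOn_norm_rpow_ge (by linarith) hρ
  have hβi : Integrable (fun y => bump (x₀ + y)) := integrable_bump.comp_add_left x₀
  have hψi' : Integrable (fun y => ψ (x₀ + y)) := hψi.comp_add_left x₀
  have hb0 := bump_nonneg x₀
  have hle : ∀ᵐ y : E d, (φ (x₀ + y) - φ x₀ - if ‖y‖ < ρ then P y else 0) * K y ≤
      m * indicator (ball 0 ρ) F y
      + m * bump x₀ * Lam * indicator {y : E d | ρ ≤ ‖y‖} (fun y => ‖y‖ ^ (-((d : ℝ) + 1))) y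
      - m * c * bump (x₀ + y) - c * ψ (x₀ + y)
      + Lam * (T (x₀ + y) * ‖y‖ ^ (-((d : ℝ) + 1))) := by
    filter_upwards [Measure.ae_ne volume (0 : E d)] with y hy
    have hyp := norm_pos_iff.2 hy
    have hKp := hK.pos hlam hy
    have hKu := hK.upper hy
    have hκ0 : 0 < ‖y‖ ^ (-((d : ℝ) + 1)) := by positivity
    have hψK : c * ψ (x₀ + y) ≤ ψ (x₀ + y) * K y := by
      by_cases h1 : 1 < ‖x₀ + y‖
      · simp [hψ1 _ h1]
      · have : ‖y‖ ≤ 2 := by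
          have : ‖y‖ ≤ ‖x₀ + y‖ + ‖x₀‖ := by simpa using norm_sub_le (x₀ + y) x₀
          linarith
        have := hK.lower_of_norm_le_two hlam hy this
        nlinarith [hψ0 (x₀ + y)]
    have hβK : c * bump (x₀ + y) ≤ bump (x₀ + y) * K y := by
      by_cases h1 : 1 < ‖x₀ + y‖
      · simp [bump_eq_zero h1.le]
      · have : ‖y‖ ≤ 2 := by
          have : ‖y‖ ≤ ‖x₀ + y‖ + ‖x₀‖ := by simpa using norm_sub_le (x₀ + y) x₀
          linarith
        have := hK.lower_of_norm_le_two hlam hy this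
        nlinarith [bump_nonneg (x₀ + y)]
    have hTK : T (x₀ + y) * K y ≤ Lam * (T (x₀ + y) * ‖y‖ ^ (-((d : ℝ) + 1))) := by
      nlinarith [mul_le_mul_of_nonneg_left hKu (hT0 (x₀ + y))]
    have hmx := hmax (x₀ + y)
    by_cases hyρ : ‖y‖ < ρ
    · have hT : T (x₀ + y) = 0 := hT2 _ (by
        have := norm_add_le x₀ y
        linarith)
      have hmem : y ∈ ball (0 : E d) ρ := by simpa using hyρ
      have hnm : y ∉ {y : E d | ρ ≤ ‖y‖} := by simpa using hyρ
      rw [indicator_of_mem hmem, indicator_of_notMem hnm, if_pos hyρ, hPy y, hT]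
      rw [hT] at hmx
      have h2 := mul_le_mul_of_nonneg_left (bump_taylor x₀ y) hm
      have h3 : φ (x₀ + y) - φ x₀ - 4 * m * max 0 (1 - ‖x₀‖ ^ 2) * inner ℝ x₀ y
          ≤ 2 * m * ‖y‖ ^ 2 - ψ (x₀ + y) := by linarith
      have h4 := mul_le_mul_of_nonneg_right h3 hKp.le
      have h5 := mul_le_mul_of_nonneg_left hKu (show 0 ≤ 2 * m * ‖y‖ ^ 2 by positivity)
      have h6 : 0 ≤ m * c * (1 - bump (x₀ + y)) :=
        mul_nonneg (by positivity) (by linarith [bump_le_one (x₀ + y)])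
      simp only [hF]
      nlinarith
    · have hnmem : y ∉ ball (0 : E d) ρ := by simpa using hyρ
      have hm' : y ∈ {y : E d | ρ ≤ ‖y‖} := not_lt.1 hyρ
      rw [indicator_of_notMem hnmem, indicator_of_mem hm', if_neg hyρ]
      have h3 : φ (x₀ + y) - φ x₀ - 0
          ≤ m * bump x₀ - m * bump (x₀ + y) - ψ (x₀ + y) + T (x₀ + y) := by linarith
      have h4 := mul_le_mul_of_nonneg_right h3 hKp.le
      have h5 := mul_le_mul_of_nonneg_left hKu (show 0 ≤ m * bump x₀ by positivity)
      have h6 := mul_le_mul_of_nonneg_left hβK hm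
      nlinarith
  have i1 := hFi.const_mul m
  have i2 := hκi.const_mul (m * bump x₀ * Lam)
  have i3 := hβi.const_mul (m * c)
  have i4 := hψi'.const_mul c
  have i5 := hTi.const_mul Lam
  have i12 : Integrable fun y => m * indicator (ball 0 ρ) F y
      + m * bump x₀ * Lam * indicator {y : E d | ρ ≤ ‖y‖} (fun y => ‖y‖ ^ (-((d : ℝ) + 1))) y :=
    i1.add i2
  have i123 : Integrable fun y => m * indicator (ball 0 ρ) F y
      + m * bump x₀ * Lam * indicator {y : E d | ρ ≤ ‖y‖} (fun y => ‖y‖ ^ (-((d : ℝ) + 1))) y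
      - m * c * bump (x₀ + y) := i12.sub i3
  have i1234 : Integrable fun y => m * indicator (ball 0 ρ) F y
      + m * bump x₀ * Lam * indicator {y : E d | ρ ≤ ‖y‖} (fun y => ‖y‖ ^ (-((d : ℝ) + 1))) y
      - m * c * bump (x₀ + y) - c * ψ (x₀ + y) := i123.sub i4
  refine (integral_mono_ae hint' (i1234.add i5) hle).trans ?_
  simp only [Pi.add_apply]
  rw [integral_add i1234 i5, integral_sub i123 i4, integral_sub i12 i3, integral_add i1 i2]
  simp only [integral_const_mul]
  have e1 : ∫ y, bump (x₀ + y) = ∫ x : E d, bump x :=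
    integral_add_left_eq_self (μ := volume) (fun y => bump y) x₀
  have e2 : ∫ y, ψ (x₀ + y) = ∫ x : E d, ψ x :=
    integral_add_left_eq_self (μ := volume) (fun y => ψ y) x₀
  rw [integral_indicator measurableSet_ball, integral_indicator hms, e1, e2]
  have h1 := mul_le_mul_of_nonneg_left hρint hm
  have h2 : 0 ≤ m * bump x₀ := by positivity
  rw [← hJ]
  nlinarith

/-- A solution of `m' = c g - C m` vanishing at `-1`. -/
theorem exists_ode_weight {c C M : ℝ} (hc : 0 ≤ c) (hC : 0 ≤ C) {g : ℝ → ℝ} (hg : Continuous g)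
    (hg0 : ∀ t, 0 ≤ g t) (hgM : ∀ t, -1 ≤ t → g t ≤ M) :
    ∃ m : ℝ → ℝ, m (-1) = 0 ∧ (∀ t, HasDerivAt m (c * g t - C * m t) t) ∧
      (∀ t, -1 ≤ t → t ≤ 0 → 0 ≤ m t ∧ m t ≤ c * M) ∧
      ∀ t, -(1 / 2) ≤ t → t ≤ 0 →
        c * Real.exp (-C) * ∫ s in (-1 : ℝ)..(-(1 / 2)), g s ≤ m t := by
  have hk : Continuous fun s => Real.exp (C * s) * g s := by fun_prop
  have hk0 : ∀ s, 0 ≤ Real.exp (C * s) * g s := fun s => mul_nonneg (Real.exp_pos _).le (hg0 s)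
  have hM : 0 ≤ M := (hg0 0).trans (hgM 0 (by norm_num))
  refine ⟨fun t => c * Real.exp (-C * t) * ∫ s in (-1 : ℝ)..t, Real.exp (C * s) * g s,
    by simp, fun t => ?_, fun t ht ht0 => ⟨?_, ?_⟩, fun t ht ht0 => ?_⟩
  · have h1 : HasDerivAt (fun t => Real.exp (-C * t)) (Real.exp (-C * t) * (-C)) t := by
      simpa using ((hasDerivAt_id t).const_mul (-C)).exp
    have h2 := intervalIntegral.integral_hasDerivAt_right (hk.intervalIntegrable (-1) t)
      hk.stronglyMeasurable.stronglyMeasurableAtFilter hk.continuousAt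
    refine ((h1.const_mul c).mul h2).congr_deriv ?_
    have : Real.exp (-C * t) * Real.exp (C * t) = 1 := by rw [← Real.exp_add]; simp
    linear_combination (c * g t) * this
  · exact mul_nonneg (by positivity)
      (intervalIntegral.integral_nonneg_of_forall ht hk0)
  · have h1 : ∫ s in (-1 : ℝ)..t, Real.exp (C * s) * g s ≤ ∫ s in (-1 : ℝ)..t, Real.exp (C * t) * M := by
      refine intervalIntegral.integral_mono_on ht (hk.intervalIntegrable _ _)
        (continuous_const.intervalIntegrable _ _) fun s hs => ?_
      have : Real.exp (C * s) ≤ Real.exp (C * t) :=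
        Real.exp_le_exp.2 (mul_le_mul_of_nonneg_left hs.2 hC)
      exact mul_le_mul this (hgM s hs.1) (hg0 s) (Real.exp_pos _).le
    rw [intervalIntegral.integral_const, smul_eq_mul] at h1
    have h2 : Real.exp (-C * t) * Real.exp (C * t) = 1 := by rw [← Real.exp_add]; simp
    have h3 : (0 : ℝ) < Real.exp (-C * t) := Real.exp_pos _
    calc c * Real.exp (-C * t) * ∫ s in (-1 : ℝ)..t, Real.exp (C * s) * g s
        ≤ c * Real.exp (-C * t) * ((t - -1) * (Real.exp (C * t) * M)) :=
          mul_le_mul_of_nonneg_left h1 (by positivity)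
      _ = c * M * (t + 1) * (Real.exp (-C * t) * Real.exp (C * t)) := by ring
      _ ≤ c * M := by
          rw [h2]
          have : 0 ≤ c * M := by positivity
          nlinarith
  · have h1 : ∫ s in (-1 : ℝ)..(-(1 / 2)), Real.exp (-C) * g s
        ≤ ∫ s in (-1 : ℝ)..(-(1 / 2)), Real.exp (C * s) * g s := by
      refine intervalIntegral.integral_mono_on (by norm_num)
        ((hg.const_smul (Real.exp (-C))).intervalIntegrable _ _)
        (hk.intervalIntegrable _ _) fun s hs => ?_
      exact mul_le_mul_of_nonneg_right (Real.exp_le_exp.2 (by nlinarith [hs.1])) (hg0 s)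
    have h2 : ∫ s in (-1 : ℝ)..(-(1 / 2)), Real.exp (C * s) * g s
        ≤ ∫ s in (-1 : ℝ)..t, Real.exp (C * s) * g s :=
      intervalIntegral.integral_mono_interval le_rfl (by norm_num) ht
        (Filter.Eventually.of_forall hk0) (hk.intervalIntegrable _ _)
    rw [intervalIntegral.integral_const_mul] at h1
    have h3 : 1 ≤ Real.exp (-C * t) := Real.one_le_exp (by nlinarith)
    have h4 : 0 ≤ ∫ s in (-1 : ℝ)..t, Real.exp (C * s) * g s :=
      intervalIntegral.integral_nonneg_of_forall (by linarith) hk0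
    calc c * Real.exp (-C) * ∫ s in (-1 : ℝ)..(-(1 / 2)), g s
        = c * (Real.exp (-C) * ∫ s in (-1 : ℝ)..(-(1 / 2)), g s) := by ring
      _ ≤ c * ∫ s in (-1 : ℝ)..t, Real.exp (C * s) * g s :=
          mul_le_mul_of_nonneg_left (h1.trans h2) hc
      _ ≤ c * Real.exp (-C * t) * ∫ s in (-1 : ℝ)..t, Real.exp (C * s) * g s := by
          nlinarith [mul_nonneg hc h4]

theorem HasDerivAt.nonneg_of_isMaxOn_left {f : ℝ → ℝ} {f' a t₀ : ℝ} (hf : HasDerivAt f f' t₀)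
    (ha : a < t₀) (hmax : ∀ t, a ≤ t → t ≤ t₀ → f t ≤ f t₀) : 0 ≤ f' := by
  have h1 : IsLocalMaxOn f (Icc a t₀) t₀ :=
    IsMaxOn.localize fun t ht => hmax t ht.1 ht.2
  have h2 := h1.hasFDerivWithinAt_nonpos (y := a - t₀) hf.hasFDerivAt.hasFDerivWithinAt
    (sub_mem_posTangentConeAt_of_segment_subset (by
      rw [segment_symm, segment_eq_Icc ha.le]))
  simp at h2
  nlinarith

/-- `W` satisfies `∂ₜ W ≤ L W + ε` at `z` for some admissible kernel. -/
def SubAt {d : ℕ} (lam Lam : ℝ) (W : ℝ × E d → ℝ) (z : ℝ × E d) (ε : ℝ) : Prop :=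
  ∃ (τ : ℝ) (P : E d →L[ℝ] ℝ) (K : E d → ℝ) (s : ℝ), 0 < s ∧
    HasDerivAt (fun t => W (t, z.2)) τ z.1 ∧ HasFDerivAt (fun x => W (z.1, x)) P z.2 ∧
    IsKer lam Lam K ∧
    Integrable (fun y => (W (z.1, z.2 + y) - W z - if ‖y‖ < s then P y else 0) * K y) ∧
    τ ≤ (∫ y, (W (z.1, z.2 + y) - W z - if ‖y‖ < s then P y else 0) * K y) + ε

/-- The mass of `{W < 1/2}` in the unit ball at time `min t 0`. -/
def lowMass {d : ℕ} (W : ℝ × E d → ℝ) (t : ℝ) : ℝ :=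
  ∫ x in closedBall (0 : E d) 1, max 0 (1 / 2 - W (min t 0, x))

theorem continuous_comp_min {d : ℕ} {W : ℝ × E d → ℝ} (hW : ContinuousOn W (Iic 0 ×ˢ univ)) :
    Continuous fun p : ℝ × E d => W (min p.1 0, p.2) :=
  hW.comp_continuous (by fun_prop) fun p => ⟨mem_Iic.2 (min_le_right _ _), mem_univ _⟩

theorem continuous_lowMass {d : ℕ} {W : ℝ × E d → ℝ} (hW : ContinuousOn W (Iic 0 ×ˢ univ)) :
    Continuous (lowMass W) := by
  have h := continuous_comp_min hW
  exact continuous_parametric_integral_of_continuous (μ := volume)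
    (f := fun t (x : E d) => max 0 (1 / 2 - W (min t 0, x)))
    (continuous_const.max (continuous_const.sub h)) (isCompact_closedBall (0 : E d) 1)

theorem lowMass_nonneg {d : ℕ} (W : ℝ × E d → ℝ) (t : ℝ) : 0 ≤ lowMass W t :=
  integral_nonneg fun _ => le_max_left _ _

/-- The volume of the unit ball. -/
def ballVol (d : ℕ) : ℝ := (volume : Measure (E d)).real (closedBall (0 : E d) 1)

theorem ballVol_pos (d : ℕ) : 0 < ballVol d :=
  ENNReal.toReal_pos (measure_closedBall_pos volume _ one_pos).ne' measure_closedBall_lt_top.ne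

theorem integrableOn_lowMass {d : ℕ} {W : ℝ × E d → ℝ} (hW : ContinuousOn W (Iic 0 ×ˢ univ))
    (t : ℝ) : IntegrableOn (fun x => max 0 (1 / 2 - W (min t 0, x))) (closedBall (0 : E d) 1) := by
  have h := (continuous_comp_min hW).comp (Continuous.prodMk_right t)
  exact ((continuous_const.max (continuous_const.sub h)).continuousOn).integrableOn_compact
    (isCompact_closedBall _ _)

/-- One-sided improvement: a subsolution below `1` with enough mass below `1/2` in the past
is strictly below `1` in a smaller cylinder. -/
theorem exists_one_sided_decay {d : ℕ} (hd : 1 ≤ d) {lam Lam : ℝ} (hlam : 0 < lam)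
    (hlL : lam ≤ Lam) :
    ∃ θ : ℝ, 0 < θ ∧ θ ≤ 1 / 2 ∧ ∀ (W : ℝ × E d → ℝ) (T : E d → ℝ), ContinuousOn W (Iic 0 ×ˢ univ) →
      (∀ t x, -1 < t → t ≤ 0 → ‖x‖ < 1 → SubAt lam Lam W (t, x) θ) →
      (∀ t x, -1 ≤ t → t ≤ 0 → W (t, x) ≤ 1 + T x) →
      (∀ t x, -1 ≤ t → t ≤ 0 → ‖x‖ ≤ 1 → -1 ≤ W (t, x)) →
      (∀ x, 0 ≤ T x) → (∀ x, ‖x‖ < 2 → T x = 0) →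
      (∀ x₀, ‖x₀‖ < 1 → Integrable (fun y => T (x₀ + y) * ‖y‖ ^ (-((d : ℝ) + 1))) ∧
        Lam * ∫ y, T (x₀ + y) * ‖y‖ ^ (-((d : ℝ) + 1)) ≤ θ / 2) →
      ballVol d / 4 ≤ ∫ s in (-1 : ℝ)..(-(1 / 2)), lowMass W s →
      ∀ t x, -(1 / 2) ≤ t → t ≤ 0 → ‖x‖ ≤ 1 / 2 → W (t, x) ≤ 1 - 2 * θ := by
  obtain ⟨c, C, hc, hC, hcon⟩ := contact_estimate hd hlam hlL
  have hv := ballVol_pos d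
  set c' : ℝ := min c (1 / (3 * ballVol d)) with hc'
  have hc'0 : 0 < c' := by positivity
  have hc'c : c' ≤ c := min_le_left _ _
  have hc'v : c' * (3 / 2 * ballVol d) ≤ 1 / 2 := by
    have : c' ≤ 1 / (3 * ballVol d) := min_le_right _ _
    rw [le_div_iff₀ (by positivity)] at this
    linarith
  set θ : ℝ := 9 / 64 * (c' * Real.exp (-C) * (ballVol d / 4)) with hθ
  have hθ0 : 0 < θ := by positivity
  have hθ1 : θ ≤ 1 / 2 := by
    have h1 : Real.exp (-C) ≤ 1 := Real.exp_le_one_iff.2 (by linarith)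
    have h2 : c' * ballVol d * Real.exp (-C) ≤ c' * ballVol d :=
      mul_le_of_le_one_right (by positivity) h1
    rw [hθ]
    nlinarith
  refine ⟨θ, hθ0, hθ1, fun W T hW hsub hup hlow hT0 hT2 hTi hmass => ?_⟩
  have hWc := continuous_comp_min hW
  have hgM : ∀ t, -1 ≤ t → lowMass W t ≤ 3 / 2 * ballVol d := by
    intro t ht
    have : lowMass W t ≤ ∫ x in closedBall (0 : E d) 1, (3 / 2 : ℝ) := by
      refine setIntegral_mono_on (integrableOn_lowMass hW t)
        (integrableOn_const (measure_closedBall_lt_top.ne)) measurableSet_closedBall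
        fun x hx => ?_
      have := hlow (min t 0) x (le_min ht (by norm_num)) (min_le_right _ _) (by simpa using hx)
      exact max_le (by norm_num) (by linarith)
    refine this.trans (le_of_eq ?_)
    rw [setIntegral_const, smul_eq_mul, mul_comm]
    rfl
  obtain ⟨m, hm1, hmd, hmb, hml⟩ := exists_ode_weight hc'0.le hC.le (continuous_lowMass hW)
    (lowMass_nonneg W) hgM
  have hmc : Continuous m := continuous_iff_continuousAt.2 fun t => (hmd t).continuousAt
  have hT1 : ∀ x, ‖x‖ ≤ 1 → T x = 0 := fun x hx => hT2 x (by linarith)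
  have hclaim : ∀ p ∈ Icc (-1 : ℝ) 0 ×ˢ closedBall (0 : E d) 1,
      W (min p.1 0, p.2) + m p.1 * bump p.2 - 2 * θ * (p.1 + 1) ≤ 1 := by
    have hcont : Continuous fun p : ℝ × E d =>
        W (min p.1 0, p.2) + m p.1 * bump p.2 - 2 * θ * (p.1 + 1) :=
      (hWc.add ((hmc.comp continuous_fst).mul (continuous_bump.comp continuous_snd))).sub
        (by fun_prop)
    obtain ⟨⟨t₀, x₀⟩, ⟨⟨ht1, ht0⟩, hx⟩, hmax⟩ := (isCompact_Icc.prod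
      (isCompact_closedBall (0 : E d) 1)).exists_isMaxOn
      ⟨((0 : ℝ), (0 : E d)), right_mem_Icc.2 (show (-1 : ℝ) ≤ 0 by norm_num), mem_closedBall_self zero_le_one⟩ hcont.continuousOn
    intro p hp
    by_contra! hlt
    have hgt := hlt.trans_le (hmax hp)
    simp only at ht1 ht0 hx
    have hmin : min t₀ 0 = t₀ := min_eq_left ht0
    simp only [hmin] at hgt
    have hx1 : ‖x₀‖ ≤ 1 := by simpa using hx
    have hW1 : W (t₀, x₀) ≤ 1 := by simpa [hT1 x₀ hx1] using hup t₀ x₀ ht1 ht0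
    have htt : 0 ≤ 2 * θ * (t₀ + 1) := mul_nonneg (by positivity) (by linarith)
    have hx1' : ‖x₀‖ < 1 := by
      refine lt_of_le_of_ne hx1 fun h => ?_
      rw [bump_eq_zero h.ge] at hgt
      linarith
    have ht1' : -1 < t₀ := by
      refine lt_of_le_of_ne ht1 fun h => ?_
      rw [← h, hm1] at hgt
      rw [← h] at hW1
      linarith
    obtain ⟨hm0, hmM⟩ := hmb t₀ ht1 ht0
    obtain ⟨τ, P, K, s, hs, hτ, hP, hK, hint, hle⟩ := hsub t₀ x₀ ht1' ht0 hx1'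
    simp only at hτ hP hint hle
    set ψ : E d → ℝ := indicator (closedBall 0 1) fun x => max 0 (1 / 2 - W (min t₀ 0, x)) with hψ
    have hψi : Integrable ψ :=
      (integrable_indicator_iff measurableSet_closedBall).2 (integrableOn_lowMass hW t₀)
    have hψint : ∫ x, ψ x = lowMass W t₀ := integral_indicator measurableSet_closedBall
    have hcomp : ∀ x, W (t₀, x) + m t₀ * bump x ≤ W (t₀, x₀) + m t₀ * bump x₀ - ψ x + T x := by
      intro x
      by_cases hx2 : ‖x‖ ≤ 1
      · have hmem : x ∈ closedBall (0 : E d) 1 := by simpa using hx2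
        have h1 := hmax (show ((t₀, x) : ℝ × E d) ∈ Icc (-1 : ℝ) 0 ×ˢ closedBall (0 : E d) 1 from
          ⟨⟨ht1, ht0⟩, hmem⟩)
        simp only [mem_ofPred_eq, hmin] at h1
        rw [hψ, indicator_of_mem hmem, hT1 x hx2, hmin]
        have h2 : m t₀ * bump x ≤ m t₀ := mul_le_of_le_one_right hm0 (bump_le_one x)
        rcases max_cases 0 (1 / 2 - W (t₀, x)) with h | h <;> rw [h.1] <;> linarith
      · have hmem : x ∉ closedBall (0 : E d) 1 := by simpa using hx2
        rw [hψ, indicator_of_notMem hmem, bump_eq_zero (not_le.1 hx2).le]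
        have := hup t₀ x ht1 ht0
        linarith
    obtain ⟨hTi1, hTi2⟩ := hTi x₀ hx1'
    have hest := hcon K hK x₀ (m t₀) s (fun x => W (t₀, x)) ψ T P hx1' hm0 hs hP hint hψi
      (fun x => indicator_nonneg (fun _ _ => le_max_left _ _) x)
      (fun x hx => indicator_of_notMem (by simpa using hx) _) hT0 hT2 hTi1 hcomp
    rw [hψint] at hest
    have hder : HasDerivAt (fun t => W (t, x₀) + m t * bump x₀ - 2 * θ * (t + 1))
        (τ + (c' * lowMass W t₀ - C * m t₀) * bump x₀ - 2 * θ * 1) t₀ :=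
      (hτ.add ((hmd t₀).mul_const _)).sub (((hasDerivAt_id t₀).add_const 1).const_mul _)
    have hnn := hder.nonneg_of_isMaxOn_left ht1' (fun t h1 h2 => by
      have h3 := hmax (show ((t, x₀) : ℝ × E d) ∈ Icc (-1 : ℝ) 0 ×ˢ closedBall (0 : E d) 1 from
          ⟨⟨h1, h2.trans ht0⟩, hx⟩)
      simpa only [mem_ofPred_eq, hmin, min_eq_left (h2.trans ht0)] using h3)
    have hg0 := lowMass_nonneg W t₀
    have h5 : c' * lowMass W t₀ * bump x₀ ≤ c * lowMass W t₀ :=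
      (mul_le_of_le_one_right (by positivity) (bump_le_one x₀)).trans
        (mul_le_mul_of_nonneg_right hc'c hg0)
    linarith
  intro t x ht ht0 hx
  have h1 := hclaim (t, x) ⟨⟨by simp only; linarith, ht0⟩, by simp only [mem_closedBall, dist_zero_right]; linarith⟩
  simp only [min_eq_left ht0] at h1
  have h2 := hml t ht ht0
  have h3 := bump_ge_half hx
  have h4 : c' * Real.exp (-C) * (ballVol d / 4) ≤ m t :=
    (mul_le_mul_of_nonneg_left hmass (by positivity)).trans h2
  have h5 : c' * Real.exp (-C) * (ballVol d / 4) * (9 / 16) ≤ m t * bump x :=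
    mul_le_mul h4 h3 (by norm_num) (hmb t (by linarith) ht0).1
  have h6 : c' * Real.exp (-C) * (ballVol d / 4) * (9 / 16) = 4 * θ := by rw [hθ]; ring
  nlinarith

/-- The majorant of the exterior growth: `8 √‖x‖` beyond radius `R`, plus `B` beyond radius `s`. -/
def tailFn {d : ℕ} (R s B : ℝ) (x : E d) : ℝ :=
  (if R ≤ ‖x‖ then 8 * √‖x‖ else 0) + if max s R ≤ ‖x‖ then B else 0

theorem tailFn_nonneg {d : ℕ} {R s B : ℝ} (hB : 0 ≤ B) (x : E d) : 0 ≤ tailFn R s B x := by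
  unfold tailFn
  positivity

theorem exists_tail_bound (d : ℕ) :
    ∃ C : ℝ, 0 < C ∧ ∀ (R s B : ℝ) (x₀ : E d), 2 ≤ R → 0 < s → 0 ≤ B → ‖x₀‖ < 1 →
      Integrable (fun y => tailFn R s B (x₀ + y) * ‖y‖ ^ (-((d : ℝ) + 1))) ∧
      ∫ y, tailFn R s B (x₀ + y) * ‖y‖ ^ (-((d : ℝ) + 1)) ≤ C * (1 / √R) + C * (B / s) := by
  set J₁ : ℝ := ∫ y in {y : E d | 1 ≤ ‖y‖}, ‖y‖ ^ (-((d : ℝ) + 1 / 2)) with hJ₁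
  set J₂ : ℝ := ∫ y in {y : E d | 1 ≤ ‖y‖}, ‖y‖ ^ (-((d : ℝ) + 1)) with hJ₂
  have hJ₁0 : 0 ≤ J₁ := integral_nonneg fun y => by positivity
  have hJ₂0 : 0 ≤ J₂ := integral_nonneg fun y => by positivity
  refine ⟨32 * J₁ + 2 * J₂ + 1, by positivity, fun R s B x₀ hR hs hB hx₀ => ?_⟩
  have hR0 : 0 < R := by linarith
  set S := max s R with hS
  have hS0 : 0 < S := lt_max_of_lt_left hs
  have hms : ∀ a : ℝ, MeasurableSet {y : E d | a ≤ ‖y‖} := fun a =>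
    measurableSet_le measurable_const measurable_norm
  have i1 : Integrable (indicator {y : E d | R / 2 ≤ ‖y‖} fun y => ‖y‖ ^ (-((d : ℝ) + 1 / 2))) :=
    (integrable_indicator_iff (hms _)).2 (integrableOn_norm_rpow_ge (by linarith) (by positivity))
  have i2 : Integrable (indicator {y : E d | S / 2 ≤ ‖y‖} fun y => ‖y‖ ^ (-((d : ℝ) + 1))) :=
    (integrable_indicator_iff (hms _)).2 (integrableOn_norm_rpow_ge (by linarith) (by positivity))
  have hle : ∀ y : E d, tailFn R s B (x₀ + y) * ‖y‖ ^ (-((d : ℝ) + 1)) ≤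
      16 * indicator {y : E d | R / 2 ≤ ‖y‖} (fun y => ‖y‖ ^ (-((d : ℝ) + 1 / 2))) y
      + B * indicator {y : E d | S / 2 ≤ ‖y‖} (fun y => ‖y‖ ^ (-((d : ℝ) + 1))) y := by
    intro y
    have hn : ‖x₀ + y‖ ≤ ‖x₀‖ + ‖y‖ := norm_add_le _ _
    unfold tailFn
    rw [add_mul]
    refine add_le_add ?_ ?_
    · by_cases h : R ≤ ‖x₀ + y‖
      · have hmem : y ∈ {y : E d | R / 2 ≤ ‖y‖} := show R / 2 ≤ ‖y‖ by linarith
        have hy : 0 < ‖y‖ := by linarith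
        rw [if_pos h, indicator_of_mem hmem]
        have h1 : √‖x₀ + y‖ ≤ 2 * √‖y‖ := by
          rw [show (2 : ℝ) * √‖y‖ = √(4 * ‖y‖) by
            rw [Real.sqrt_mul (by norm_num), show (4 : ℝ) = 2 ^ 2 by norm_num,
              Real.sqrt_sq (by norm_num)]]
          exact Real.sqrt_le_sqrt (by linarith)
        have h2 : √‖y‖ * ‖y‖ ^ (-((d : ℝ) + 1)) = ‖y‖ ^ (-((d : ℝ) + 1 / 2)) := by
          rw [Real.sqrt_eq_rpow, ← Real.rpow_add hy]
          congr 1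
          ring
        rw [← h2, ← mul_assoc]
        exact mul_le_mul_of_nonneg_right (by linarith) (by positivity)
      · rw [if_neg h, zero_mul]
        exact mul_nonneg (by norm_num) (indicator_nonneg (fun _ _ => by positivity) _)
    · by_cases h : S ≤ ‖x₀ + y‖
      · have hRS : R ≤ S := le_max_right _ _
        have hmem : y ∈ {y : E d | S / 2 ≤ ‖y‖} := show S / 2 ≤ ‖y‖ by linarith
        rw [if_pos h, indicator_of_mem hmem]
      · rw [if_neg h, zero_mul]
        exact mul_nonneg hB (indicator_nonneg (fun _ _ => by positivity) _)
  have hi := (i1.const_mul 16).add (i2.const_mul B)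
  have hmeas : Measurable fun y : E d => tailFn R s B (x₀ + y) * ‖y‖ ^ (-((d : ℝ) + 1)) := by
    have hT : Measurable (tailFn R s B : E d → ℝ) :=
      (Measurable.ite (hms R) (by fun_prop) measurable_const).add
        (Measurable.ite (hms S) measurable_const measurable_const)
    exact (hT.comp (measurable_const_add x₀)).mul (measurable_norm.pow_const _)
  have hint := hi.mono' hmeas.aestronglyMeasurable (Filter.Eventually.of_forall fun y => by
    rw [Real.norm_of_nonneg (mul_nonneg (tailFn_nonneg hB _) (by positivity))]
    exact hle y)
  refine ⟨hint, (integral_mono hint hi hle).trans ?_⟩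
  simp only [Pi.add_apply]
  rw [integral_add (i1.const_mul 16) (i2.const_mul B), integral_const_mul, integral_const_mul,
    integral_indicator (hms _), integral_indicator (hms _),
    setIntegral_norm_rpow_ge (half_pos hR0), setIntegral_norm_rpow_ge (half_pos hS0),
    ← hJ₁, ← hJ₂]
  have e1 : (R / 2) ^ ((d : ℝ) - (d + 1 / 2)) ≤ 2 * (1 / √R) := by
    rw [show (d : ℝ) - (d + 1 / 2) = -(1 / 2) by ring, Real.rpow_neg (by positivity),
      ← Real.sqrt_eq_rpow, ← one_div, mul_one_div, div_le_div_iff₀ (by positivity)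
      (by positivity), one_mul]
    rw [show (2 : ℝ) * √(R / 2) = √(4 * (R / 2)) by
      rw [Real.sqrt_mul (by norm_num), show (4 : ℝ) = 2 ^ 2 by norm_num,
        Real.sqrt_sq (by norm_num)]]
    exact Real.sqrt_le_sqrt (by linarith)
  have e2 : (S / 2) ^ ((d : ℝ) - (d + 1)) ≤ 2 / s := by
    rw [show (d : ℝ) - (d + 1) = -1 by ring, Real.rpow_neg_one, inv_div]
    exact div_le_div_of_nonneg_left (by norm_num) hs (le_max_left _ _)
  have f1 := mul_le_mul_of_nonneg_right e1 hJ₁0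
  have f2 := mul_le_mul_of_nonneg_left (mul_le_mul_of_nonneg_right e2 hJ₂0) hB
  have g1 : 0 ≤ 1 / √R := by positivity
  have g2 : 0 ≤ B / s := by positivity
  have f3 : B * (2 / s * J₂) = 2 * J₂ * (B / s) := by ring
  nlinarith [mul_nonneg hJ₂0 g1, mul_nonneg hJ₁0 g2]

theorem SubAt.mono {d : ℕ} {lam Lam : ℝ} {W : ℝ × E d → ℝ} {z : ℝ × E d} {ε ε' : ℝ}
    (h : SubAt lam Lam W z ε) (hε : ε ≤ ε') : SubAt lam Lam W z ε' := by
  obtain ⟨τ, P, K, s, h1, h2, h3, h4, h5, h6⟩ := h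
  exact ⟨τ, P, K, s, h1, h2, h3, h4, h5, by linarith⟩

theorem lowMass_add_neg {d : ℕ} {W : ℝ × E d → ℝ} (hW : ContinuousOn W (Iic 0 ×ˢ univ)) (t : ℝ) :
    ballVol d ≤ lowMass W t + lowMass (fun z => -W z) t := by
  have hWn : ContinuousOn (fun z => -W z) (Iic 0 ×ˢ univ) := hW.neg
  unfold lowMass
  rw [← integral_add (integrableOn_lowMass hW t) (integrableOn_lowMass hWn t)]
  have h1 : ballVol d = ∫ x in closedBall (0 : E d) 1, (1 : ℝ) := by
    rw [setIntegral_const, smul_eq_mul, mul_one]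
    rfl
  rw [h1]
  refine setIntegral_mono_on (integrableOn_const measure_closedBall_lt_top.ne)
    ((integrableOn_lowMass hW t).add (integrableOn_lowMass hWn t)) measurableSet_closedBall
    fun x _ => ?_
  have := le_max_right 0 (1 / 2 - W (min t 0, x))
  have := le_max_right 0 (1 / 2 - -W (min t 0, x))
  linarith

/-- Improvement of oscillation. -/
theorem exists_osc_decay {d : ℕ} (hd : 1 ≤ d) {lam Lam : ℝ} (hlam : 0 < lam) (hlL : lam ≤ Lam) :
    ∃ (q ε₀ : ℝ) (l : ℕ), 1 / 2 ≤ q ∧ q < 1 ∧ 0 < ε₀ ∧ 2 ≤ l ∧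
      ∀ (W : ℝ × E d → ℝ) (B s : ℝ), 0 ≤ B → 0 < s → B / s ≤ ε₀ →
      ContinuousOn W (Iic 0 ×ˢ univ) →
      (∀ t x, -1 < t → t ≤ 0 → ‖x‖ < 1 → SubAt lam Lam W (t, x) ε₀) →
      (∀ t x, -1 < t → t ≤ 0 → ‖x‖ < 1 → SubAt lam Lam (fun z => -W z) (t, x) ε₀) →
      (∀ t x, -1 ≤ t → t ≤ 0 → ‖x‖ ≤ 2 ^ l / 2 → |W (t, x)| ≤ 1) →
      (∀ t x, -1 ≤ t → t ≤ 0 → 2 ^ l / 2 ≤ ‖x‖ →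
        |W (t, x)| ≤ 8 * √‖x‖ + if s ≤ ‖x‖ then B else 0) →
      ∃ c, ∀ t x, -(1 / 2) ≤ t → t ≤ 0 → ‖x‖ ≤ 1 / 2 → |W (t, x) - c| ≤ q := by
  obtain ⟨θ, hθ, hθ1, hdec⟩ := exists_one_sided_decay hd hlam hlL
  obtain ⟨C, hC, htail⟩ := exists_tail_bound d
  have hLam : 0 < Lam := hlam.trans_le hlL
  obtain ⟨n, hn⟩ := pow_unbounded_of_one_lt (4 * (Lam * C) / θ) (one_lt_two (α := ℝ))
  set l : ℕ := 2 * n + 2 with hl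
  have hR : (2 : ℝ) ^ l / 2 = 2 * (2 ^ n) ^ 2 := by rw [hl, pow_add, pow_mul']; ring
  have h2n : (1 : ℝ) ≤ 2 ^ n := one_le_pow₀ (by norm_num)
  have hR2 : (2 : ℝ) ≤ 2 ^ l / 2 := by rw [hR]; nlinarith
  have hsq : (2 : ℝ) ^ n ≤ √(2 ^ l / 2) := Real.le_sqrt_of_sq_le (by rw [hR]; nlinarith)
  have hT1 : Lam * (C * (1 / √(2 ^ l / 2))) ≤ θ / 4 := by
    have h1 : 0 < √((2 : ℝ) ^ l / 2) := by linarith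
    rw [div_lt_iff₀ hθ] at hn
    rw [← mul_assoc, mul_one_div, div_le_iff₀ h1]
    nlinarith
  refine ⟨1 - θ, min θ (θ / (4 * (Lam * C))), l, by linarith, by linarith, by positivity,
    by omega, ?_⟩
  intro W B s hB hs hBs hW hsub hsub' hin hout
  have hTi : ∀ x₀ : E d, ‖x₀‖ < 1 →
      Integrable (fun y => tailFn (2 ^ l / 2) s B (x₀ + y) * ‖y‖ ^ (-((d : ℝ) + 1))) ∧
      Lam * ∫ y, tailFn (2 ^ l / 2) s B (x₀ + y) * ‖y‖ ^ (-((d : ℝ) + 1)) ≤ θ / 2 := by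
    intro x₀ hx₀
    obtain ⟨h1, h2⟩ := htail (2 ^ l / 2) s B x₀ hR2 hs hB hx₀
    refine ⟨h1, (mul_le_mul_of_nonneg_left h2 hLam.le).trans ?_⟩
    have h3 : B / s ≤ θ / (4 * (Lam * C)) := hBs.trans (min_le_right _ _)
    rw [le_div_iff₀ (by positivity)] at h3
    linarith
  have hT2 : ∀ x : E d, ‖x‖ < 2 → tailFn (2 ^ l / 2) s B x = 0 := by
    intro x hx
    have h1 : ¬ (2 : ℝ) ^ l / 2 ≤ ‖x‖ := by linarith
    simp [tailFn, h1]
  have hbd : ∀ t x, -1 ≤ t → t ≤ 0 → |W (t, x)| ≤ 1 + tailFn (2 ^ l / 2) s B x := by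
    intro t x ht ht0
    rcases le_total ‖x‖ (2 ^ l / 2) with h | h
    · have := hin t x ht ht0 h
      have := tailFn_nonneg (R := 2 ^ l / 2) (s := s) hB x
      linarith
    · have := hout t x ht ht0 h
      have h1 : tailFn (2 ^ l / 2) s B x = 8 * √‖x‖ + if s ≤ ‖x‖ then B else 0 := by
        simp [tailFn, h]
      linarith
  have hin1 : ∀ t x, -1 ≤ t → t ≤ 0 → ‖x‖ ≤ 1 → |W (t, x)| ≤ 1 := fun t x ht ht0 hx =>
    hin t x ht ht0 (by linarith)
  have hc1 := continuous_lowMass hW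
  have hWn : ContinuousOn (fun z => -W z) (Iic 0 ×ˢ univ) := hW.neg
  have hc2 := continuous_lowMass hWn
  have hmass : ballVol d / 2 ≤ (∫ s in (-1 : ℝ)..(-(1 / 2)), lowMass W s)
      + ∫ s in (-1 : ℝ)..(-(1 / 2)), lowMass (fun z => -W z) s := by
    rw [← intervalIntegral.integral_add (hc1.intervalIntegrable _ _) (hc2.intervalIntegrable _ _)]
    have h := intervalIntegral.integral_mono_on (μ := volume) (a := -1) (b := -(1 / 2)) (by norm_num)
      (continuous_const.intervalIntegrable _ _) ((hc1.add hc2).intervalIntegrable _ _)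
      (fun t _ => lowMass_add_neg hW t)
    rw [intervalIntegral.integral_const, smul_eq_mul] at h
    refine le_trans (le_of_eq ?_) h
    ring
  have hεθ : min θ (θ / (4 * (Lam * C))) ≤ θ := min_le_left _ _
  rcases le_or_gt (ballVol d / 4) (∫ s in (-1 : ℝ)..(-(1 / 2)), lowMass W s) with h | h
  · refine ⟨-θ, fun t x ht ht0 hx => ?_⟩
    have h1 := hdec W (tailFn (2 ^ l / 2) s B) hW
      (fun t x h1 h2 h3 => (hsub t x h1 h2 h3).mono hεθ)
      (fun t x h1 h2 => (le_abs_self _).trans (hbd t x h1 h2))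
      (fun t x h1 h2 h3 => (abs_le.1 (hin1 t x h1 h2 h3)).1)
      (tailFn_nonneg hB) hT2 hTi h t x ht ht0 hx
    have h2 := (abs_le.1 (hin1 t x (by linarith) ht0 (by linarith))).1
    rw [abs_le]
    constructor <;> linarith
  · refine ⟨θ, fun t x ht ht0 hx => ?_⟩
    have h1 := hdec (fun z => -W z) (tailFn (2 ^ l / 2) s B) hWn
      (fun t x h1 h2 h3 => (hsub' t x h1 h2 h3).mono hεθ)
      (fun t x h1 h2 => (neg_le_abs _).trans (hbd t x h1 h2))
      (fun t x h1 h2 h3 => neg_le_neg (abs_le.1 (hin1 t x h1 h2 h3)).2)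
      (tailFn_nonneg hB) hT2 hTi (by linarith) t x ht ht0 hx
    have h2 := (abs_le.1 (hin1 t x (by linarith) ht0 (by linarith))).2
    rw [abs_le]
    constructor <;> linarith

theorem SubAt.scale {d : ℕ} {lam Lam : ℝ} {w : ℝ × E d → ℝ} {a z : ℝ × E d} {ρ A c ε : ℝ}
    (hρ : 0 < ρ) (hA : 0 < A) (h : SubAt lam Lam w (a + ρ • z) ε) :
    SubAt lam Lam (fun z => (w (a + ρ • z) - c) / A) z (ρ * ε / A) := by
  obtain ⟨τ, P, K, s, hs, hτ, hP, hK, hint, hle⟩ := h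
  set D : E d → ℝ := fun y => (w ((a + ρ • z).1, (a + ρ • z).2 + y) - w (a + ρ • z)
    - if ‖y‖ < s then P y else 0) * K y with hD
  have hfun : (fun y => ((w (a + ρ • (z.1, z.2 + y)) - c) / A - (w (a + ρ • z) - c) / A
      - if ‖y‖ < s / ρ then ((ρ / A) • P) y else 0) * (ρ ^ (d + 1) * K (ρ • y)))
      = fun y => ρ ^ (d + 1) / A * D (ρ • y) := by
    funext y
    have h1 : ‖ρ • y‖ < s ↔ ‖y‖ < s / ρ := by
      rw [norm_smul, Real.norm_of_nonneg hρ.le, lt_div_iff₀ hρ, mul_comm]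
    have h2 : a + ρ • (z.1, z.2 + y) = ((a + ρ • z).1, (a + ρ • z).2 + ρ • y) := by
      ext1
      · simp
      · simp [add_assoc]
    simp only [hD, h1, h2]
    by_cases h : ‖y‖ < s / ρ
    · simp only [if_pos h, _root_.smul_apply, map_smul, smul_eq_mul]
      field_simp
      ring
    · simp only [if_neg h]
      field_simp
      ring
  refine ⟨ρ / A * τ, (ρ / A) • P, fun y => ρ ^ (d + 1) * K (ρ • y), s / ρ, by positivity,
    ?_, ?_, hK.scale hρ, ?_, ?_⟩
  · have h1 : HasDerivAt (fun t => a.1 + ρ * t) (ρ * 1) z.1 :=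
      ((hasDerivAt_id z.1).const_mul ρ).const_add a.1
    have h2 : HasDerivAt (fun t => w (a.1 + ρ * t, (a + ρ • z).2)) (τ * (ρ * 1)) z.1 :=
      HasDerivAt.comp z.1 (h₂ := fun t => w (t, (a + ρ • z).2)) hτ h1
    refine ((h2.sub_const c).div_const A).congr_deriv ?_
    ring
  · have h1 : HasFDerivAt (fun x : E d => a.2 + ρ • x) (ρ • ContinuousLinearMap.id ℝ (E d)) z.2 :=
      ((hasFDerivAt_id z.2).const_smul ρ).const_add a.2
    have h2 : HasFDerivAt (fun x => w ((a + ρ • z).1, a.2 + ρ • x))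
        (P.comp (ρ • ContinuousLinearMap.id ℝ (E d))) z.2 :=
      HasFDerivAt.comp z.2 (g := fun x => w ((a + ρ • z).1, x)) hP h1
    have h3 := (h2.sub_const c).mul_const A⁻¹
    refine (h3.congr_fderiv ?_)
    ext y
    simp
    ring
  · rw [hfun]
    exact ((integrable_comp_smul_iff volume D hρ.ne').2 hint).const_mul _
  · rw [hfun, integral_const_mul, Measure.integral_comp_smul, finrank_euclideanSpace,
      Fintype.card_fin, abs_of_pos (by positivity), smul_eq_mul]
    have h1 : ρ ^ (d + 1) / A * ((ρ ^ d)⁻¹ * ∫ y, D y) = ρ / A * ∫ y, D y := by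
      field_simp
      ring
    rw [h1]
    have := mul_le_mul_of_nonneg_left hle (show 0 ≤ ρ / A by positivity)
    refine this.trans (le_of_eq ?_)
    ring

theorem deltaU_one {d : ℕ} (u : ℝ × E d → ℝ) (t : ℝ) (x y : E d) :
    deltaU 1 u t x y = u (t, x + y) - u (t, x) - if ‖y‖ < 1 then Du u (t, x) y else 0 := by
  simp [deltaU]

theorem isOpen_lowerHalf (d : ℕ) : IsOpen (lowerHalf d) := isOpen_Iio.prod isOpen_univ

theorem Q0_subset_lowerHalf (d : ℕ) : Q0 d 1 1 ⊆ lowerHalf d :=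
  fun _ hz => ⟨hz.1.2, mem_univ _⟩

theorem hasDerivAt_time {d : ℕ} {u : ℝ × E d → ℝ} (hu : ContDiffOn ℝ (⊤ : ℕ∞) u (lowerHalf d))
    {z : ℝ × E d} (hz : z ∈ lowerHalf d) : HasDerivAt (fun t => u (t, z.2)) (ut u z) z.1 := by
  have h : DifferentiableAt ℝ u (z.1, z.2) :=
    (hu.contDiffAt ((isOpen_lowerHalf d).mem_nhds hz)).differentiableAt (by simp)
  exact (DifferentiableAt.comp z.1 (g := u) (f := fun t => (t, z.2)) h
    (by fun_prop)).hasDerivAt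

theorem hasFDerivAt_space {d : ℕ} {u : ℝ × E d → ℝ} (hu : ContDiffOn ℝ (⊤ : ℕ∞) u (lowerHalf d))
    {z : ℝ × E d} (hz : z ∈ lowerHalf d) : HasFDerivAt (fun x => u (z.1, x)) (Du u z) z.2 := by
  have h : DifferentiableAt ℝ u (z.1, z.2) :=
    (hu.contDiffAt ((isOpen_lowerHalf d).mem_nhds hz)).differentiableAt (by simp)
  exact (DifferentiableAt.comp z.2 (g := u) (f := fun x => (z.1, x)) h
    (by fun_prop)).hasFDerivAt

theorem integrable_deltaU_mul_kernel {d : ℕ} (hd : 1 ≤ d) {lam Lam : ℝ} (hlam : 0 < lam)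
    {K : E d → ℝ} (hK : IsKer lam Lam K) {u : ℝ × E d → ℝ} (hu : ContinuousOn u (lowerHalf d)) {z : ℝ × E d}
    (hz : z ∈ lowerHalf d)
    (hint : Integrable (fun y : E d => deltaU 1 u z.1 z.2 y * ‖y‖ ^ (-((d : ℝ) + 1)))) :
    Integrable (fun y => deltaU 1 u z.1 z.2 y * K y) ∧
      |∫ y, deltaU 1 u z.1 z.2 y * K y|
        ≤ Lam * ∫ y, |deltaU 1 u z.1 z.2 y * ‖y‖ ^ (-((d : ℝ) + 1))| := by
  have hm : Measurable fun y => deltaU 1 u z.1 z.2 y * K y := by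
    refine Measurable.mul ?_ hK.2
    rw [show deltaU 1 u z.1 z.2 = _ from funext (deltaU_one u z.1 z.2)]
    have h1 : Continuous fun y => u (z.1, z.2 + y) :=
      hu.comp_continuous (by fun_prop) fun y => ⟨hz.1, mem_univ _⟩
    refine (h1.measurable.sub_const _).sub (Measurable.ite ?_ (by fun_prop) measurable_const)
    exact measurableSet_lt measurable_norm measurable_const
  have := nontrivial_E hd
  have hi := hint.abs.const_mul Lam
  have hb : ∀ᵐ y : E d, ‖deltaU 1 u z.1 z.2 y * K y‖
      ≤ Lam * |deltaU 1 u z.1 z.2 y * ‖y‖ ^ (-((d : ℝ) + 1))| := by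
    filter_upwards [Measure.ae_ne volume (0 : E d)] with y hy
    rw [Real.norm_eq_abs, abs_mul, abs_mul, abs_of_pos (hK.pos hlam hy),
      abs_of_nonneg (show 0 ≤ ‖y‖ ^ (-((d : ℝ) + 1)) by positivity)]
    have := mul_le_mul_of_nonneg_left (hK.upper hy) (abs_nonneg (deltaU 1 u z.1 z.2 y))
    linarith
  refine ⟨hi.mono' hm.aestronglyMeasurable hb, ?_⟩
  rw [← integral_const_mul]
  exact norm_integral_le_of_norm_le hi hb

/-- Differences of translates of a solution satisfy one-sided linear inequalities. -/
theorem subAt_increment {d : ℕ} (hd : 1 ≤ d) {lam Lam : ℝ} (hlam : 0 < lam) {ι : Type} [Nonempty ι]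
    {K : ι → E d → ℝ} {f : ι → ℝ × E d → ℝ} {u : ℝ × E d → ℝ} {F δ : ℝ}
    (hK : ∀ a, IsKer lam Lam (K a)) (hf : ∀ a, ∀ z ∈ Q0 d 1 1, |f a z| ≤ F)
    (hu : ContDiffOn ℝ (⊤ : ℕ∞) u (lowerHalf d))
    (hint : ∀ z ∈ lowerHalf d, Integrable (fun y : E d =>
      deltaU 1 u z.1 z.2 y * ‖y‖ ^ (-((d : ℝ) + 1))))
    (heq : ∀ z ∈ Q0 d 1 1, ut u z = ⨅ a, (Lop 1 (K a) u z + f a z)) (hδ : 0 < δ)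
    {z k₁ k₂ : ℝ × E d} (h₁ : z + k₁ ∈ Q0 d 1 1) (h₂ : z + k₂ ∈ Q0 d 1 1) :
    SubAt lam Lam (fun ζ => u (ζ + k₁) - u (ζ + k₂)) z (2 * F + δ) := by
  have hl₁ := Q0_subset_lowerHalf d h₁
  have hl₂ := Q0_subset_lowerHalf d h₂
  obtain ⟨a, ha⟩ : ∃ a, Lop 1 (K a) u (z + k₂) + f a (z + k₂) < ut u (z + k₂) + δ := by
    rw [heq _ h₂]
    exact exists_lt_of_ciInf_lt (by linarith)
  have hle : ut u (z + k₁) ≤ Lop 1 (K a) u (z + k₁) + f a (z + k₁) := by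
    rw [heq _ h₁]
    refine ciInf_le ⟨-(Lam * ∫ y, |deltaU 1 u (z + k₁).1 (z + k₁).2 y * ‖y‖ ^ (-((d : ℝ) + 1))|)
      - F, ?_⟩ a
    rintro _ ⟨b, rfl⟩
    have h := (abs_le.1 (integrable_deltaU_mul_kernel hd hlam (hK b) hu.continuousOn hl₁
      (hint _ hl₁)).2).1
    have h' := (abs_le.1 (hf b _ h₁)).1
    simp only [Lop]
    linarith
  obtain ⟨i₁, -⟩ := integrable_deltaU_mul_kernel hd hlam (hK a) hu.continuousOn hl₁ (hint _ hl₁)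
  obtain ⟨i₂, -⟩ := integrable_deltaU_mul_kernel hd hlam (hK a) hu.continuousOn hl₂ (hint _ hl₂)
  have hfun : (fun y => (u ((z.1, z.2 + y) + k₁) - u ((z.1, z.2 + y) + k₂)
        - (u (z + k₁) - u (z + k₂))
        - if ‖y‖ < 1 then (Du u (z + k₁) - Du u (z + k₂)) y else 0) * K a y)
      = fun y => deltaU 1 u (z + k₁).1 (z + k₁).2 y * K a y
        - deltaU 1 u (z + k₂).1 (z + k₂).2 y * K a y := by
    funext y
    have e : ∀ k : ℝ × E d, (z.1, z.2 + y) + k = ((z + k).1, (z + k).2 + y) := by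
      intro k
      ext1
      · rfl
      · exact add_right_comm _ _ _
    rw [deltaU_one, deltaU_one, e, e]
    by_cases h : ‖y‖ < 1
    · simp only [if_pos h, _root_.sub_apply]
      ring
    · simp only [if_neg h]
      ring
  refine ⟨ut u (z + k₁) - ut u (z + k₂), Du u (z + k₁) - Du u (z + k₂), K a, 1, one_pos, ?_, ?_,
    hK a, ?_, ?_⟩
  · exact ((hasDerivAt_time hu hl₁).comp_add_const z.1 k₁.1).sub
      ((hasDerivAt_time hu hl₂).comp_add_const z.1 k₂.1)
  · have h : ∀ k, z + k ∈ lowerHalf d →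
        HasFDerivAt (fun x => u ((z.1, x) + k)) (Du u (z + k)) z.2 := fun k hk =>
      (hasFDerivAt_comp_add_right (f := fun x => u (z.1 + k.1, x)) k.2).2 (hasFDerivAt_space hu hk)
    exact (h _ hl₁).sub (h _ hl₂)
  · rw [hfun]
    exact i₁.sub i₂
  · rw [hfun, integral_sub i₁ i₂]
    have h1 := (abs_le.1 (hf a _ h₁)).2
    have h2 := (abs_le.1 (hf a _ h₂)).1
    simp only [Lop] at ha hle
    linarith

/-- The closed backward cylinder of size `r` with top center `a`. -/
def cyl {d : ℕ} (a : ℝ × E d) (r : ℝ) : Set (ℝ × E d) := Icc (a.1 - r) a.1 ×ˢ closedBall a.2 r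

theorem cyl_subset_cyl {d : ℕ} {a : ℝ × E d} {r s : ℝ} (h : r ≤ s) : cyl a r ⊆ cyl a s :=
  prod_mono (Icc_subset_Icc_left (by linarith)) (closedBall_subset_closedBall h)

theorem self_mem_cyl {d : ℕ} {a : ℝ × E d} {r : ℝ} (h : 0 ≤ r) : a ∈ cyl a r :=
  ⟨⟨by linarith, le_rfl⟩, mem_closedBall_self h⟩

theorem add_smul_mem_cyl {d : ℕ} {a : ℝ × E d} {ρ r t : ℝ} {x : E d} (hρ : 0 ≤ ρ) (ht0 : t ≤ 0)
    (ht : ρ * (-t) ≤ r) (hx : ρ * ‖x‖ ≤ r) : a + ρ • (t, x) ∈ cyl a r := by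
  refine ⟨⟨?_, ?_⟩, ?_⟩
  · simp only [Prod.fst_add, Prod.smul_fst, smul_eq_mul]
    linarith
  · simp only [Prod.fst_add, Prod.smul_fst, smul_eq_mul]
    nlinarith
  · simpa [norm_smul, abs_of_nonneg hρ] using hx

set_option maxHeartbeats 3000000 in
/-- Iterating the oscillation decay from the scale where logarithmic growth is dominated. -/
theorem exists_osc_iteration {d : ℕ} (hd : 1 ≤ d) {lam Lam : ℝ} (hlam : 0 < lam)
    (hlL : lam ≤ Lam) :
    ∃ (C : ℝ) (k : ℕ), 0 < C ∧ ∀ (w : ℝ × E d → ℝ) (a : ℝ × E d) (r η N U G : ℝ),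
      0 < η → 0 ≤ N → 0 ≤ U → 0 < G → 2 * 2 ^ k * η ≤ r →
      ContinuousOn w (Iic a.1 ×ˢ univ) → (∀ t x, t ≤ a.1 → |w (t, x)| ≤ 2 * U) →
      (∀ z ∈ cyl a (r - η), SubAt lam Lam w z G) →
      (∀ z ∈ cyl a (r - η), SubAt lam Lam (fun z => -w z) z G) →
      (∀ n : ℕ, 2 * 2 ^ n * η ≤ r → ∀ z ∈ cyl a (2 ^ n * η),
        |w z - w a| ≤ (2 * n + 4) * (N * η)) →
      ∃ c, ∀ z ∈ cyl a η, |w z - c| ≤ N * η / 16 + C * (U / r + G) * η := by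
  obtain ⟨q, ε₀, l, hq, hq1, hε, hl, hosc⟩ := exists_osc_decay hd hlam hlL
  have hq0 : 0 < q := by linarith
  set L : ℝ := 2 ^ l with hL
  have hL4 : (4 : ℝ) ≤ L := by
    calc (4 : ℝ) = 2 ^ 2 := by norm_num
      _ ≤ L := pow_le_pow_right₀ (by norm_num) hl
  have hL0 : 0 < L := by linarith
  obtain ⟨m, hm⟩ : ∃ m : ℕ, ∀ n ≥ m, (2 * (l * n : ℕ) + 4) * q ^ n ≤ (1 : ℝ) / 16 := by
    have h1 := (tendsto_self_mul_const_pow_of_lt_one hq0.le hq1).const_mul (2 * l : ℝ)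
    have h2 := (tendsto_pow_atTop_nhds_zero_of_lt_one hq0.le hq1).const_mul (4 : ℝ)
    have h3 := (h1.add h2).eventually_le_const (u := (1 : ℝ) / 16) (by norm_num)
    obtain ⟨m, hm⟩ := Filter.eventually_atTop.1 h3
    refine ⟨m, fun n hn => le_trans (le_of_eq ?_) (hm n hn)⟩
    push_cast
    ring
  refine ⟨16 * L ^ m / ε₀, l * m, by positivity, ?_⟩
  intro w a r η N U G hη hN hU hG hr hw hwU hsub hsub' hgr
  rw [pow_mul, ← hL] at hr
  have hr0 : 0 < r := lt_of_lt_of_le (by positivity) hr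
  set M : ℝ := N * η / 16 + 16 * L ^ m / ε₀ * (U / r + G) * η with hM
  have hM0 : 0 < M := by positivity
  have hMU : 16 * L ^ m * (U / r) * η ≤ ε₀ * M := by
    have : ε₀ * M = ε₀ * (N * η / 16) + 16 * L ^ m * (U / r) * η + 16 * L ^ m * G * η := by
      rw [hM]; field_simp; ring
    rw [this]
    have : 0 ≤ ε₀ * (N * η / 16) + 16 * L ^ m * G * η := by positivity
    linarith
  have hMG : 16 * L ^ m * G * η ≤ ε₀ * M := by
    have : ε₀ * M = ε₀ * (N * η / 16) + 16 * L ^ m * (U / r) * η + 16 * L ^ m * G * η := by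
      rw [hM]; field_simp; ring
    rw [this]
    have : 0 ≤ ε₀ * (N * η / 16) + 16 * L ^ m * (U / r) * η := by positivity
    linarith
  suffices H : ∀ n : ℕ, 2 * L ^ n * η ≤ r → ∃ c, ∀ z ∈ cyl a (L ^ n * η), |w z - c| ≤ M / q ^ n by
    obtain ⟨c, hc⟩ := H 0 (le_trans (by
      have : (1 : ℝ) ≤ L ^ m := one_le_pow₀ (by linarith)
      simp only [pow_zero]
      gcongr) hr)
    exact ⟨c, fun z hz => by simpa using hc z (by simpa using hz)⟩
  have hbase : ∀ n : ℕ, m ≤ n → 2 * L ^ n * η ≤ r →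
      ∃ c, ∀ z ∈ cyl a (L ^ n * η), |w z - c| ≤ M / q ^ n := by
    intro n hn hnr
    refine ⟨w a, fun z hz => ?_⟩
    have h1 := hgr (l * n) (by rwa [pow_mul]) z (by rwa [pow_mul])
    refine h1.trans ?_
    rw [le_div_iff₀ (by positivity)]
    have h2 := mul_le_mul_of_nonneg_right (hm n hn) (show 0 ≤ N * η by positivity)
    have h3 : 0 ≤ 16 * L ^ m / ε₀ * (U / r + G) * η := by positivity
    calc (2 * ((l * n : ℕ) : ℝ) + 4) * (N * η) * q ^ n
        = (2 * ((l * n : ℕ) : ℝ) + 4) * q ^ n * (N * η) := by ring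
      _ ≤ 1 / 16 * (N * η) := h2
      _ ≤ M := by rw [hM]; linarith
  have hdown : ∀ j : ℕ, ∀ n : ℕ, m ≤ n + j → 2 * L ^ n * η ≤ r →
      ∃ c, ∀ z ∈ cyl a (L ^ n * η), |w z - c| ≤ M / q ^ n := by
    intro j
    induction j with
    | zero => exact hbase
    | succ j ih =>
      intro n hn hnr
      by_cases hmn : m ≤ n
      · exact hbase n hmn hnr
      have hnm : n + 1 ≤ m := by omega
      have hH : ∀ i : ℕ, 2 * L ^ (n + 1 + i) * η ≤ r →
          ∃ c, ∀ z ∈ cyl a (L ^ (n + 1 + i) * η), |w z - c| ≤ M / q ^ (n + 1 + i) :=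
        fun i hi => ih (n + 1 + i) (by omega) hi
      have hLn1 : L ^ (n + 1) ≤ L ^ m := pow_le_pow_right₀ (by linarith) hnm
      obtain ⟨c, hc⟩ := hH 0 (le_trans (by
        simp only [add_zero]
        gcongr) hr)
      simp only [add_zero] at hc
      set A : ℝ := M / q ^ (n + 1) with hA
      have hA0 : 0 < A := by positivity
      have hAM : M ≤ A := by
        rw [hA, le_div_iff₀ (by positivity)]
        exact mul_le_of_le_one_right hM0.le (pow_le_one₀ hq0.le hq1.le)
      set ρ : ℝ := 2 * (L ^ n * η) with hρ
      have hρ0 : 0 < ρ := by positivity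
      have hρL : ρ * L = 2 * (L ^ (n + 1) * η) := by rw [hρ, pow_succ]; ring
      have hLn1' : L ^ (n + 1) * η ≤ L ^ m * η := by gcongr
      set W : ℝ × E d → ℝ := fun z => (w (a + ρ • z) - c) / A with hW
      have hca : |w a - c| ≤ A := hc a (self_mem_cyl (by positivity))
      have hρr : ρ ≤ r - η := by
        have : (1 : ℝ) ≤ L ^ n := one_le_pow₀ (by linarith)
        have : η ≤ L ^ n * η := le_mul_of_one_le_left hη.le this
        linarith [mul_le_mul_of_nonneg_left hL4 hρ0.le]
      have hmemρ : ∀ t x, -1 < t → t ≤ 0 → ‖x‖ < 1 → a + ρ • ((t, x) : ℝ × E d) ∈ cyl a (r - η) :=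
        fun t x ht ht0 hx => add_smul_mem_cyl hρ0.le ht0
          ((mul_le_of_le_one_right hρ0.le (by linarith)).trans hρr)
          ((mul_le_of_le_one_right hρ0.le hx.le).trans hρr)
      have hsc : ρ * G / A ≤ ε₀ := by
        rw [div_le_iff₀ hA0]
        have : ρ * G ≤ 16 * L ^ m * G * η := by
          have := le_mul_of_one_le_right hρ0.le (show 1 ≤ L by linarith)
          have : ρ ≤ 2 * (L ^ m * η) := by linarith
          linarith [mul_le_mul_of_nonneg_right this hG.le,
            show 0 ≤ L ^ m * η * G by positivity]
        exact this.trans (hMG.trans (by gcongr))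
      obtain ⟨c₁, hc₁⟩ : ∃ c₁, ∀ t x, -(1 / 2) ≤ t → t ≤ 0 → ‖x‖ ≤ 1 / 2 →
          |W (t, x) - c₁| ≤ q := by
        refine hosc W (4 * U / A) (r / (4 * (L ^ (n + 1) * η))) (by positivity)
          (by positivity) ?_ ?_ ?_ ?_ ?_ ?_
        · have e : 4 * U / A / (r / (4 * (L ^ (n + 1) * η)))
              = 16 * (U * (L ^ (n + 1) * η)) / (A * r) := by
            field_simp
            ring
          rw [e, div_le_iff₀ (by positivity)]
          have h1 : 16 * L ^ m * U * η ≤ ε₀ * M * r := by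
            have := mul_le_mul_of_nonneg_right hMU hr0.le
            refine le_trans (le_of_eq ?_) this
            field_simp
          have h2 : U * (L ^ (n + 1) * η) ≤ U * (L ^ m * η) := by gcongr
          have h3 : ε₀ * M * r ≤ ε₀ * A * r := by gcongr
          linarith
        · refine ContinuousOn.div_const (ContinuousOn.sub ?_ continuousOn_const) _
          refine hw.comp (by fun_prop) fun z hz => ⟨?_, mem_univ _⟩
          have hz1 : z.1 ≤ 0 := hz.1
          simp only [mem_Iic, Prod.fst_add, Prod.smul_fst, smul_eq_mul]
          linarith [mul_nonpos_of_nonneg_of_nonpos hρ0.le hz1]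
        · exact fun t x ht ht0 hx => ((hsub _ (hmemρ t x ht ht0 hx)).scale hρ0 hA0).mono hsc
        · intro t x ht ht0 hx
          have h := ((hsub' _ (hmemρ t x ht ht0 hx)).scale (c := -c) hρ0 hA0).mono hsc
          convert h using 2 with z
          simp only [hW]
          ring
        · intro t x ht ht0 hx
          simp only [hW, abs_div, abs_of_pos hA0]
          rw [div_le_one hA0]
          refine hc _ (add_smul_mem_cyl hρ0.le ht0 ?_ ?_)
          · have : ρ * 4 ≤ ρ * L := by gcongr
            linarith [mul_le_mul_of_nonneg_left (show -t ≤ 1 by linarith) hρ0.le]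
          · have : ρ * ‖x‖ ≤ ρ * (L / 2) := by gcongr
            linarith
        · intro t x ht ht0 hx
          have hL2 : 0 < L / 2 := by positivity
          obtain ⟨i, hi1, hi2⟩ := exists_nat_pow_near (x := ‖x‖ / (L / 2)) (y := L)
            ((one_le_div hL2).2 hx) (by linarith)
          rw [le_div_iff₀ hL2] at hi1
          rw [div_lt_iff₀ hL2] at hi2
          have hLi : (1 : ℝ) ≤ L ^ i := one_le_pow₀ (by linarith)
          have hLix : L ^ i ≤ ‖x‖ :=
            (le_mul_of_one_le_right (by positivity) (by linarith)).trans hi1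
          have hx1 : 1 ≤ √‖x‖ := by
            rw [Real.one_le_sqrt]
            linarith
          have hmem : a + ρ • ((t, x) : ℝ × E d) ∈ cyl a (L ^ (n + 1 + (i + 1)) * η) := by
            have e : L ^ (n + 1 + (i + 1)) * η = ρ * (L ^ (i + 1) * (L / 2)) := by
              rw [hρ]; ring
            rw [e]
            refine add_smul_mem_cyl hρ0.le ht0 ?_ ?_
            · have : 1 ≤ L ^ (i + 1) * (L / 2) := by linarith
              gcongr
              linarith
            · gcongr
          simp only [hW, abs_div, abs_of_pos hA0]
          rw [div_le_iff₀ hA0]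
          by_cases hir : 2 * L ^ (n + 1 + (i + 1)) * η ≤ r
          · obtain ⟨c₂, hc₂⟩ := hH (i + 1) hir
            have h1 := hc₂ _ hmem
            have h2 := hc₂ a (self_mem_cyl (by positivity))
            have h3 : |w (a + ρ • ((t, x) : ℝ × E d)) - c|
                ≤ 2 * (M / q ^ (n + 1 + (i + 1))) + A := by
              rw [abs_le] at h1 h2 hca ⊢
              constructor <;> linarith
            have h4 : M / q ^ (n + 1 + (i + 1)) = A * (1 / q ^ (i + 1)) := by
              rw [hA, pow_add]; field_simp
            have hqL : 1 / q ^ i ≤ √‖x‖ := by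
              refine le_trans ?_ (Real.sqrt_le_sqrt hLix)
              refine Real.le_sqrt_of_sq_le ?_
              rw [div_pow, one_pow, ← pow_mul, mul_comm i 2, pow_mul, ← one_div_pow]
              refine pow_le_pow_left₀ (by positivity) ?_ i
              rw [div_le_iff₀ (by positivity)]
              nlinarith
            have h5 : 1 / q ^ (i + 1) ≤ 2 * √‖x‖ := by
              have e : 1 / q ^ (i + 1) = 1 / q * (1 / q ^ i) := by rw [pow_succ]; field_simp
              have : 1 / q ≤ 2 := by rw [div_le_iff₀ hq0]; linarith
              rw [e]
              exact mul_le_mul this hqL (by positivity) (by norm_num)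
            rw [h4] at h3
            have h6 : (0 : ℝ) ≤ if r / (4 * (L ^ (n + 1) * η)) ≤ ‖x‖ then 4 * U / A else 0 := by
              positivity
            have h7 := mul_le_mul_of_nonneg_left h5 hA0.le
            have h8 := mul_le_mul_of_nonneg_left hx1 hA0.le
            have h9 := mul_nonneg h6 hA0.le
            rw [add_mul]
            linarith
          · have hs : r / (4 * (L ^ (n + 1) * η)) ≤ ‖x‖ := by
              rw [div_le_iff₀ (by positivity)]
              have e : 2 * L ^ (n + 1 + (i + 1)) * η
                  = L ^ i * (L / 2) * (4 * (L ^ (n + 1) * η)) := by ring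
              rw [not_le, e] at hir
              refine hir.le.trans ?_
              gcongr
            rw [if_pos hs, add_mul, div_mul_cancel₀ _ hA0.ne']
            have h1 : |w (a + ρ • ((t, x) : ℝ × E d))| ≤ 2 * U := by
              refine hwU _ _ ?_
              exact hmem.1.2
            have h2 := hwU a.1 a.2 le_rfl
            have h8 := mul_le_mul_of_nonneg_right hx1 hA0.le
            rw [abs_le] at h1 h2 hca ⊢
            simp only [Prod.mk.eta] at h2
            constructor <;> linarith
      refine ⟨c + A * c₁, fun z hz => ?_⟩
      obtain ⟨⟨hz1, hz2⟩, hz3⟩ := hz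
      have hz3' : ‖z.2 - a.2‖ ≤ L ^ n * η := by simpa [dist_eq_norm] using hz3
      have h1 := hc₁ ((z.1 - a.1) / ρ) (ρ⁻¹ • (z.2 - a.2))
        (by rw [le_div_iff₀ hρ0]; linarith) (div_nonpos_of_nonpos_of_nonneg (by linarith) hρ0.le)
        (by
          rw [norm_smul, norm_inv, Real.norm_of_nonneg hρ0.le, inv_mul_le_iff₀ hρ0]
          linarith)
      have h2 : a + ρ • (((z.1 - a.1) / ρ, ρ⁻¹ • (z.2 - a.2)) : ℝ × E d) = z := by
        ext1
        · simp only [Prod.fst_add, Prod.smul_fst, smul_eq_mul]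
          field_simp
          ring
        · simp [smul_smul, hρ0.ne']
      simp only [hW, h2] at h1
      have h3 : w z - (c + A * c₁) = A * ((w z - c) / A - c₁) := by
        field_simp
        ring
      rw [h3, abs_mul, abs_of_pos hA0]
      calc A * |(w z - c) / A - c₁| ≤ A * q := by gcongr
        _ = M / q ^ n := by rw [hA, pow_succ]; field_simp
  exact fun n hn => hdown m n (by omega) hn

/-- The Zygmund condition with constant `N`, in terms of endpoints and midpoints. -/
def ZygOn {d : ℕ} (u : ℝ × E d → ℝ) (Ω : Set (ℝ × E d)) (N : ℝ) : Prop :=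
  ∀ p ∈ Ω, ∀ q ∈ Ω, |u p + u q - 2 * u ((1 / 2 : ℝ) • (p + q))| ≤ N * ‖p - q‖

theorem sub_mem_cyl {d : ℕ} {a z h : ℝ × E d} {r s t : ℝ} (hz : z ∈ cyl a r) (h0 : 0 ≤ h.1)
    (hs : ‖h‖ ≤ s) (ht : r + s ≤ t) : z - h ∈ cyl a t := by
  obtain ⟨⟨h1, h2⟩, h3⟩ := hz
  have h4 : h.1 ≤ ‖h‖ := (le_abs_self _).trans (norm_fst_le h)
  have h5 : ‖h.2‖ ≤ ‖h‖ := norm_snd_le h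
  rw [mem_closedBall, dist_eq_norm] at h3
  refine ⟨⟨?_, ?_⟩, ?_⟩
  · simp only [Prod.fst_sub]
    linarith
  · simp only [Prod.fst_sub]
    linarith
  · rw [mem_closedBall, dist_eq_norm, Prod.snd_sub, sub_right_comm]
    linarith [norm_sub_le (z.2 - a.2) h.2]

theorem norm_sub_le_of_mem_cyl {d : ℕ} {a z : ℝ × E d} {r : ℝ} (hz : z ∈ cyl a r) :
    ‖z - a‖ ≤ r := by
  obtain ⟨⟨h1, h2⟩, h3⟩ := hz
  rw [mem_closedBall, dist_eq_norm] at h3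
  refine norm_prod_le_iff.2 ⟨?_, h3⟩
  rw [Prod.fst_sub, Real.norm_eq_abs, abs_le]
  constructor <;> linarith [norm_nonneg (z.2 - a.2)]

/-- Increments of a Zygmund function grow logarithmically. -/
theorem ZygOn.increment_growth {d : ℕ} {u : ℝ × E d → ℝ} {a h : ℝ × E d} {r N : ℝ}
    (hN : 0 ≤ N) (hu : ZygOn u (cyl a r) N) (h0 : 0 ≤ h.1) (n : ℕ) (hr : 2 * 2 ^ n * ‖h‖ ≤ r)
    {z : ℝ × E d} (hz : z ∈ cyl a (2 ^ n * ‖h‖)) :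
    |(u z - u (z - h)) - (u a - u (a - h))| ≤ (2 * n + 4) * (N * ‖h‖) := by
  have hη : 0 ≤ ‖h‖ := norm_nonneg h
  have hnorm : ∀ j : ℕ, ‖(2 ^ j : ℝ) • h‖ = 2 ^ j * ‖h‖ := fun j => by simp [norm_smul]
  have hshift : ∀ j ≤ n, ∀ z ∈ cyl a (2 ^ n * ‖h‖), z - (2 ^ j : ℝ) • h ∈ cyl a r := by
    intro j hj z hz
    refine sub_mem_cyl hz (by simp only [Prod.smul_fst, smul_eq_mul]; positivity)
      (s := 2 ^ n * ‖h‖) ?_ (by linarith)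
    rw [hnorm]
    have : (2 : ℝ) ^ j ≤ 2 ^ n := pow_le_pow_right₀ (by norm_num) hj
    gcongr
  have hsub : cyl a (2 ^ n * ‖h‖) ⊆ cyl a r :=
    cyl_subset_cyl (by nlinarith [show 0 ≤ 2 ^ n * ‖h‖ by positivity])
  have hdy : ∀ j ≤ n, ∀ z ∈ cyl a (2 ^ n * ‖h‖),
      |(u z - u (z - h)) - (u z - u (z - (2 ^ j : ℝ) • h)) / 2 ^ j| ≤ j * (N * ‖h‖) := by
    intro j
    induction j with
    | zero => intro _ z _; simp
    | succ j ih =>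
      intro hj z hz
      have h1 := ih (by omega) z hz
      have h2 := hu z (hsub hz) _ (hshift (j + 1) hj z hz)
      have e : (1 / 2 : ℝ) • (z + (z - (2 ^ (j + 1) : ℝ) • h)) = z - (2 ^ j : ℝ) • h := by
        rw [pow_succ]
        module
      have e' : z - (z - (2 ^ (j + 1) : ℝ) • h) = (2 ^ (j + 1) : ℝ) • h := by abel
      rw [e, e', hnorm] at h2
      have hp : (0 : ℝ) < 2 ^ (j + 1) := by positivity
      have h3 : |(u z - u (z - (2 ^ j : ℝ) • h)) / 2 ^ j
          - (u z - u (z - (2 ^ (j + 1) : ℝ) • h)) / 2 ^ (j + 1)| ≤ N * ‖h‖ := by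
        have e2 : (u z - u (z - (2 ^ j : ℝ) • h)) / 2 ^ j
            - (u z - u (z - (2 ^ (j + 1) : ℝ) • h)) / 2 ^ (j + 1)
            = (u z + u (z - (2 ^ (j + 1) : ℝ) • h) - 2 * u (z - (2 ^ j : ℝ) • h))
              / 2 ^ (j + 1) := by
          rw [pow_succ]
          field_simp
          ring
        rw [e2, abs_div, abs_of_pos hp, div_le_iff₀ hp]
        linarith
      refine (abs_sub_le _ _ _).trans ((add_le_add h1 h3).trans (le_of_eq ?_))
      push_cast
      ring
  have ha : a ∈ cyl a (2 ^ n * ‖h‖) := self_mem_cyl (by positivity)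
  have h1 := hdy n le_rfl z hz
  have h2 := hdy n le_rfl a ha
  have h3 := hu z (hsub hz) _ (hshift n le_rfl a ha)
  have h4 := hu a (hsub ha) _ (hshift n le_rfl z hz)
  set H : ℝ × E d := (2 ^ n : ℝ) • h with hH
  have e : z + (a - H) = a + (z - H) := by abel
  rw [e] at h3
  have hza : ‖z - a‖ ≤ 2 ^ n * ‖h‖ := norm_sub_le_of_mem_cyl hz
  have h5 : ‖z - (a - H)‖ ≤ 2 * (2 ^ n * ‖h‖) := by
    rw [show z - (a - H) = (z - a) + H by abel]
    linarith [norm_add_le (z - a) H, hnorm n]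
  have h6 : ‖a - (z - H)‖ ≤ 2 * (2 ^ n * ‖h‖) := by
    rw [show a - (z - H) = H - (z - a) by abel]
    linarith [norm_sub_le H (z - a), hnorm n]
  have h7 := mul_le_mul_of_nonneg_left h5 hN
  have h8 := mul_le_mul_of_nonneg_left h6 hN
  have hp : (0 : ℝ) < 2 ^ n := by positivity
  have h9 : |(u z - u (z - H)) / 2 ^ n - (u a - u (a - H)) / 2 ^ n| ≤ 4 * (N * ‖h‖) := by
    rw [← sub_div, abs_div, abs_of_pos hp, div_le_iff₀ hp]
    rw [abs_le] at h3 h4 ⊢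
    constructor <;> linarith
  rw [abs_le] at h1 h2 h9 ⊢
  constructor <;> linarith

/-- The second-difference estimate with a small multiple of the Zygmund constant. -/
theorem exists_second_difference_bound {d : ℕ} (hd : 1 ≤ d) {lam Lam : ℝ} (hlam : 0 < lam)
    (hlL : lam ≤ Lam) :
    ∃ C : ℝ, 0 < C ∧ ∀ (ι : Type) (_ : Nonempty ι) (K : ι → E d → ℝ) (f : ι → ℝ × E d → ℝ)
      (u : ℝ × E d → ℝ) (F U δ : ℝ), (∀ a, IsKer lam Lam (K a)) →
      (∀ a, ∀ z ∈ Q0 d 1 1, |f a z| ≤ F) → ContDiffOn ℝ (⊤ : ℕ∞) u (lowerHalf d) →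
      (∀ z ∈ lowerHalf d, |u z| ≤ U) →
      (∀ z ∈ lowerHalf d, Integrable (fun y : E d =>
        deltaU 1 u z.1 z.2 y * ‖y‖ ^ (-((d : ℝ) + 1)))) →
      (∀ z ∈ Q0 d 1 1, ut u z = ⨅ a, (Lop 1 (K a) u z + f a z)) → 0 < δ →
      ∀ (a h : ℝ × E d) (r N : ℝ), 0 < r → cyl a r ⊆ Q0 d 1 1 → 0 ≤ N →
        ZygOn u (cyl a r) N → 0 ≤ h.1 → h ≠ 0 →
        |u a + u (a - h - h) - 2 * u (a - h)|
          ≤ N * ‖h‖ / 8 + C * (U / r + (2 * F + δ)) * ‖h‖ := by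
  obtain ⟨C, k, hC, hosc⟩ := exists_osc_iteration hd hlam hlL
  refine ⟨2 * C + 8 * 2 ^ k, by positivity, ?_⟩
  intro ι _ K f u F U δ hK hf hu hU hint heq hδ a h r N hr hcyl hN hz h0 hh
  have hη : 0 < ‖h‖ := norm_pos_iff.2 hh
  have ha : a ∈ Q0 d 1 1 := hcyl (self_mem_cyl hr.le)
  have ha1 : a.1 < 0 := ha.1.2
  have hlow : ∀ z : ℝ × E d, z.1 ≤ a.1 → z ∈ lowerHalf d := fun z hz =>
    ⟨hz.trans_lt ha1, mem_univ _⟩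
  have hU0 : 0 ≤ U := (abs_nonneg _).trans (hU a (hlow a le_rfl))
  have hF0 : 0 ≤ F := (abs_nonneg _).trans (hf (Classical.arbitrary ι) a ha)
  have hG : 0 < 2 * F + δ := by linarith
  by_cases hkr : 2 * 2 ^ k * ‖h‖ ≤ r
  · have hmem : ∀ z ∈ cyl a (r - ‖h‖), z + 0 ∈ Q0 d 1 1 ∧ z + -h ∈ Q0 d 1 1 := fun z hz =>
      ⟨hcyl (by simpa using cyl_subset_cyl (by linarith) hz), hcyl (by
        rw [← sub_eq_add_neg]
        exact sub_mem_cyl hz h0 le_rfl (by linarith))⟩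
    have hcont : ContinuousOn u (lowerHalf d) := hu.continuousOn
    obtain ⟨c, hc⟩ := hosc (fun ζ => u (ζ + 0) - u (ζ + -h)) a r ‖h‖ N U (2 * F + δ) hη hN hU0 hG
      hkr
      (by
        refine (hcont.comp (by fun_prop) fun z hz => hlow _ ?_).sub
          (hcont.comp (by fun_prop) fun z hz => hlow _ ?_)
        · have : z.1 ≤ a.1 := hz.1
          simpa using this
        · have : z.1 ≤ a.1 := hz.1
          simp only [Prod.fst_add, Prod.fst_neg]
          linarith)
      (by
        intro t x ht
        have h1 := hU ((t, x) + 0) (hlow _ (by simpa using ht))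
        have h2 := hU ((t, x) + -h) (hlow _ (by
          simp only [Prod.fst_add, Prod.fst_neg]
          linarith))
        rw [abs_le] at h1 h2 ⊢
        constructor <;> linarith)
      (fun z hz => subAt_increment hd hlam hK hf hu hint heq hδ (hmem z hz).1 (hmem z hz).2)
      (fun z hz => by
        have := subAt_increment hd hlam hK hf hu hint heq hδ (hmem z hz).2 (hmem z hz).1
        simpa only [neg_sub] using this)
      (fun n hn z hz' => by
        simpa only [add_zero, ← sub_eq_add_neg] using hz.increment_growth hN h0 n hn hz')
    have h1 := hc a (self_mem_cyl hη.le)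
    have h2 := hc (a - h) (sub_mem_cyl (self_mem_cyl le_rfl) h0 le_rfl (by simp))
    simp only [add_zero, ← sub_eq_add_neg] at h1 h2
    have h3 : 0 ≤ 8 * 2 ^ k * (U / r + (2 * F + δ)) * ‖h‖ := by positivity
    rw [abs_le] at h1 h2 ⊢
    constructor <;> linarith
  · have h1 := hU a (hlow a le_rfl)
    have h2 := hU (a - h) (hlow _ (by simpa using h0))
    have h3 := hU (a - h - h) (hlow _ (by simp only [Prod.fst_sub]; linarith))
    have h4 : 4 * U ≤ 8 * 2 ^ k * (U / r) * ‖h‖ := by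
      have e : 8 * 2 ^ k * (U / r) * ‖h‖ = 4 * U * (2 * 2 ^ k * ‖h‖) / r := by ring
      rw [e, le_div_iff₀ hr]
      exact mul_le_mul_of_nonneg_left (not_le.1 hkr).le (by positivity)
    have h5 : 0 ≤ N * ‖h‖ / 8 + 2 * C * (U / r + (2 * F + δ)) * ‖h‖
        + 8 * 2 ^ k * (2 * F + δ) * ‖h‖ := by positivity
    rw [abs_le] at h1 h2 h3 ⊢
    constructor <;> linarith

theorem mem_Q0_iff {d : ℕ} {r : ℝ} {z : ℝ × E d} :
    z ∈ Q0 d 1 r ↔ (-r < z.1 ∧ z.1 < 0) ∧ ‖z.2‖ < r := by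
  simp [Q0, Q, mem_prod]

/-- The distance of a point of `Q₁` to the backward parabolic boundary. -/
def bdist {d : ℕ} (z : ℝ × E d) : ℝ := min (z.1 + 1) (1 - ‖z.2‖)

/-- The weighted Zygmund condition on the part of `Q₁` up to time `τ`. -/
def WeightedZyg {d : ℕ} (u : ℝ × E d → ℝ) (τ N : ℝ) : Prop :=
  ∀ p q : ℝ × E d, 0 < bdist p → 0 < bdist q → p.1 ≤ τ → q.1 ≤ τ →
    min (bdist p) (bdist q) * |u p + u q - 2 * u ((1 / 2 : ℝ) • (p + q))| ≤ N * ‖p - q‖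

theorem exists_weightedZyg {d : ℕ} {u : ℝ × E d → ℝ}
    (hu : ContDiffOn ℝ (⊤ : ℕ∞) u (lowerHalf d)) {τ : ℝ} (hτ : τ < 0) :
    ∃ N, 0 ≤ N ∧ WeightedZyg u τ N := by
  set S : Set (ℝ × E d) := Icc (-1) τ ×ˢ closedBall 0 1 with hS
  have hSl : S ⊆ lowerHalf d := fun z hz => ⟨hz.1.2.trans_lt hτ, mem_univ _⟩
  have hSc : Convex ℝ S := (convex_Icc _ _).prod (convex_closedBall _ _)
  have hSk : IsCompact S := isCompact_Icc.prod (isCompact_closedBall _ _)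
  have hcont : ContinuousOn (fderiv ℝ u) S :=
    (hu.continuousOn_fderiv_of_isOpen (isOpen_lowerHalf d) (by simp)).mono hSl
  obtain ⟨L, hL⟩ := hSk.exists_bound_of_continuousOn hcont
  have hlip : ∀ p ∈ S, ∀ q ∈ S, |u q - u p| ≤ max L 0 * ‖q - p‖ := fun p hp q hq =>
    hSc.norm_image_sub_le_of_norm_fderiv_le (𝕜 := ℝ)
      (fun z hz => (hu.contDiffAt ((isOpen_lowerHalf d).mem_nhds (hSl hz))).differentiableAt
        (by simp)) (fun z hz => (hL z hz).trans (le_max_left _ _)) hp hq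
  have hmem : ∀ p : ℝ × E d, 0 < bdist p → p.1 ≤ τ → p ∈ S := fun p hp hpτ => by
    obtain ⟨h1, h2⟩ := lt_min_iff.1 hp
    exact ⟨⟨by linarith, hpτ⟩, by rw [mem_closedBall_zero_iff]; linarith⟩
  refine ⟨max L 0, le_max_right _ _, fun p q hp hq hpτ hqτ => ?_⟩
  have hpS := hmem p hp hpτ
  have hqS := hmem q hq hqτ
  have hmS : (1 / 2 : ℝ) • (p + q) ∈ S := by
    rw [smul_add]
    exact hSc hpS hqS (by norm_num) (by norm_num) (by norm_num)
  have h1 := hlip _ hmS p hpS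
  have h2 := hlip _ hmS q hqS
  rw [show p - (1 / 2 : ℝ) • (p + q) = (1 / 2 : ℝ) • (p - q) by module, norm_smul,
    Real.norm_of_nonneg (by norm_num)] at h1
  rw [show q - (1 / 2 : ℝ) • (p + q) = (1 / 2 : ℝ) • (q - p) by module, norm_smul,
    Real.norm_of_nonneg (by norm_num), norm_sub_rev q p] at h2
  have h3 : min (bdist p) (bdist q) ≤ 1 := by
    refine (min_le_left _ _).trans ((min_le_right _ _).trans ?_)
    linarith [norm_nonneg p.2]
  refine (mul_le_of_le_one_left (abs_nonneg _) h3).trans ?_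
  rw [abs_le] at h1 h2 ⊢
  constructor <;> linarith

/-- Cylinders of half the boundary distance stay in `Q₁`. -/
theorem half_bdist_le_of_mem_cyl {d : ℕ} {a z : ℝ × E d} (hz : z ∈ cyl a (bdist a / 2)) :
    bdist a / 2 ≤ bdist z := by
  obtain ⟨⟨h1, h2⟩, h3⟩ := hz
  have h4 : bdist a ≤ a.1 + 1 := min_le_left _ _
  have h5 : bdist a ≤ 1 - ‖a.2‖ := min_le_right _ _
  rw [mem_closedBall, dist_eq_norm] at h3
  refine le_min (by linarith) ?_
  linarith [norm_le_norm_add_norm_sub' z.2 a.2]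

theorem mem_Q0_of_bdist_pos {d : ℕ} {z : ℝ × E d} (hz : 0 < bdist z) (h0 : z.1 < 0) :
    z ∈ Q0 d 1 1 := by
  obtain ⟨h1, h2⟩ := lt_min_iff.1 hz
  exact mem_Q0_iff.2 ⟨⟨by linarith, h0⟩, by linarith⟩

/-- The interior Zygmund estimate. -/
theorem exists_interior_zygmund {d : ℕ} (hd : 1 ≤ d) {lam Lam : ℝ} (hlam : 0 < lam)
    (hlL : lam ≤ Lam) :
    ∃ C : ℝ, 0 < C ∧ ∀ (ι : Type) (_ : Nonempty ι) (K : ι → E d → ℝ) (f : ι → ℝ × E d → ℝ)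
      (u : ℝ × E d → ℝ) (F U δ : ℝ), (∀ a, IsKer lam Lam (K a)) →
      (∀ a, ∀ z ∈ Q0 d 1 1, |f a z| ≤ F) → ContDiffOn ℝ (⊤ : ℕ∞) u (lowerHalf d) →
      (∀ z ∈ lowerHalf d, |u z| ≤ U) →
      (∀ z ∈ lowerHalf d, Integrable (fun y : E d =>
        deltaU 1 u z.1 z.2 y * ‖y‖ ^ (-((d : ℝ) + 1)))) →
      (∀ z ∈ Q0 d 1 1, ut u z = ⨅ a, (Lop 1 (K a) u z + f a z)) → 0 < δ →
      ∀ τ < 0, WeightedZyg u τ (C * (U + (2 * F + δ))) := by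
  obtain ⟨C, hC, hkey⟩ := exists_second_difference_bound hd hlam hlL
  refine ⟨2 * C, by positivity, ?_⟩
  intro ι hι K f u F U δ hK hf hu hU hint heq hδ τ hτ
  have hkey := hkey ι hι K f u F U δ hK hf hu hU hint heq hδ
  have hmem : ((-1 / 2 : ℝ), (0 : E d)) ∈ Q0 d 1 1 := mem_Q0_iff.2 (by norm_num)
  have hU0 : 0 ≤ U := (abs_nonneg _).trans (hU _ (Q0_subset_lowerHalf d hmem))
  have hF0 : 0 ≤ F := (abs_nonneg _).trans (hf (Classical.arbitrary ι) _ hmem)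
  set G : ℝ := 2 * F + δ with hG
  have hG0 : 0 < G := by linarith
  have hordered : ∀ N, 0 ≤ N → WeightedZyg u τ N → ∀ p q : ℝ × E d, 0 < bdist p → 0 < bdist q →
      p.1 ≤ τ → q.1 ≤ p.1 →
      min (bdist p) (bdist q) * |u p + u q - 2 * u ((1 / 2 : ℝ) • (p + q))|
        ≤ (N / 2 + C * (U + G)) * ‖p - q‖ := by
    intro N hN hz p q hp hq hpτ hqp
    rcases eq_or_ne p q with rfl | hpq
    · rw [← two_smul ℝ p, smul_smul]
      norm_num
      ring_nf
      simp
    set r : ℝ := bdist p / 2 with hr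
    have hr0 : 0 < r := by positivity
    have hr1 : r ≤ 1 / 2 := by
      have : bdist p ≤ 1 - ‖p.2‖ := min_le_right _ _
      linarith [norm_nonneg p.2]
    have hZ : ZygOn u (cyl p r) (N / r) := by
      intro x hx y hy
      have hbx : r ≤ bdist x := half_bdist_le_of_mem_cyl hx
      have hby : r ≤ bdist y := half_bdist_le_of_mem_cyl hy
      have h := hz x y (hr0.trans_le hbx) (hr0.trans_le hby) (hx.1.2.trans hpτ)
        (hy.1.2.trans hpτ)
      rw [div_mul_eq_mul_div, le_div_iff₀ hr0, mul_comm]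
      exact (mul_le_mul_of_nonneg_right (le_min hbx hby) (abs_nonneg _)).trans h
    have h := hkey p ((1 / 2 : ℝ) • (p - q)) r (N / r) hr0
      (fun z hz' => mem_Q0_of_bdist_pos (hr0.trans_le (half_bdist_le_of_mem_cyl hz'))
        ((hz'.1.2.trans hpτ).trans_lt hτ)) (by positivity) hZ
      (by
        simp only [Prod.smul_fst, Prod.fst_sub, smul_eq_mul]
        linarith)
      (smul_ne_zero (by norm_num) (sub_ne_zero.2 hpq))
    rw [show p - (1 / 2 : ℝ) • (p - q) - (1 / 2 : ℝ) • (p - q) = q by module,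
      show p - (1 / 2 : ℝ) • (p - q) = (1 / 2 : ℝ) • (p + q) by module, norm_smul,
      Real.norm_of_nonneg (by norm_num)] at h
    calc min (bdist p) (bdist q) * |u p + u q - 2 * u ((1 / 2 : ℝ) • (p + q))|
        ≤ (2 * r) * (N / r * (1 / 2 * ‖p - q‖) / 8
          + C * (U / r + G) * (1 / 2 * ‖p - q‖)) := by
          refine mul_le_mul ((min_le_left _ _).trans (by linarith)) h (abs_nonneg _)
            (by positivity)
      _ = (N / 8 + C * (U + r * G)) * ‖p - q‖ := by
          field_simp
      _ ≤ (N / 2 + C * (U + G)) * ‖p - q‖ := by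
          have : r * G ≤ G := mul_le_of_le_one_left hG0.le (by linarith)
          gcongr
          norm_num
  have hhalf : ∀ N, 0 ≤ N → WeightedZyg u τ N → WeightedZyg u τ (N / 2 + C * (U + G)) := by
    intro N hN hz p q hp hq hpτ hqτ
    rcases le_total q.1 p.1 with h | h
    · exact hordered N hN hz p q hp hq hpτ h
    · have := hordered N hN hz q p hq hp hqτ h
      rwa [min_comm, add_comm (u q), add_comm q, norm_sub_rev] at this
  obtain ⟨N, hN, hz⟩ := exists_weightedZyg hu hτ
  have hiter : ∀ n : ℕ, WeightedZyg u τ (N * (1 / 2) ^ n + 2 * C * (U + G)) := by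
    intro n
    induction n with
    | zero =>
      refine fun p q hp hq hpτ hqτ => (hz p q hp hq hpτ hqτ).trans ?_
      have : 0 ≤ 2 * C * (U + G) := by positivity
      gcongr
      simpa using this
    | succ n ih =>
      have := hhalf _ (by positivity) ih
      convert this using 1
      ring
  intro p q hp hq hpτ hqτ
  have ht : Filter.Tendsto (fun n : ℕ => (N * (1 / 2 : ℝ) ^ n + 2 * C * (U + G)) * ‖p - q‖)
      Filter.atTop (nhds ((N * 0 + 2 * C * (U + G)) * ‖p - q‖)) :=
    (((_root_.tendsto_pow_atTop_nhds_zero_of_lt_one (by norm_num) (by norm_num)).const_mul N).add_const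
      _).mul_const _
  rw [mul_zero, zero_add] at ht
  exact ge_of_tendsto' ht fun n => hiter n p q hp hq hpτ hqτ

theorem norm_le_toReal_supENorm {d : ℕ} {Ω : Set (ℝ × E d)} {f : ℝ × E d → ℝ} {M : ℝ≥0∞}
    (hM : M < ⊤) (hf : supENorm Ω f ≤ M) {z : ℝ × E d} (hz : z ∈ Ω) : |f z| ≤ M.toReal := by
  have h : ENNReal.ofReal ‖f z‖ ≤ M :=
    (le_iSup (fun p : Ω => ENNReal.ofReal ‖f p.1‖) ⟨z, hz⟩).trans hf
  simpa [ENNReal.toReal_ofReal (norm_nonneg _)] using ENNReal.toReal_mono hM.ne h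

theorem half_le_bdist {d : ℕ} {z : ℝ × E d} (hz : z ∈ Q0 d 1 (1 / 2)) : 1 / 2 ≤ bdist z := by
  obtain ⟨⟨h1, -⟩, h2⟩ := mem_Q0_iff.1 hz
  exact le_min (by linarith) (by linarith)

/-- Corollary 1.3 (ii), case σ = 1: local space-time Zygmund estimate for
translation invariant equations with bounded data. -/
theorem statement5 (d : ℕ) (hd : 1 ≤ d) (lam Lam : ℝ)
    (hlam : 0 < lam) (hlL : lam ≤ Lam) :
    ∃ C : ℝ, 0 < C ∧
      ∀ (ι : Type) (_ : Nonempty ι) (K : ι → E d → ℝ) (f : ι → ℝ × E d → ℝ)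
        (u : ℝ × E d → ℝ),
        -- kernels in L₀ (σ = 1), independent of (t,x), with the cancellation condition
        (∀ a, memL0 1 lam Lam (K a)) →
        (∀ a, Measurable (K a)) →
        -- sup_a ‖f_a‖_{L∞(Q₁)} < ∞
        (⨆ a, supENorm (Q0 d 1 1) (f a)) < ⊤ →
        -- u is smooth and bounded on (-∞,0) × ℝ^d
        ContDiffOn ℝ (⊤ : ℕ∞) u (lowerHalf d) →
        supENorm (lowerHalf d) u < ⊤ →
        -- δu(t,x,·) is integrable against |y|^{-d-1}
        (∀ z ∈ lowerHalf d,
          Integrable (fun y : E d =>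
            deltaU 1 u z.1 z.2 y * ‖y‖ ^ (-((d : ℝ) + 1)))) →
        -- the equation u_t = inf_a (L_a u + f_a) in Q₁
        (∀ z ∈ Q0 d 1 1, ut u z = ⨅ a, (Lop 1 (K a) u z + f a z)) →
        zygFull (Q0 d 1 (1 / 2)) u
          ≤ ENNReal.ofReal C *
              ((⨆ a, supENorm (Q0 d 1 1) (f a)) + supENorm (lowerHalf d) u) := by
  obtain ⟨C, hC, hmain⟩ := exists_interior_zygmund hd hlam hlL
  refine ⟨8 * C, by positivity, ?_⟩
  intro ι hι K f u hK hKm hfF hu hU hint heq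
  set F := (⨆ a, supENorm (Q0 d 1 1) (f a)) with hF
  set U := supENorm (lowerHalf d) u with hUdef
  rw [← ENNReal.ofReal_toReal hfF.ne, ← ENNReal.ofReal_toReal hU.ne,
    ← ENNReal.ofReal_add ENNReal.toReal_nonneg ENNReal.toReal_nonneg,
    ← ENNReal.ofReal_mul (by positivity)]
  refine iSup_le fun z => iSup_le fun h => iSup_le fun hh => iSup_le fun hz => iSup_le fun hp =>
    iSup_le fun hq => ENNReal.ofReal_le_ofReal ?_
  have hh0 : 0 < ‖h‖ := norm_pos_iff.2 hh
  rw [div_le_iff₀ hh0]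
  have hδ : ∀ δ > 0, |u (z + h) + u (z - h) - 2 * u z|
      ≤ 4 * C * (U.toReal + (2 * F.toReal + δ)) * ‖h‖ := by
    intro δ hδ
    have hbp := half_le_bdist hp
    have hbq := half_le_bdist hq
    have h1 := hmain ι hι K f u F.toReal U.toReal δ (fun a => ⟨hK a, hKm a⟩)
      (fun a z hz => norm_le_toReal_supENorm hfF (le_iSup (fun a => supENorm (Q0 d 1 1) (f a)) a) hz)
      hu (fun z hz => norm_le_toReal_supENorm hU le_rfl hz) hint heq hδ
      (max (z + h).1 (z - h).1) (max_lt hp.1.2 hq.1.2) (z + h) (z - h) (by linarith) (by linarith)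
      (le_max_left _ _) (le_max_right _ _)
    rw [show (1 / 2 : ℝ) • (z + h + (z - h)) = z by module,
      show z + h - (z - h) = (2 : ℝ) • h by module, norm_smul,
      Real.norm_of_nonneg (by norm_num)] at h1
    have h2 := mul_le_mul_of_nonneg_right (le_min hbp hbq)
      (abs_nonneg (u (z + h) + u (z - h) - 2 * u z))
    linarith
  refine le_of_forall_pos_le_add fun ε hε => ?_
  have h1 := hδ (ε / (4 * C * ‖h‖)) (by positivity)
  have h2 : 4 * C * (U.toReal + (2 * F.toReal + ε / (4 * C * ‖h‖))) * ‖h‖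
      = 4 * C * (U.toReal + 2 * F.toReal) * ‖h‖ + ε := by
    field_simp
    ring
  have h3 : 0 ≤ 4 * C * U.toReal * ‖h‖ := by positivity
  linarith
end
end

section
/- Let σ ∈ (1,2) and α ∈ (0,1) with σ + α > 2 and σ + α not an integer. Let η be a fixed nonnegative smooth cutoff function with η ≡ 1 in Q₁ and η vanishing outside (−(5/4)^σ, (5/4)^σ) × B_{5/4}, and set v = ηu (extended by zero). Assume u ∈ C^{1+α/σ, σ+α}(Q_{11/8}) ∩ C^{α/σ, α}((−(11/8)^σ, 0) × ℝ^d), and for each a ∈ A let K_a ∈ L₀ satisfy |K_a(t,x,y) − K_a(t',x',y)| ≤ A₀(|x−x'|^α + |t−t'|^{α/σ})·Λ(2−σ)|y|^{−d−σ} for a constant A₀ ≥ 0. Define g_a(t,x) = ∫_{ℝ^d} δv(t,x,y)(K_a(t,x,y) − K_a(0,0,y)) dy and h_a(t,x) = ∫_{ℝ^d} ((η(t,x) − η(t,x+y))u(t,x+y) + y·Dη(t,x)·u(t,x)) K_a(t,x,y) dy. Then for every a ∈ A: [g_a]_{α/σ, α; Q₁} ≤ C A₀ ([v]_{1+α/σ,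 α+σ; ℝ₀^{d+1}} + [v]_{α/σ, α; ℝ₀^{d+1}}) and [h_a]_{α/σ, α; Q₁} ≤ C (A₀ + 1)(‖u‖_{α/σ, α; (−(11/8)^σ, 0)×ℝ^d} + ‖D²u‖_{L∞(Q_{11/8})}), where C depends only on d, λ, Λ, α, σ, and the cutoff η. -/
open MeasureTheory Set Metric ENNReal
open scoped Classical
noncomputable section

open MeasureTheory Set Metric ENNReal Nonlocal

namespace Nonlocal

open Filter Topology

section Taylor

variable {V W : Type*} [NormedAddCommGroup V] [NormedSpace ℝ V]
  [NormedAddCommGroup W] [NormedSpace ℝ W]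

theorem norm_iteratedFDeriv_two_sub (f g : V → W) (x y : V) :
    ‖iteratedFDeriv ℝ 2 f x - iteratedFDeriv ℝ 2 g y‖
      = ‖fderiv ℝ (fderiv ℝ f) x - fderiv ℝ (fderiv ℝ g) y‖ := by
  have key : ∀ (h : V → W) (z : V), iteratedFDeriv ℝ 2 h z =
      (continuousMultilinearCurryRightEquiv' ℝ 1 V W).symm
        ((continuousMultilinearCurryRightEquiv' ℝ 0 V (V →L[ℝ] W)).symm
          ((continuousMultilinearCurryFin0 ℝ V (V →L[ℝ] V →L[ℝ] W)).symm
            (fderiv ℝ (fderiv ℝ h) z))) := by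
    intro h z
    rw [iteratedFDeriv_succ_eq_comp_right, Function.comp_apply,
      iteratedFDeriv_succ_eq_comp_right, Function.comp_apply,
      iteratedFDeriv_zero_eq_comp, Function.comp_apply]
  simp only [key, ← LinearIsometryEquiv.map_sub, LinearIsometryEquiv.norm_map]

theorem norm_image_add_sub_sub_fderiv_le {f : V → W} (hf : Differentiable ℝ f) {x y : V} {C : ℝ}
    (hC : ∀ w, ‖w‖ ≤ ‖y‖ → ‖fderiv ℝ f (x + w) - fderiv ℝ f x‖ ≤ C) :
    ‖f (x + y) - f x - fderiv ℝ f x y‖ ≤ C * ‖y‖ := by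
  have := (convex_closedBall x ‖y‖).norm_image_sub_le_of_norm_fderiv_le' (𝕜 := ℝ) (f := f)
    (φ := fderiv ℝ f x) (C := C) (x := x) (y := x + y) (fun z _ => hf z)
    (fun z hz => by
      have := hC (z - x) (by simpa [dist_eq_norm] using hz)
      simpa using this)
    (by simp) (by simp)
  simpa using this

theorem norm_image_add_sub_le {f : V → W} (hf : Differentiable ℝ f) {B : ℝ}
    (hB : ∀ x, ‖fderiv ℝ f x‖ ≤ B) (x y : V) : ‖f (x + y) - f x‖ ≤ B * ‖y‖ := by
  simpa using convex_univ.norm_image_sub_le_of_norm_fderiv_le (𝕜 := ℝ) (f := f) (C := B)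
    (fun z _ => hf z) (fun z _ => hB z) (mem_univ x) (mem_univ (x + y))

theorem differentiable_fderiv_of_contDiff_two {f : V → W} (hf : ContDiff ℝ 2 f) :
    Differentiable ℝ (fderiv ℝ f) :=
  (hf.fderiv_right (m := 1) (by norm_num)).differentiable (by norm_num)

theorem norm_taylor_le_of_norm_fderiv_fderiv_le {f : V → W} (hf : ContDiff ℝ 2 f) {B : ℝ}
    (hB0 : 0 ≤ B) (hB : ∀ x, ‖fderiv ℝ (fderiv ℝ f) x‖ ≤ B) (x y : V) :
    ‖f (x + y) - f x - fderiv ℝ f x y‖ ≤ B * ‖y‖ ^ 2 := by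
  refine (norm_image_add_sub_sub_fderiv_le (hf.differentiable (by norm_num))
    (C := B * ‖y‖) fun w hw => ?_).trans (le_of_eq (by ring))
  exact (norm_image_add_sub_le (differentiable_fderiv_of_contDiff_two hf) hB x w).trans (by gcongr)

theorem norm_sub_taylor_le_of_holder {f : V → W} (hf : ContDiff ℝ 2 f) {M γ : ℝ}
    (hM0 : 0 ≤ M) (hγ : 0 ≤ γ)
    (hM : ∀ x x', ‖fderiv ℝ (fderiv ℝ f) x - fderiv ℝ (fderiv ℝ f) x'‖ ≤ M * ‖x - x'‖ ^ γ)
    {x x' : V} {R : ℝ} (hR : ‖x - x'‖ ≤ R) (y : V) :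
    ‖(f (x + y) - f x - fderiv ℝ f x y) - (f (x' + y) - f x' - fderiv ℝ f x' y)‖
      ≤ M * min (R ^ γ * ‖y‖ ^ 2) (R * ‖y‖ ^ (γ + 1)) := by
  have hR0 : 0 ≤ R := (norm_nonneg _).trans hR
  have hf2 := differentiable_fderiv_of_contDiff_two hf
  have hf2' : ∀ a : V, Differentiable ℝ fun z => fderiv ℝ f (z + a) := fun a =>
    hf2.comp (differentiable_id.add_const a)
  have shift : ∀ a : V, ContDiff ℝ 2 fun w => f (w + a) := fun a =>
    hf.comp (contDiff_id.add contDiff_const)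
  have hφ : ContDiff ℝ 2 fun w => f (w + x) - f (w + x') := (shift x).sub (shift x')
  have hφ' : fderiv ℝ (fun w => f (w + x) - f (w + x'))
      = fun w => fderiv ℝ f (w + x) - fderiv ℝ f (w + x') := by
    ext1 w
    rw [fderiv_fun_sub ((shift x).differentiable (by norm_num) w)
      ((shift x').differentiable (by norm_num) w), fderiv_comp_add_right, fderiv_comp_add_right]
  have hφ'' : ∀ w, fderiv ℝ (fderiv ℝ (fun w => f (w + x) - f (w + x'))) w
      = fderiv ℝ (fderiv ℝ f) (w + x) - fderiv ℝ (fderiv ℝ f) (w + x') := by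
    intro w
    rw [hφ', fderiv_fun_sub (hf2' x w)
      (hf2' x' w), fderiv_comp_add_right,
      fderiv_comp_add_right]
  have rew : (f (x + y) - f x - fderiv ℝ f x y) - (f (x' + y) - f x' - fderiv ℝ f x' y)
      = (fun w => f (w + x) - f (w + x')) (0 + y) - (fun w => f (w + x) - f (w + x')) 0
        - fderiv ℝ (fun w => f (w + x) - f (w + x')) 0 y := by
    rw [hφ']
    simp only [zero_add, sub_apply, add_comm y]
    abel
  rw [rew, mul_min_of_nonneg _ _ hM0]
  refine le_min ?_ ?_
  · refine (norm_taylor_le_of_norm_fderiv_fderiv_le hφ (B := M * R ^ γ) (by positivity)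
      (fun w => ?_) 0 y).trans (le_of_eq (by ring))
    rw [hφ'']
    refine (hM _ _).trans ?_
    rw [add_sub_add_left_eq_sub]
    gcongr
  · refine (norm_image_add_sub_sub_fderiv_le (hφ.differentiable (by norm_num))
      (C := M * ‖y‖ ^ γ * R) fun w hw => ?_).trans (le_of_eq ?_)
    · rw [hφ']
      have hψ : ∀ z, fderiv ℝ (fun z => fderiv ℝ f (z + w) - fderiv ℝ f z) z
          = fderiv ℝ (fderiv ℝ f) (z + w) - fderiv ℝ (fderiv ℝ f) z := fun z => by
        rw [fderiv_fun_sub (hf2' w z) (hf2 z),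
          fderiv_comp_add_right]
      have := norm_image_add_sub_le (f := fun z => fderiv ℝ f (z + w) - fderiv ℝ f z)
        ((hf2' w).sub hf2) (B := M * ‖y‖ ^ γ)
        (fun z => by
          rw [hψ]
          refine (hM _ _).trans ?_
          rw [add_sub_cancel_left]
          gcongr) x' (x - x')
      simp only [add_sub_cancel, zero_add] at this ⊢
      calc _ = ‖fderiv ℝ f (x + w) - fderiv ℝ f x - (fderiv ℝ f (x' + w) - fderiv ℝ f x')‖ := by
            rw [add_comm w x, add_comm w x']; congr 1; abel
        _ ≤ M * ‖y‖ ^ γ * ‖x - x'‖ := this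
        _ ≤ _ := by gcongr
    · rw [Real.rpow_add_one' (norm_nonneg _) (by positivity)]
      ring

theorem norm_le_of_norm_fderiv_le_of_eq_zero [Nontrivial V] {g : V → W} (hg : Differentiable ℝ g)
    {B : ℝ} (hB0 : 0 ≤ B) (hB : ∀ x, ‖fderiv ℝ g x‖ ≤ B) (h0 : ∀ x, 2 ≤ ‖x‖ → g x = 0) (x : V) :
    ‖g x‖ ≤ 4 * B := by
  rcases le_total 2 ‖x‖ with hx | hx
  · rw [h0 x hx, norm_zero]; positivity
  · obtain ⟨p, hp⟩ := exists_norm_eq V (c := 2) (by norm_num)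
    have h := norm_image_add_sub_le hg hB p (x - p)
    rw [add_sub_cancel, h0 p hp.ge, sub_zero] at h
    have : ‖x - p‖ ≤ 4 := (norm_sub_le _ _).trans (by linarith)
    nlinarith

theorem norm_le_of_holder_of_eq_zero {G : Type*} [NormedAddCommGroup G] [Nontrivial V]
    {g : V → G} {M γ : ℝ} (hM0 : 0 ≤ M)
    (hγ : γ ∈ Icc (0 : ℝ) 1) (hM : ∀ x x', ‖g x - g x'‖ ≤ M * ‖x - x'‖ ^ γ)
    (h0 : ∀ x, 2 ≤ ‖x‖ → g x = 0) (x : V) : ‖g x‖ ≤ 4 * M := by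
  rcases le_total 2 ‖x‖ with hx | hx
  · rw [h0 x hx, norm_zero]; positivity
  · obtain ⟨p, hp⟩ := exists_norm_eq V (c := 2) (by norm_num)
    have h := hM x p
    rw [h0 p hp.ge, sub_zero] at h
    have h4 : ‖x - p‖ ^ γ ≤ 4 := calc
      ‖x - p‖ ^ γ ≤ 4 ^ γ := by
        gcongr
        · exact hγ.1
        · exact (norm_sub_le _ _).trans (by linarith)
      _ ≤ 4 ^ (1 : ℝ) := Real.rpow_le_rpow_of_exponent_le (by norm_num) hγ.2
      _ = 4 := Real.rpow_one 4
    nlinarith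

theorem norm_taylor_le_of_eq_zero [Nontrivial V] {f : V → W} (hf : ContDiff ℝ 2 f) {B : ℝ}
    (hB0 : 0 ≤ B) (hB : ∀ x, ‖fderiv ℝ (fderiv ℝ f) x‖ ≤ B)
    (h0 : ∀ x, 2 ≤ ‖x‖ → fderiv ℝ f x = 0) (x y : V) :
    ‖f (x + y) - f x - fderiv ℝ f x y‖ ≤ 8 * B * min (‖y‖ ^ 2) ‖y‖ := by
  have hD := norm_le_of_norm_fderiv_le_of_eq_zero (differentiable_fderiv_of_contDiff_two hf)
    hB0 hB h0
  rw [mul_min_of_nonneg _ _ (by positivity)]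
  refine le_min ?_ ?_
  · refine (norm_taylor_le_of_norm_fderiv_fderiv_le hf hB0 hB x y).trans ?_
    gcongr
    linarith
  · refine norm_image_add_sub_sub_fderiv_le (hf.differentiable (by norm_num)) fun w _ => ?_
    refine (norm_sub_le _ _).trans ?_
    linarith [hD (x + w), hD x]

/-- A function that vanishes together with its derivative on a set is, quadratically in the
distance to that set, small. -/
theorem norm_le_mul_min_of_eq_zero {f : V → W} (hf : ContDiff ℝ 2 f) {B : ℝ} (hB0 : 0 ≤ B)
    (hB : ∀ x, ‖f x‖ ≤ B) (hB2 : ∀ x, ‖fderiv ℝ (fderiv ℝ f) x‖ ≤ B) {x : V}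
    (h0 : f =ᶠ[𝓝 x] 0) (y : V) : ‖f (x + y)‖ ≤ B * min (‖y‖ ^ 2) 1 := by
  rw [mul_min_of_nonneg _ _ hB0]
  refine le_min ?_ (by simpa using hB (x + y))
  have h := norm_taylor_le_of_norm_fderiv_fderiv_le hf hB0 hB2 x y
  have h1 : fderiv ℝ f x = 0 := by rw [h0.fderiv_eq]; simp
  simpa [h1, h0.eq_of_nhds] using h

end Taylor

section Integrals

variable {d : ℕ}

theorem integrable_min_rpow_mul_norm_rpow (hd : 1 ≤ d) {p q σ : ℝ} (hq : q < σ) (hp : σ < p) :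
    Integrable fun y : E d => min (‖y‖ ^ p) (‖y‖ ^ q) * ‖y‖ ^ (-((d : ℝ) + σ)) := by
  have : Nonempty (Fin d) := ⟨⟨0, hd⟩⟩
  have hmul : ∀ a s : ℝ, 0 < s →
      s ^ (d - 1) * (s ^ a * s ^ (-((d : ℝ) + σ))) = s ^ (a - σ - 1) := by
    intro a s hs
    rw [← Real.rpow_natCast, ← Real.rpow_add hs, ← Real.rpow_add hs, Nat.cast_sub hd]
    congr 1
    push_cast
    ring
  refine (integrable_fun_norm_addHaar (E := E d) volume
    (f := fun s => min (s ^ p) (s ^ q) * s ^ (-((d : ℝ) + σ)))).2 ?_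
  rw [finrank_euclideanSpace_fin, ← Ioc_union_Ioi_eq_Ioi (zero_le_one' ℝ)]
  refine IntegrableOn.union ?_ ?_
  · have h : IntegrableOn (fun s : ℝ => s ^ (p - σ - 1)) (Ioc 0 1) := by
      rw [integrableOn_Ioc_iff_integrableOn_Ioo, intervalIntegral.integrableOn_Ioo_rpow_iff one_pos]
      linarith
    refine h.congr_fun (fun s hs => ?_) measurableSet_Ioc
    have hle : s ^ p ≤ s ^ q := Real.rpow_le_rpow_of_exponent_ge hs.1 hs.2 (by linarith)
    simp only [smul_eq_mul, min_eq_left hle, hmul p s hs.1]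
  · have h : IntegrableOn (fun s : ℝ => s ^ (q - σ - 1)) (Ioi 1) :=
      integrableOn_Ioi_rpow_of_lt (by linarith) one_pos
    refine h.congr_fun (fun s hs => ?_) measurableSet_Ioi
    have hs0 : (1 : ℝ) < s := hs
    have hle : s ^ q ≤ s ^ p := Real.rpow_le_rpow_of_exponent_le hs0.le (by linarith)
    simp only [smul_eq_mul, min_eq_right hle, hmul q s (by linarith)]

theorem scaled_min_eq {R : ℝ} (hR : 0 < R) (γ σ : ℝ) (y : E d) :
    min (R ^ γ * ‖y‖ ^ 2) (R * ‖y‖ ^ (γ + 1)) * ‖y‖ ^ (-((d : ℝ) + σ))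
      = R ^ (γ + 2 - σ - d) * (min (‖R⁻¹ • y‖ ^ (2 : ℝ)) (‖R⁻¹ • y‖ ^ (γ + 1))
          * ‖R⁻¹ • y‖ ^ (-((d : ℝ) + σ))) := by
  have hR' : 0 ≤ R⁻¹ := (inv_pos.2 hR).le
  rw [norm_smul, Real.norm_of_nonneg hR', Real.mul_rpow hR' (norm_nonneg _),
    Real.mul_rpow hR' (norm_nonneg _), Real.mul_rpow hR' (norm_nonneg _), Real.rpow_two ‖y‖,
    ← Real.rpow_neg_one, ← Real.rpow_mul hR.le, ← Real.rpow_mul hR.le, ← Real.rpow_mul hR.le]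
  have h1 : R ^ γ = R ^ (γ + 2) * R ^ (-1 * 2 : ℝ) := by
    rw [← Real.rpow_add hR]; congr 1; ring
  have h2 : R = R ^ (γ + 2) * R ^ (-1 * (γ + 1)) := by
    rw [← Real.rpow_add hR]; ring_nf; simp
  have h3 : R ^ (γ + 2) = R ^ (γ + 2 - σ - d) * R ^ (-1 * -((d : ℝ) + σ)) := by
    rw [← Real.rpow_add hR]; congr 1; ring
  have h4 : min (R ^ γ * ‖y‖ ^ 2) (R * ‖y‖ ^ (γ + 1))
      = R ^ (γ + 2) * min (R ^ (-1 * 2 : ℝ) * ‖y‖ ^ 2) (R ^ (-1 * (γ + 1)) * ‖y‖ ^ (γ + 1)) := by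
    rw [mul_min_of_nonneg _ _ (Real.rpow_nonneg hR.le _), ← mul_assoc, ← mul_assoc, ← h1, ← h2]
  rw [h4, h3]
  ring

theorem integrable_scaled_min (hd : 1 ≤ d) {R γ σ : ℝ} (hR : 0 < R) (hσ : σ < 2)
    (hγ : γ + 1 < σ) :
    Integrable fun y : E d =>
      min (R ^ γ * ‖y‖ ^ 2) (R * ‖y‖ ^ (γ + 1)) * ‖y‖ ^ (-((d : ℝ) + σ)) := by
  simp only [scaled_min_eq hR γ σ]
  exact ((integrable_min_rpow_mul_norm_rpow hd hγ hσ).comp_smul (inv_ne_zero hR.ne')).const_mul _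

theorem integral_scaled_min {R : ℝ} (hR : 0 < R) (γ σ : ℝ) :
    ∫ y : E d, min (R ^ γ * ‖y‖ ^ 2) (R * ‖y‖ ^ (γ + 1)) * ‖y‖ ^ (-((d : ℝ) + σ))
      = R ^ (γ + 2 - σ) *
        ∫ y : E d, min (‖y‖ ^ (2 : ℝ)) (‖y‖ ^ (γ + 1)) * ‖y‖ ^ (-((d : ℝ) + σ)) := by
  simp only [scaled_min_eq hR γ σ]
  rw [integral_const_mul, Measure.integral_comp_inv_smul_of_nonneg volume
    (fun y : E d => min (‖y‖ ^ (2 : ℝ)) (‖y‖ ^ (γ + 1)) * ‖y‖ ^ (-((d : ℝ) + σ))) hR.le,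
    finrank_euclideanSpace_fin, smul_eq_mul, ← mul_assoc, ← Real.rpow_natCast R d,
    ← Real.rpow_add hR]
  congr 2
  ring

end Integrals

section Hoelder

variable {d : ℕ} {F : Type*} [NormedAddCommGroup F]

theorem holderE_le_ofReal {α β c : ℝ} {Ω : Set (ℝ × E d)} {f : ℝ × E d → F} (hc : 0 ≤ c)
    (h : ∀ p ∈ Ω, ∀ q ∈ Ω, p ≠ q →
      ‖f p - f q‖ ≤ c * max (‖p.2 - q.2‖ ^ α) (|p.1 - q.1| ^ β)) :
    holderE β α Ω f ≤ ENNReal.ofReal c := by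
  refine iSup₂_le fun p q => ENNReal.ofReal_le_ofReal ?_
  by_cases hpq : p.1 = q.1
  · simpa [hpq] using hc
  · exact div_le_of_le_mul₀ (le_max_of_le_left (Real.rpow_nonneg (norm_nonneg _) _)) hc
      (h _ p.2 _ q.2 hpq)

theorem max_rpow_pos_of_ne {p q : ℝ × E d} (hpq : p ≠ q) (α β : ℝ) :
    0 < max (‖p.2 - q.2‖ ^ α) (|p.1 - q.1| ^ β) := by
  by_cases h : p.1 = q.1
  · have : p.2 - q.2 ≠ 0 := fun h' => hpq (Prod.ext h (sub_eq_zero.1 h'))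
    exact lt_max_of_lt_left (Real.rpow_pos_of_pos (norm_pos_iff.2 this) _)
  · exact lt_max_of_lt_right (Real.rpow_pos_of_pos (abs_pos.2 (sub_ne_zero.2 h)) _)

theorem norm_sub_le_of_holderE_le {α β : ℝ} {Ω : Set (ℝ × E d)} {f : ℝ × E d → F} {X : ℝ≥0∞}
    (hX : X ≠ ⊤) (h : holderE β α Ω f ≤ X) {p q : ℝ × E d} (hp : p ∈ Ω) (hq : q ∈ Ω) :
    ‖f p - f q‖ ≤ X.toReal * max (‖p.2 - q.2‖ ^ α) (|p.1 - q.1| ^ β) := by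
  by_cases hpq : p = q
  · subst hpq
    simp only [sub_self, norm_zero]
    exact mul_nonneg ENNReal.toReal_nonneg (le_max_of_le_left (Real.rpow_nonneg le_rfl _))
  · have h1 := (le_iSup₂ (f := fun (p q : Ω) => ENNReal.ofReal
      (‖f p.1 - f q.1‖ / max (‖p.1.2 - q.1.2‖ ^ α) (|p.1.1 - q.1.1| ^ β))) ⟨p, hp⟩ ⟨q, hq⟩).trans h
    rw [ENNReal.ofReal_le_iff_le_toReal hX] at h1
    exact (div_le_iff₀ (max_rpow_pos_of_ne hpq α β)).1 h1

theorem norm_le_of_supENorm_le {Ω : Set (ℝ × E d)} {f : ℝ × E d → F} {X : ℝ≥0∞}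
    (hX : X ≠ ⊤) (h : supENorm Ω f ≤ X) {p : ℝ × E d} (hp : p ∈ Ω) : ‖f p‖ ≤ X.toReal := by
  have h1 := (le_iSup (fun p : Ω => ENNReal.ofReal ‖f p.1‖) ⟨p, hp⟩).trans h
  rwa [ENNReal.ofReal_le_iff_le_toReal hX] at h1

end Hoelder

section Cutoff

variable {V : Type*} [NormedAddCommGroup V] [NormedSpace ℝ V]

theorem exists_bound_fderiv_of_hasCompactSupport {W : Type*} [NormedAddCommGroup W]
    [NormedSpace ℝ W] {f : V → W} (hf : ContDiff ℝ 1 f) (hc : HasCompactSupport f) :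
    ∃ B : ℝ, ∀ x, ‖fderiv ℝ f x‖ ≤ B :=
  (hc.fderiv ℝ).exists_bound_of_continuous (hf.continuous_fderiv (by norm_num))

theorem exists_bound_of_hasCompactSupport {W : Type*} [NormedAddCommGroup W] [NormedSpace ℝ W]
    {f : V → W} (hf : ContDiff ℝ 2 f) (hc : HasCompactSupport f) :
    ∃ B : ℝ, 0 ≤ B ∧ (∀ x, ‖f x‖ ≤ B) ∧ ∀ x, ‖fderiv ℝ (fderiv ℝ f) x‖ ≤ B := by
  obtain ⟨B, hB⟩ := hc.exists_bound_of_continuous hf.continuous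
  obtain ⟨B', hB'⟩ := exists_bound_fderiv_of_hasCompactSupport
    (hf.fderiv_right (m := 1) (by norm_num)) (hc.fderiv ℝ)
  exact ⟨max B B', le_max_of_le_left ((norm_nonneg _).trans (hB 0)),
    fun x => (hB x).trans (le_max_left _ _), fun x => (hB' x).trans (le_max_right _ _)⟩

theorem exists_cutoff_bound {η : V → ℝ} (hη : ContDiff ℝ (⊤ : ℕ∞) η) (hc : HasCompactSupport η)
    {Ω : Set V} (hΩ : IsOpen Ω) (hconv : Convex ℝ Ω) (h1 : ∀ z ∈ Ω, η z = 1) :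
    ∃ B : ℝ, 0 ≤ B ∧ (∀ z ∈ Ω, ∀ k, |1 - η (z + k)| ≤ B * min (‖k‖ ^ 2) 1) ∧
      ∀ z ∈ Ω, ∀ z' ∈ Ω, ∀ k,
        |η (z + k) - η (z' + k)| ≤ B * min (‖k‖ ^ 2) 1 * ‖z - z'‖ := by
  have hle : ∀ n : ℕ, (n : WithTop ℕ∞) ≤ ((⊤ : ℕ∞) : WithTop ℕ∞) := fun n => by
    exact_mod_cast le_top
  have hη1 : ContDiff ℝ 2 (fderiv ℝ η) := hη.fderiv_right (by exact_mod_cast hle 3)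
  have hη0 : ContDiff ℝ 2 η := hη.of_le (by exact_mod_cast hle 2)
  obtain ⟨B, hB, hB0, hB2⟩ := exists_bound_of_hasCompactSupport hη0 hc
  obtain ⟨B', hB', hB1, hB3⟩ := exists_bound_of_hasCompactSupport hη1 (hc.fderiv ℝ)
  have hloc : ∀ z ∈ Ω, (fun w => 1 - η w) =ᶠ[𝓝 z] 0 := fun z hz =>
    Filter.eventually_of_mem (hΩ.mem_nhds hz) fun w hw => by simp [h1 w hw]
  have hsub : fderiv ℝ (fun w => 1 - η w) = fun w => -fderiv ℝ η w := by
    exact funext fun w => fderiv_const_sub (f := η) (1 : ℝ)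
  have hloc1 : ∀ z ∈ Ω, fderiv ℝ η =ᶠ[𝓝 z] 0 := fun z hz => by
    have := (hloc z hz).fderiv (𝕜 := ℝ)
    rw [hsub] at this
    filter_upwards [this] with w hw
    simpa using hw
  refine ⟨1 + B + B', by positivity, fun z hz k => ?_, fun z hz z' hz' k => ?_⟩
  · refine norm_le_mul_min_of_eq_zero (f := fun w => 1 - η w)
      (contDiff_const.sub hη0) (by positivity) (fun x => ?_) (fun x => ?_) (hloc z hz) k
    · refine (norm_sub_le _ _).trans ?_
      have := hB0 x
      rw [norm_one]
      linarith
    · rw [hsub, fderiv_fun_neg]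
      exact (norm_neg (fderiv ℝ (fderiv ℝ η) x)).le.trans ((hB2 x).trans (by linarith))
  · have := hconv.norm_image_sub_le_of_norm_fderiv_le (𝕜 := ℝ) (f := fun w => η (w + k))
      (C := (1 + B + B') * min (‖k‖ ^ 2) 1)
      (fun w _ => ((hη.differentiable (by simp)).comp (differentiable_id.add_const k)) w)
      (fun w hw => by
        rw [fderiv_comp_add_right]
        exact norm_le_mul_min_of_eq_zero hη1 (by positivity) (fun x => (hB1 x).trans (by linarith))
          (fun x => (hB3 x).trans (by linarith)) (hloc1 w hw) k) hz' hz
    simpa using this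

end Cutoff

section Frozen

variable {d : ℕ}

theorem norm_taylor_sub_taylor_le {V W : Type*} [NormedAddCommGroup V] [NormedSpace ℝ V]
    [NormedAddCommGroup W] [NormedSpace ℝ W] [Nontrivial V] {f g : V → W}
    (hf : ContDiff ℝ 2 f) (hg : ContDiff ℝ 2 g) {M N γ : ℝ} (hM0 : 0 ≤ M) (hN0 : 0 ≤ N)
    (hγ : 0 ≤ γ)
    (hM : ∀ x x', ‖fderiv ℝ (fderiv ℝ f) x - fderiv ℝ (fderiv ℝ f) x'‖ ≤ M * ‖x - x'‖ ^ γ)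
    (hN : ∀ x, ‖fderiv ℝ (fderiv ℝ f) x - fderiv ℝ (fderiv ℝ g) x‖ ≤ N)
    (hf0 : ∀ x, 2 ≤ ‖x‖ → fderiv ℝ f x = 0) (hg0 : ∀ x, 2 ≤ ‖x‖ → fderiv ℝ g x = 0)
    {x x' : V} {R : ℝ} (hR : ‖x - x'‖ ≤ R) (y : V) :
    ‖(f (x + y) - f x - fderiv ℝ f x y) - (g (x' + y) - g x' - fderiv ℝ g x' y)‖
      ≤ M * min (R ^ γ * ‖y‖ ^ 2) (R * ‖y‖ ^ (γ + 1)) + 8 * N * min (‖y‖ ^ 2) ‖y‖ := by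
  have hfg' : fderiv ℝ (fun z => f z - g z) = fun z => fderiv ℝ f z - fderiv ℝ g z :=
    funext fun z => fderiv_fun_sub (hf.differentiable (by norm_num) z)
      (hg.differentiable (by norm_num) z)
  have h2 := norm_taylor_le_of_eq_zero (hf.sub hg) hN0
    (fun z => by
      rw [hfg', fderiv_fun_sub (differentiable_fderiv_of_contDiff_two hf z)
        (differentiable_fderiv_of_contDiff_two hg z)]
      exact hN z)
    (fun z hz => by simp only [hfg', hf0 z hz, hg0 z hz, sub_zero]) x' y
  have h1 := norm_sub_taylor_le_of_holder hf hM0 hγ hM hR y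
  refine le_trans (le_of_eq ?_) ((norm_add_le _ _).trans (add_le_add h1 h2))
  rw [hfg']
  congr 1
  simp only [sub_apply]
  abel

theorem mem_Q0_one {σ : ℝ} {z : ℝ × E d} :
    z ∈ Q0 d σ 1 ↔ z.1 ∈ Ioo (-1 : ℝ) 0 ∧ ‖z.2‖ < 1 := by
  simp [Q0, Q, mem_prod]

theorem ae_ne_zero (hd : 1 ≤ d) : ∀ᵐ y : E d, y ≠ 0 := by
  have : Nonempty (Fin d) := ⟨⟨0, hd⟩⟩
  exact Measure.ae_ne volume 0

theorem rpow_le_max_of_root {p q : ℝ × E d} {α β : ℝ} (hα : 0 < α) :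
    ‖p.2 - q.2‖ ≤ (max (‖p.2 - q.2‖ ^ α) (|p.1 - q.1| ^ β)) ^ α⁻¹ := by
  calc ‖p.2 - q.2‖ = (‖p.2 - q.2‖ ^ α) ^ α⁻¹ := (Real.rpow_rpow_inv (norm_nonneg _) hα.ne').symm
    _ ≤ _ := by
      gcongr
      exact le_max_left _ _

/-- Hölder bound for `∫ δv(z,y) (K(z,y) - K(0,y)) dy` when the time slices of `v` are `C²` with
compact support. -/
theorem norm_frozen_sub_le (hd : 1 ≤ d) {σ Lam α A0 M : ℝ} (hσ : σ ∈ Ioo (1 : ℝ) 2)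
    (hLam : 0 ≤ Lam) (hα : α ∈ Ioo (0 : ℝ) 1) (h2 : 2 < σ + α) (hA0 : 0 ≤ A0) (hM0 : 0 ≤ M)
    {K : ℝ × E d → E d → ℝ}
    (hK : ∀ z z' : ℝ × E d, ∀ y : E d, y ≠ 0 → |K z y - K z' y| ≤
      A0 * (‖z.2 - z'.2‖ ^ α + |z.1 - z'.1| ^ (α / σ)) *
        (Lam * (2 - σ) * ‖y‖ ^ (-((d : ℝ) + σ))))
    {v : ℝ × E d → ℝ} (hv : ∀ t ∈ Ioo (-1 : ℝ) 0, ContDiff ℝ 2 fun x => v (t, x))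
    (hv0 : ∀ t ∈ Ioo (-1 : ℝ) 0, ∀ x, 5 / 4 ≤ ‖x‖ → v (t, x) = 0)
    (hM : ∀ p : ℝ × E d, p.1 ∈ Ioo (-1 : ℝ) 0 → ∀ q : ℝ × E d, q.1 ∈ Ioo (-1 : ℝ) 0 →
      ‖iteratedFDeriv ℝ 2 (fun x => v (p.1, x)) p.2 - iteratedFDeriv ℝ 2 (fun x => v (q.1, x)) q.2‖
        ≤ M * max (‖p.2 - q.2‖ ^ (σ + α - 2)) (|p.1 - q.1| ^ (α / σ)))
    (hint : ∀ z ∈ Q0 d σ 1,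
      Integrable fun y : E d => deltaU σ v z.1 z.2 y * (K z y - K (0, (0 : E d)) y))
    {p q : ℝ × E d} (hp : p ∈ Q0 d σ 1) (hq : q ∈ Q0 d σ 1) (hpq : p ≠ q) :
    ‖(∫ y, deltaU σ v p.1 p.2 y * (K p y - K (0, (0 : E d)) y))
        - ∫ y, deltaU σ v q.1 q.2 y * (K q y - K (0, (0 : E d)) y)‖
      ≤ A0 * M * (Lam * (2 - σ)) *
          (80 * (∫ y : E d, min (‖y‖ ^ (2 : ℝ)) (‖y‖ ^ (1 : ℝ)) * ‖y‖ ^ (-((d : ℝ) + σ)))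
            + 2 * ∫ y : E d, min (‖y‖ ^ (2 : ℝ)) (‖y‖ ^ (σ + α - 2 + 1))
                * ‖y‖ ^ (-((d : ℝ) + σ)))
        * max (‖p.2 - q.2‖ ^ α) (|p.1 - q.1| ^ (α / σ)) := by
  have : Nonempty (Fin d) := ⟨⟨0, hd⟩⟩
  obtain ⟨hσ1, hσ2⟩ := hσ
  obtain ⟨hα0, hα1⟩ := hα
  have hβ : 0 < α / σ := by positivity
  set γ := σ + α - 2 with hγ
  have hγ0 : 0 < γ := by linarith
  have hγ1 : γ ≤ 1 := by linarith
  set m := max (‖p.2 - q.2‖ ^ α) (|p.1 - q.1| ^ (α / σ)) with hm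
  have hm0 : 0 < m := max_rpow_pos_of_ne hpq _ _
  set R := m ^ α⁻¹ with hRdef
  have hR0 : 0 < R := Real.rpow_pos_of_pos hm0 _
  have hRm : R ^ α = m := Real.rpow_inv_rpow hm0.le hα0.ne'
  have hR : ‖p.2 - q.2‖ ≤ R := rpow_le_max_of_root hα0
  have hp' := mem_Q0_one.1 hp
  have hq' := mem_Q0_one.1 hq
  have hD0 : ∀ t ∈ Ioo (-1 : ℝ) 0, ∀ x : E d, 2 ≤ ‖x‖ →
      (fun x => v (t, x)) =ᶠ[𝓝 x] fun _ => 0 := fun t ht x hx => by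
    have hopen : IsOpen {x : E d | 5 / 4 < ‖x‖} := isOpen_lt continuous_const continuous_norm
    filter_upwards [hopen.mem_nhds (show (5 / 4 : ℝ) < ‖x‖ by linarith)] with w hw
    exact hv0 t ht w (le_of_lt hw)
  have hD1 : ∀ t ∈ Ioo (-1 : ℝ) 0, ∀ x : E d, 2 ≤ ‖x‖ → fderiv ℝ (fun x => v (t, x)) x = 0 :=
    fun t ht x hx => by rw [(hD0 t ht x hx).fderiv_eq, fderiv_const_apply]
  have hD2 : ∀ t ∈ Ioo (-1 : ℝ) 0, ∀ x : E d, 2 ≤ ‖x‖ →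
      fderiv ℝ (fderiv ℝ (fun x => v (t, x))) x = 0 := fun t ht x hx => by
    rw [((hD0 t ht x hx).fderiv (𝕜 := ℝ)).fderiv_eq, fderiv_fun_const]
    exact fderiv_const_apply (0 : E d →L[ℝ] ℝ)
  have hspace : ∀ t ∈ Ioo (-1 : ℝ) 0, ∀ x x' : E d,
      ‖fderiv ℝ (fderiv ℝ (fun x => v (t, x))) x - fderiv ℝ (fderiv ℝ (fun x => v (t, x))) x'‖
        ≤ M * ‖x - x'‖ ^ γ := fun t ht x x' => by
    have h := hM (t, x) ht (t, x') ht
    rw [norm_iteratedFDeriv_two_sub] at h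
    simpa only [sub_self, abs_zero, Real.zero_rpow hβ.ne',
      max_eq_left (Real.rpow_nonneg (norm_nonneg (x - x')) γ)] using h
  have htime : ∀ x : E d, ‖fderiv ℝ (fderiv ℝ (fun x => v (p.1, x))) x
      - fderiv ℝ (fderiv ℝ (fun x => v (q.1, x))) x‖ ≤ M * m := fun x => by
    have h := hM (p.1, x) hp'.1 (q.1, x) hq'.1
    rw [norm_iteratedFDeriv_two_sub] at h
    simp only [sub_self, norm_zero, Real.zero_rpow hγ0.ne',
      max_eq_right (Real.rpow_nonneg (abs_nonneg (p.1 - q.1)) (α / σ))] at h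
    exact h.trans (by gcongr; exact le_max_right _ _)
  have hδ : ∀ (t : ℝ) (x y : E d), deltaU σ v t x y
      = (fun x => v (t, x)) (x + y) - (fun x => v (t, x)) x
        - fderiv ℝ (fun x => v (t, x)) x y := fun t x y => by
    simp only [deltaU, if_pos hσ1, Du]
  have hδ1 : ∀ y : E d, |deltaU σ v p.1 p.2 y| ≤ 32 * M * min (‖y‖ ^ 2) ‖y‖ := fun y => by
    rw [hδ]
    have h := norm_taylor_le_of_eq_zero (hv _ hp'.1) (B := 4 * M) (by positivity)
      (norm_le_of_holder_of_eq_zero (g := fderiv ℝ (fderiv ℝ fun x => v (p.1, x))) hM0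
        ⟨hγ0.le, hγ1⟩ (hspace _ hp'.1) (hD2 _ hp'.1))
      (hD1 _ hp'.1) p.2 y
    exact h.trans (le_of_eq (by ring))
  have hδ2 : ∀ y : E d, |deltaU σ v p.1 p.2 y - deltaU σ v q.1 q.2 y|
      ≤ M * min (R ^ γ * ‖y‖ ^ 2) (R * ‖y‖ ^ (γ + 1)) + 8 * (M * m) * min (‖y‖ ^ 2) ‖y‖ :=
    fun y => by
      rw [hδ, hδ]
      exact norm_taylor_sub_taylor_le (hv _ hp'.1) (hv _ hq'.1) hM0 (by positivity) hγ0.le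
        (hspace _ hp'.1) htime (hD1 _ hp'.1) (hD1 _ hq'.1) hR y
  have hI1 := integrable_min_rpow_mul_norm_rpow hd (p := 2) (q := 1) (σ := σ) hσ1 hσ2
  have hI2 := integrable_scaled_min hd (γ := γ) hR0 hσ2 (by linarith)
  have hI3 := integral_scaled_min (d := d) hR0 γ σ
  rw [show γ + 2 - σ = α by rw [hγ]; ring, hRm] at hI3
  rw [← integral_sub (hint p hp) (hint q hq)]
  have hbound : ∀ᵐ y : E d, ‖deltaU σ v p.1 p.2 y * (K p y - K (0, (0 : E d)) y)
      - deltaU σ v q.1 q.2 y * (K q y - K (0, (0 : E d)) y)‖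
      ≤ A0 * M * (Lam * (2 - σ)) * (80 * m) *
          (min (‖y‖ ^ (2 : ℝ)) (‖y‖ ^ (1 : ℝ)) * ‖y‖ ^ (-((d : ℝ) + σ)))
        + A0 * M * (Lam * (2 - σ)) * 2 * (min (R ^ γ * ‖y‖ ^ 2) (R * ‖y‖ ^ (γ + 1))
            * ‖y‖ ^ (-((d : ℝ) + σ))) := by
    filter_upwards [ae_ne_zero hd] with y hy
    rw [Real.rpow_two, Real.rpow_one]
    set κ := Lam * (2 - σ) * ‖y‖ ^ (-((d : ℝ) + σ)) with hκ
    have hκ0 : 0 ≤ κ := mul_nonneg (mul_nonneg hLam (by linarith))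
      (Real.rpow_nonneg (norm_nonneg _) _)
    have k1 : |K p y - K q y| ≤ A0 * (2 * m) * κ := (hK p q y hy).trans (by
      gcongr
      linarith [le_max_left (‖p.2 - q.2‖ ^ α) (|p.1 - q.1| ^ (α / σ)),
        le_max_right (‖p.2 - q.2‖ ^ α) (|p.1 - q.1| ^ (α / σ))])
    have k2 : |K q y - K (0, (0 : E d)) y| ≤ A0 * 2 * κ := (hK q _ y hy).trans (by
      have e1 : ‖q.2 - 0‖ ^ α ≤ 1 := by
        rw [sub_zero]; exact Real.rpow_le_one (norm_nonneg _) hq'.2.le hα0.le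
      have e2 : |q.1 - 0| ^ (α / σ) ≤ 1 := by
        rw [sub_zero]
        exact Real.rpow_le_one (abs_nonneg _) (abs_le.2 ⟨hq'.1.1.le, by linarith [hq'.1.2]⟩) hβ.le
      gcongr
      linarith)
    rw [Real.norm_eq_abs, show ∀ a b k k' k0 : ℝ, a * (k - k0) - b * (k' - k0)
      = a * (k - k') + (a - b) * (k' - k0) from fun _ _ _ _ _ => by ring]
    have hmin : 0 ≤ min (‖y‖ ^ 2) ‖y‖ := by positivity
    have hmin' : 0 ≤ min (R ^ γ * ‖y‖ ^ 2) (R * ‖y‖ ^ (γ + 1)) := by positivity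
    calc _ ≤ |deltaU σ v p.1 p.2 y| * |K p y - K q y|
          + |deltaU σ v p.1 p.2 y - deltaU σ v q.1 q.2 y| * |K q y - K (0, (0 : E d)) y| := by
          rw [← abs_mul, ← abs_mul]; exact abs_add_le _ _
      _ ≤ 32 * M * min (‖y‖ ^ 2) ‖y‖ * (A0 * (2 * m) * κ)
          + (M * min (R ^ γ * ‖y‖ ^ 2) (R * ‖y‖ ^ (γ + 1)) + 8 * (M * m) * min (‖y‖ ^ 2) ‖y‖)
            * (A0 * 2 * κ) := by
          gcongr
          · exact hδ1 y
          · exact hδ2 y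
      _ = _ := by rw [hκ]; ring
  refine (norm_integral_le_of_norm_le ((hI1.const_mul _).add (hI2.const_mul _)) hbound).trans
    (le_of_eq ?_)
  simp only [Pi.add_apply]
  rw [integral_add (hI1.const_mul _) (hI2.const_mul _), integral_const_mul, integral_const_mul,
    hI3]
  ring

/-- Hölder bound for `∫ (1 - η(t,x+y)) u(t,x+y) K(z,y) dy` when `1 - η` is quadratically small
off `Q₁`. -/
theorem norm_cutoff_sub_le (hd : 1 ≤ d) {σ Lam α A0 B N : ℝ} (hσ : σ ∈ Ioo (1 : ℝ) 2)
    (hLam : 0 ≤ Lam) (hα : α ∈ Ioo (0 : ℝ) 1) (hA0 : 0 ≤ A0) (hB0 : 0 ≤ B) (hN0 : 0 ≤ N)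
    {K : ℝ × E d → E d → ℝ}
    (hK0 : ∀ z : ℝ × E d, ∀ y : E d, y ≠ 0 →
      |K z y| ≤ Lam * (2 - σ) * ‖y‖ ^ (-((d : ℝ) + σ)))
    (hK : ∀ z z' : ℝ × E d, ∀ y : E d, y ≠ 0 → |K z y - K z' y| ≤
      A0 * (‖z.2 - z'.2‖ ^ α + |z.1 - z'.1| ^ (α / σ)) *
        (Lam * (2 - σ) * ‖y‖ ^ (-((d : ℝ) + σ))))
    {ζ u : ℝ × E d → ℝ}
    (hζ : ∀ z ∈ Q0 d σ 1, ∀ y : E d, |ζ (z.1, z.2 + y)| ≤ B * min (‖y‖ ^ 2) 1)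
    (hζ' : ∀ z ∈ Q0 d σ 1, ∀ z' ∈ Q0 d σ 1, ∀ y : E d,
      |ζ (z.1, z.2 + y) - ζ (z'.1, z'.2 + y)| ≤ B * min (‖y‖ ^ 2) 1 * ‖z - z'‖)
    (hu : ∀ p : ℝ × E d, p.1 ∈ Ioo (-1 : ℝ) 0 → |u p| ≤ N)
    (hu' : ∀ p : ℝ × E d, p.1 ∈ Ioo (-1 : ℝ) 0 → ∀ q : ℝ × E d, q.1 ∈ Ioo (-1 : ℝ) 0 →
      |u p - u q| ≤ N * max (‖p.2 - q.2‖ ^ α) (|p.1 - q.1| ^ (α / σ)))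
    (hint : ∀ z ∈ Q0 d σ 1,
      Integrable fun y : E d => ζ (z.1, z.2 + y) * u (z.1, z.2 + y) * K z y)
    {p q : ℝ × E d} (hp : p ∈ Q0 d σ 1) (hq : q ∈ Q0 d σ 1) :
    ‖(∫ y, ζ (p.1, p.2 + y) * u (p.1, p.2 + y) * K p y)
        - ∫ y, ζ (q.1, q.2 + y) * u (q.1, q.2 + y) * K q y‖
      ≤ (A0 + 1) * N * (Lam * (2 - σ)) * (3 * B) *
          (∫ y : E d, min (‖y‖ ^ (2 : ℝ)) (‖y‖ ^ (0 : ℝ)) * ‖y‖ ^ (-((d : ℝ) + σ)))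
        * max (‖p.2 - q.2‖ ^ α) (|p.1 - q.1| ^ (α / σ)) := by
  obtain ⟨hσ1, hσ2⟩ := hσ
  obtain ⟨hα0, hα1⟩ := hα
  have hβ1 : α / σ ≤ 1 := (div_le_one (by linarith)).2 (by linarith)
  have hβ0 : 0 < α / σ := by positivity
  set m := max (‖p.2 - q.2‖ ^ α) (|p.1 - q.1| ^ (α / σ)) with hm
  have hm1 : ‖p.2 - q.2‖ ^ α ≤ m := le_max_left _ _
  have hm2 : |p.1 - q.1| ^ (α / σ) ≤ m := le_max_right _ _
  have hm0 : 0 ≤ m := (Real.rpow_nonneg (norm_nonneg _) _).trans hm1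
  have hp' := mem_Q0_one.1 hp
  have hq' := mem_Q0_one.1 hq
  have hdist : ‖p - q‖ ≤ 2 * m := by
    refine max_le ?_ ?_
    · have h1 : |p.1 - q.1| ≤ 1 := abs_le.2
        ⟨by linarith [hp'.1.1, hq'.1.2], by linarith [hp'.1.2, hq'.1.1]⟩
      have := Real.rpow_le_rpow_of_exponent_ge' (abs_nonneg _) h1 hβ0.le hβ1
      rw [Real.rpow_one] at this
      change |p.1 - q.1| ≤ 2 * m
      linarith
    · have h1 : ‖p.2 - q.2‖ / 2 ≤ 1 := by linarith [norm_sub_le p.2 q.2, hp'.2, hq'.2]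
      have h3 := Real.rpow_le_rpow_of_exponent_ge' (by positivity) h1 hα0.le hα1.le
      rw [Real.rpow_one] at h3
      have h4 : (‖p.2 - q.2‖ / 2) ^ α ≤ ‖p.2 - q.2‖ ^ α := by
        gcongr
        linarith [norm_nonneg (p.2 - q.2)]
      change ‖p.2 - q.2‖ ≤ 2 * m
      linarith
  have hI := integrable_min_rpow_mul_norm_rpow hd (p := 2) (q := 0) (σ := σ) (by linarith) hσ2
  rw [← integral_sub (hint p hp) (hint q hq)]
  have hbound : ∀ᵐ y : E d, ‖ζ (p.1, p.2 + y) * u (p.1, p.2 + y) * K p y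
      - ζ (q.1, q.2 + y) * u (q.1, q.2 + y) * K q y‖
      ≤ (A0 + 1) * N * (Lam * (2 - σ)) * (3 * B) * m *
          (min (‖y‖ ^ (2 : ℝ)) (‖y‖ ^ (0 : ℝ)) * ‖y‖ ^ (-((d : ℝ) + σ))) := by
    filter_upwards [ae_ne_zero hd] with y hy
    rw [Real.rpow_two, Real.rpow_zero]
    set κ := Lam * (2 - σ) * ‖y‖ ^ (-((d : ℝ) + σ)) with hκ
    have hκ0 : 0 ≤ κ := mul_nonneg (mul_nonneg hLam (by linarith))
      (Real.rpow_nonneg (norm_nonneg _) _)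
    set w := min (‖y‖ ^ 2) (1 : ℝ)
    have hw : 0 ≤ w := by positivity
    have k1 : |K p y - K q y| ≤ A0 * (2 * m) * κ := (hK p q y hy).trans (by
      gcongr
      linarith)
    have u1 : |u (p.1, p.2 + y) - u (q.1, q.2 + y)| ≤ N * m := by
      have := hu' (p.1, p.2 + y) hp'.1 (q.1, q.2 + y) hq'.1
      simpa only [add_sub_add_right_eq_sub] using this
    rw [Real.norm_eq_abs, show ∀ a b c a' b' c' : ℝ, a * b * c - a' * b' * c'
      = a * b * (c - c') + (a - a') * b * c' + a' * (b - b') * c' from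
        fun _ _ _ _ _ _ => by ring]
    refine (abs_add_three _ _ _).trans ?_
    simp only [abs_mul]
    calc _ ≤ B * w * N * (A0 * (2 * m) * κ) + B * w * (2 * m) * N * κ + B * w * (N * m) * κ := by
          gcongr
          · exact hζ p hp y
          · exact hu _ hp'.1
          · exact (hζ' p hp q hq y).trans (by gcongr)
          · exact hu _ hp'.1
          · exact hK0 q y hy
          · exact hζ q hq y
          · exact hK0 q y hy
      _ = B * w * N * m * κ * (2 * A0 + 3) := by ring
      _ ≤ B * w * N * m * κ * (3 * (A0 + 1)) := by gcongr; linarith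
      _ = _ := by rw [hκ]; ring
  refine (norm_integral_le_of_norm_le (hI.const_mul _) hbound).trans (le_of_eq ?_)
  rw [integral_const_mul]
  ring

theorem contDiff_mul_of_eq_zero {V : Type*} [NormedAddCommGroup V] [NormedSpace ℝ V] {n : ℕ}
    {f g : V → ℝ} {r R : ℝ} (hrR : r < R) (hf : ContDiff ℝ n f)
    (hf0 : ∀ x, r ≤ ‖x‖ → f x = 0) (hg : ∀ x, ‖x‖ < R → ContDiffAt ℝ n g x) :
    ContDiff ℝ n fun x => f x * g x := by
  refine contDiff_iff_contDiffAt.2 fun x => ?_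
  rcases lt_or_ge ‖x‖ R with hx | hx
  · exact hf.contDiffAt.mul (hg x hx)
  · have h0 : (fun x => f x * g x) =ᶠ[nhds x] fun _ => 0 := by
      filter_upwards [(isOpen_lt continuous_const continuous_norm).mem_nhds
        (show r < ‖x‖ from hrR.trans_le hx)] with w hw
      rw [hf0 w (le_of_lt hw), zero_mul]
    exact contDiffAt_const.congr_of_eventuallyEq h0

theorem integral_min_rpow_nonneg (p q σ : ℝ) :
    0 ≤ ∫ y : E d, min (‖y‖ ^ p) (‖y‖ ^ q) * ‖y‖ ^ (-((d : ℝ) + σ)) :=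
  integral_nonneg fun y => by positivity

theorem isOpen_Q0 {σ r : ℝ} : IsOpen (Q0 d σ r) := isOpen_Ioo.prod isOpen_ball

theorem convex_Q0 {σ r : ℝ} : Convex ℝ (Q0 d σ r) := (convex_Ioo _ _).prod (convex_ball _ _)

theorem fderiv_slice_eq_zero {σ r : ℝ} {η : ℝ × E d → ℝ} {c : ℝ} (hη : ∀ z ∈ Q0 d σ r, η z = c)
    {z : ℝ × E d} (hz : z ∈ Q0 d σ r) : fderiv ℝ (fun x => η (z.1, x)) z.2 = 0 := by
  have h : (fun x => η (z.1, x)) =ᶠ[𝓝 z.2] fun _ => c := by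
    have hc : Continuous fun x : E d => (z.1, x) := by fun_prop
    filter_upwards [(isOpen_Q0.preimage hc).mem_nhds hz] with x hx
    exact hη _ hx
  rw [h.fderiv_eq, fderiv_const_apply]

end Frozen

end Nonlocal

/-- Lemma 4.5, estimates of `g_a` and `h_a` arising from freezing the
coefficients and from the cutoff. -/
theorem statement12 (d : ℕ) (hd : 1 ≤ d) (σ lam Lam : ℝ)
    (hσ : σ ∈ Ioo (1 : ℝ) 2) (hlam : 0 < lam) (hlL : lam ≤ Lam)
    (α : ℝ) (hα : α ∈ Ioo (0 : ℝ) 1) (h2 : 2 < σ + α) (hni : ∀ n : ℤ, σ + α ≠ (n : ℝ))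
    -- the fixed cutoff η
    (η : ℝ × E d → ℝ) (hηs : ContDiff ℝ (⊤ : ℕ∞) η) (hηnn : ∀ z, 0 ≤ η z)
    (hη1 : ∀ z ∈ Q0 d σ 1, η z = 1)
    (hη0 : ∀ z : ℝ × E d,
      z ∉ (Ioo (-((5 / 4 : ℝ) ^ σ)) ((5 / 4 : ℝ) ^ σ) ×ˢ ball (0 : E d) (5 / 4)) → η z = 0)
    :
    ∃ C : ℝ, 0 < C ∧
      ∀ A0 : ℝ, 0 ≤ A0 →
      ∀ (ι : Type) (K : ι → ℝ × E d → E d → ℝ) (u : ℝ × E d → ℝ),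
        -- kernels in L₀, Hölder continuous in (t,x)
        (∀ a, ∀ z : ℝ × E d, kernelBounds σ lam Lam (K a z)) →
        (∀ a, ∀ z : ℝ × E d, Measurable (K a z)) →
        (∀ a, ∀ z z' : ℝ × E d, ∀ y : E d, y ≠ 0 →
          |K a z y - K a z' y| ≤
            A0 * (‖z.2 - z'.2‖ ^ α + |z.1 - z'.1| ^ (α / σ)) *
              (Lam * (2 - σ) * ‖y‖ ^ (-((d : ℝ) + σ)))) →
        -- u ∈ C^{1+α/σ, σ+α}(Q_{11/8}) ∩ C^{α/σ, α}((-(11/8)^σ, 0) × ℝ^d)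
        (∀ z ∈ Q0 d σ (11 / 8), ContDiffAt ℝ (⌊σ + α⌋₊) (fun x => u (z.1, x)) z.2) →
        (∀ z ∈ Q0 d σ (11 / 8), DifferentiableAt ℝ (fun s => u (s, z.2)) z.1) →
        supENorm (Q0 d σ (11 / 8)) u + parab2Semi σ α (Q0 d σ (11 / 8)) u < ⊤ →
        pnormE (α / σ) α (Ioo (-((11 / 8 : ℝ) ^ σ)) 0 ×ˢ (univ : Set (E d))) u < ⊤ →
        -- integrability of the integrands defining g_a and h_a on Q₁
        (∀ a, ∀ z ∈ Q0 d σ 1,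
          Integrable (fun y : E d =>
            deltaU σ (fun w => η w * u w) z.1 z.2 y * (K a z y - K a (0, (0 : E d)) y)) ∧
          Integrable (fun y : E d =>
            ((η z - η (z.1, z.2 + y)) * u (z.1, z.2 + y)
              + (fderiv ℝ (fun x => η (z.1, x)) z.2 y) * u z) * K a z y)) →
        ∀ a,
          -- estimate of g_a
          holderE (α / σ) α (Q0 d σ 1)
              (fun z => ∫ y, deltaU σ (fun w => η w * u w) z.1 z.2 y *
                (K a z y - K a (0, (0 : E d)) y))
            ≤ ENNReal.ofReal (C * A0) *
                (parab2Semi σ α (lowerHalf d) (fun w => η w * u w)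
                  + holderE (α / σ) α (lowerHalf d) (fun w => η w * u w)) ∧
          -- estimate of h_a
          holderE (α / σ) α (Q0 d σ 1)
              (fun z => ∫ y, ((η z - η (z.1, z.2 + y)) * u (z.1, z.2 + y)
                + (fderiv ℝ (fun x => η (z.1, x)) z.2 y) * u z) * K a z y)
            ≤ ENNReal.ofReal (C * (A0 + 1)) *
                (pnormE (α / σ) α (Ioo (-((11 / 8 : ℝ) ^ σ)) 0 ×ˢ (univ : Set (E d))) u
                  + supENorm (Q0 d σ (11 / 8))
                      (fun z => iteratedFDeriv ℝ 2 (fun x => u (z.1, x)) z.2)) := by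
  have hσ1 := hσ.1
  have hσ2 := hσ.2
  have hα0 := hα.1
  have hα1 := hα.2
  have hLam : 0 < Lam := hlam.trans_le hlL
  have hfloor : ⌊σ + α⌋₊ = 2 := by
    rw [Nat.floor_eq_iff (by linarith)]
    push_cast
    constructor <;> linarith
  have hcs : HasCompactSupport η := by
    refine HasCompactSupport.intro
      (K := Icc (-((5 / 4 : ℝ) ^ σ)) ((5 / 4 : ℝ) ^ σ) ×ˢ closedBall (0 : E d) (5 / 4))
      (isCompact_Icc.prod (isCompact_closedBall _ _)) fun z hz => hη0 z fun hz' => hz ?_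
    exact ⟨Ioo_subset_Icc_self hz'.1, ball_subset_closedBall hz'.2⟩
  obtain ⟨B, hB0, hB1, hB2⟩ := exists_cutoff_bound hηs hcs isOpen_Q0 convex_Q0 hη1
  set I0 := ∫ y : E d, min (‖y‖ ^ (2 : ℝ)) (‖y‖ ^ (0 : ℝ)) * ‖y‖ ^ (-((d : ℝ) + σ)) with hI0
  set I1 := ∫ y : E d, min (‖y‖ ^ (2 : ℝ)) (‖y‖ ^ (1 : ℝ)) * ‖y‖ ^ (-((d : ℝ) + σ)) with hI1
  set I3 := ∫ y : E d, min (‖y‖ ^ (2 : ℝ)) (‖y‖ ^ (σ + α - 2 + 1)) * ‖y‖ ^ (-((d : ℝ) + σ))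
    with hI3
  have hI0' : 0 ≤ I0 := integral_min_rpow_nonneg _ _ _
  have hI1' : 0 ≤ I1 := integral_min_rpow_nonneg _ _ _
  have hI3' : 0 ≤ I3 := integral_min_rpow_nonneg _ _ _
  have hκ : 0 ≤ Lam * (2 - σ) := mul_nonneg hLam.le (by linarith)
  set Cg := Lam * (2 - σ) * (80 * I1 + 2 * I3) with hCg
  set Ch := Lam * (2 - σ) * (3 * B) * I0 with hCh
  have hCg0 : 0 ≤ Cg := by positivity
  have hCh0 : 0 ≤ Ch := by positivity
  refine ⟨Cg + Ch + 1, by positivity, ?_⟩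
  intro A0 hA0 ι K u hK0 hKm hK huC hut hufin hunorm hint a
  have h118 : 1 < (11 / 8 : ℝ) ^ σ := Real.one_lt_rpow (by norm_num) (by linarith)
  have htime : ∀ t ∈ Ioo (-1 : ℝ) 0, t ∈ Ioo (-((11 / 8 : ℝ) ^ σ)) 0 := fun t ht =>
    ⟨by linarith [ht.1], ht.2⟩
  constructor
  · set v : ℝ × E d → ℝ := fun w => η w * u w with hvdef
    rcases hA0.eq_or_lt with hA | hA
    · have hKc : ∀ z, ∀ᵐ y : E d, K a z y - K a (0, (0 : E d)) y = 0 := fun z => by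
        filter_upwards [ae_ne_zero hd] with y hy
        have := hK a z (0, 0) y hy
        rw [← hA, zero_mul, zero_mul] at this
        exact abs_nonpos_iff.1 this
      have hg0 : ∀ z : ℝ × E d, ∫ y, deltaU σ v z.1 z.2 y * (K a z y - K a (0, (0 : E d)) y) = 0 :=
        fun z => integral_eq_zero_of_ae <| by
          filter_upwards [hKc z] with y hy
          rw [hy, mul_zero, Pi.zero_apply]
      simp only [hg0]
      refine (holderE_le_ofReal le_rfl fun p _ q _ _ => ?_).trans (ENNReal.ofReal_zero.trans_le bot_le)
      simp
    · set X := parab2Semi σ α (lowerHalf d) v + holderE (α / σ) α (lowerHalf d) v with hX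
      rcases eq_or_ne X ⊤ with hXt | hXt
      · rw [hXt, ENNReal.mul_top (by positivity)]
        exact le_top
      have hDX : holderE (α / σ) (σ + α - 2) (lowerHalf d)
          (fun z => iteratedFDeriv ℝ 2 (fun x => v (z.1, x)) z.2) ≤ X := by
        rw [hX, parab2Semi, hfloor, Nat.cast_ofNat, add_assoc]
        exact le_self_add
      have hv0 : ∀ t : ℝ, ∀ x : E d, 5 / 4 ≤ ‖x‖ → η (t, x) = 0 := fun t x hx =>
        hη0 _ fun h => absurd (mem_ball_zero_iff.1 h.2) (not_lt.2 hx)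
      have hvC : ∀ t ∈ Ioo (-1 : ℝ) 0, ContDiff ℝ 2 fun x => v (t, x) := fun t ht => by
        refine contDiff_mul_of_eq_zero (n := 2) (show (5 / 4 : ℝ) < 11 / 8 by norm_num)
          ((hηs.of_le (WithTop.coe_le_coe.2 (le_top : (2 : ℕ∞) ≤ ⊤))).comp (contDiff_const.prodMk contDiff_id))
          (hv0 t) fun x hx => ?_
        have := huC (t, x) ⟨by simpa using htime t ht, mem_ball_zero_iff.2 hx⟩
        rwa [hfloor] at this
      refine (holderE_le_ofReal (c := A0 * X.toReal * Cg) (by positivity)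
        fun p hp q hq hpq => ?_).trans ?_
      · rw [hCg, ← mul_assoc]
        exact norm_frozen_sub_le hd hσ hLam.le hα h2 hA0 ENNReal.toReal_nonneg (hK a) hvC
          (fun t _ x hx => by simp only [hvdef, hv0 t x hx, zero_mul])
          (fun p hp q hq => norm_sub_le_of_holderE_le hXt hDX ⟨hp.2, mem_univ _⟩ ⟨hq.2, mem_univ _⟩)
          (fun z hz => (hint a z hz).1) hp hq hpq
      · rw [← ENNReal.ofReal_toReal hXt, ← ENNReal.ofReal_mul (by positivity),
          ENNReal.toReal_ofReal ENNReal.toReal_nonneg]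
        refine ENNReal.ofReal_le_ofReal ?_
        have : 0 ≤ A0 * X.toReal * (Ch + 1) := by positivity
        linarith
  · set Y := pnormE (α / σ) α (Ioo (-((11 / 8 : ℝ) ^ σ)) 0 ×ˢ (univ : Set (E d))) u with hY
    have hYt : Y ≠ ⊤ := hunorm.ne
    have hf : ∀ z ∈ Q0 d σ 1, (fun y => ((η z - η (z.1, z.2 + y)) * u (z.1, z.2 + y)
        + (fderiv ℝ (fun x => η (z.1, x)) z.2 y) * u z) * K a z y)
        = fun y => (1 - η (z.1, z.2 + y)) * u (z.1, z.2 + y) * K a z y := fun z hz => by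
      simp [fderiv_slice_eq_zero hη1 hz, hη1 z hz]
    have hmem : ∀ p : ℝ × E d, p.1 ∈ Ioo (-1 : ℝ) 0 →
        p ∈ Ioo (-((11 / 8 : ℝ) ^ σ)) 0 ×ˢ (univ : Set (E d)) := fun p hp =>
      ⟨htime _ hp, mem_univ _⟩
    refine (holderE_le_ofReal (c := (A0 + 1) * Y.toReal * Ch) (by positivity)
      fun p hp q hq _ => ?_).trans ?_
    · rw [hf p hp, hf q hq, hCh, ← mul_assoc, ← mul_assoc]
      refine norm_cutoff_sub_le hd hσ hLam.le hα hA0 hB0 ENNReal.toReal_nonneg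
        (ζ := fun z => 1 - η z) (fun z y hy => ?_) (hK a) (fun z hz y => ?_)
        (fun z hz z' hz' y => ?_)
        (fun p hp => norm_le_of_supENorm_le hYt (by rw [hY, pnormE]; exact le_self_add) (hmem p hp))
        (fun p hp q hq => norm_sub_le_of_holderE_le hYt (by rw [hY, pnormE]; exact le_add_self)
          (hmem p hp) (hmem q hq))
        (fun z hz => ?_) hp hq
      · obtain ⟨hl, hu⟩ := hK0 a z y hy
        have : 0 ≤ lam * (2 - σ) * ‖y‖ ^ (-((d : ℝ) + σ)) :=
          mul_nonneg (mul_nonneg hlam.le (by linarith)) (Real.rpow_nonneg (norm_nonneg _) _)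
        rwa [abs_of_nonneg (this.trans hl)]
      · simpa [Prod.add_def] using hB1 z hz (0, y)
      · have := hB2 z hz z' hz' (0, y)
        rw [abs_sub_comm] at this
        simpa [Prod.add_def] using this
      · rw [← hf z hz]
        exact (hint a z hz).2
    · have hle : ENNReal.ofReal ((A0 + 1) * Y.toReal * Ch)
          ≤ ENNReal.ofReal ((Cg + Ch + 1) * (A0 + 1)) * Y := by
        conv_rhs => rw [← ENNReal.ofReal_toReal hYt, ← ENNReal.ofReal_mul (by positivity)]
        refine ENNReal.ofReal_le_ofReal ?_
        have : 0 ≤ (A0 + 1) * Y.toReal * (Cg + 1) := by positivity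
        linarith
      exact hle.trans (by gcongr; exact le_self_add)
end
end
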